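/- For every integer m ≥ 1 there exists an integer r > 0 with the following property. If P is an induced path in ℤ² passing through the origin whose two endpoints both have ℓ1-norm greater than r+2, then there exists an induced path P' with the same two endpoints as P, whose vertex set agrees with that of P outside B¹_r (i.e. P' \ B¹_r = P \ B¹_r), and such that the intersection of the vertex set of P' with B¹_m is exactly the segment {(i,0) : −m ≤ i ≤ m}. -/

import Mathlib

/-- Grid adjacency in `ℤ²`: `u` and `v` are adjacent iff `‖u - v‖₁ = 1`. -/
def Adj2 (u v : ℤ × ℤ) : Prop := |u.1 - v.1| + |u.2 - v.2| = 1

/-- The `ℓ1`-norm of a point of `ℤ²`. -/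
def norm1 (x : ℤ × ℤ) : ℤ := |x.1| + |x.2|

/-- A (self-avoiding) path in the grid graph `ℤ²`: a nonempty list of distinct
points in which consecutive points are adjacent. -/
def IsPath2 (P : List (ℤ × ℤ)) : Prop :=
  P ≠ [] ∧ P.Nodup ∧ P.Chain' Adj2

/-- An induced path in `ℤ²`: a path in which two of its points are adjacent
iff they are consecutive. -/
def IsInducedPath2 (P : List (ℤ × ℤ)) : Prop :=
  IsPath2 P ∧ ∀ i j : Fin P.length, (i : ℕ) + 1 < (j : ℕ) → ¬ Adj2 (P.get i) (P.get j)

abbrev Cl := ℤ × ℤ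

theorem adj2_iff (u v : Cl) : Adj2 u v ↔
    (u.1 = v.1 ∧ (u.2 = v.2 + 1 ∨ v.2 = u.2 + 1)) ∨
    (u.2 = v.2 ∧ (u.1 = v.1 + 1 ∨ v.1 = u.1 + 1)) := by
  unfold Adj2
  constructor
  · intro h
    rcases abs_cases (u.1 - v.1) with ⟨h1, _⟩ | ⟨h1, _⟩ <;>
    rcases abs_cases (u.2 - v.2) with ⟨h2, _⟩ | ⟨h2, _⟩ <;> rw [h1, h2] at h <;> omega
  · intro h
    rcases abs_cases (u.1 - v.1) with ⟨h1, _⟩ | ⟨h1, _⟩ <;>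
    rcases abs_cases (u.2 - v.2) with ⟨h2, _⟩ | ⟨h2, _⟩ <;> rw [h1, h2] <;> omega

theorem adj2_mk (a b c d : ℤ) : Adj2 (a, b) (c, d) ↔
    (a = c ∧ (b = d + 1 ∨ d = b + 1)) ∨ (b = d ∧ (a = c + 1 ∨ c = a + 1)) := adj2_iff _ _

theorem adj2_symm {u v : Cl} (h : Adj2 u v) : Adj2 v u := by
  rw [adj2_iff] at *; omega

theorem adj2_comm {u v : Cl} : Adj2 u v ↔ Adj2 v u := ⟨adj2_symm, adj2_symm⟩

theorem adj2_irrefl (u : Cl) : ¬ Adj2 u u := by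
  rw [adj2_iff]; omega

theorem adj2_ne {u v : Cl} (h : Adj2 u v) : u ≠ v := by
  rintro rfl; exact adj2_irrefl _ h

/-- `IP R L`: the list `L` is an induced path for the relation `R`. -/
def IP (R : Cl → Cl → Prop) : List Cl → Prop
  | [] => True
  | [_] => True
  | x :: y :: t => x ≠ y ∧ R x y ∧ (∀ z ∈ t, x ≠ z ∧ ¬ R x z) ∧ IP R (y :: t)

theorem IP.tail {R : Cl → Cl → Prop} {x : Cl} {t : List Cl} (h : IP R (x :: t)) : IP R t := by
  cases t with
  | nil => trivial
  | cons y t => exact h.2.2.2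

theorem IP.not_mem {R : Cl → Cl → Prop} {x : Cl} {t : List Cl} (h : IP R (x :: t)) :
    ∀ z ∈ t, x ≠ z := by
  cases t with
  | nil => intro z hz; cases hz
  | cons y t =>
    intro z hz
    rcases List.mem_cons.1 hz with rfl | hz
    · exact h.1
    · exact (h.2.2.1 z hz).1

theorem IP.glue {R : Cl → Cl → Prop} {u : Cl} {B : List Cl} :
    ∀ {A : List Cl}, IP R (A ++ [u]) → IP R (u :: B) →
      (∀ x ∈ A, ∀ y ∈ B, x ≠ y ∧ ¬ R x y) → IP R (A ++ u :: B) := by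
  intro A
  induction A with
  | nil => intro _ h2 _; exact h2
  | cons x A ih =>
    intro h1 h2 h3
    have h4 := ih h1.tail h2 (fun z hz y hy => h3 z (List.mem_cons_of_mem _ hz) y hy)
    cases A with
    | nil =>
      refine ⟨h1.1, h1.2.1, ?_, h2⟩
      intro z hz; exact h3 x (by simp) z hz
    | cons y A =>
      refine ⟨h1.1, h1.2.1, ?_, h4⟩
      intro z hz
      rcases List.mem_append.1 hz with hz | hz
      · exact h1.2.2.1 z (by simp [hz])
      · rcases List.mem_cons.1 hz with rfl | hz
        · exact h1.2.2.1 _ (by simp)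
        · exact h3 x (by simp) z hz

theorem IP.left {R : Cl → Cl → Prop} {B : List Cl} :
    ∀ {A : List Cl}, IP R (A ++ B) → IP R A := by
  intro A
  induction A with
  | nil => intro _; trivial
  | cons x A ih =>
    intro h
    cases A with
    | nil => trivial
    | cons y A =>
      exact ⟨h.1, h.2.1, fun z hz => h.2.2.1 z (by simp [hz]), ih h.tail⟩

theorem IP.right {R : Cl → Cl → Prop} {B : List Cl} :
    ∀ {A : List Cl}, IP R (A ++ B) → IP R B := by
  intro A
  induction A with
  | nil => intro h; exact h
  | cons x A ih => intro h; exact ih h.tail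

/-- cross separation. -/
theorem IP.cross {R : Cl → Cl → Prop} {u : Cl} {B : List Cl} :
    ∀ {A : List Cl}, IP R (A ++ u :: B) → ∀ x ∈ A, ∀ y ∈ B, x ≠ y ∧ ¬ R x y := by
  intro A
  induction A with
  | nil => intro _ x hx; cases hx
  | cons x A ih =>
    intro h z hz y hy
    rcases List.mem_cons.1 hz with rfl | hz
    · cases A with
      | nil => exact h.2.2.1 y hy
      | cons w A => exact h.2.2.1 y (by simp [hy])
    · exact ih h.tail z hz y hy

theorem IP.reverse {R : Cl → Cl → Prop} (hs : ∀ x y, R x y → R y x) :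
    ∀ {A : List Cl}, IP R A → IP R A.reverse := by
  intro A
  induction A with
  | nil => intro _; trivial
  | cons x A ih =>
    intro h
    cases A with
    | nil => trivial
    | cons y A =>
      have h1 : IP R (A.reverse ++ [y]) := by simpa using ih h.tail
      have h2 : IP R [y, x] := ⟨h.1.symm, hs _ _ h.2.1, by simp, trivial⟩
      have := IP.glue h1 h2 (by
        intro z hz w hw
        simp at hw; subst hw
        have := h.2.2.1 z (by simpa using hz)
        exact ⟨this.1.symm, fun h => this.2 (hs _ _ h)⟩)
      simpa using this

theorem IP.congr {R S : Cl → Cl → Prop} :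
    ∀ {A : List Cl}, IP R A → (∀ x ∈ A, ∀ y ∈ A, x ≠ y → (R x y ↔ S x y)) → IP S A := by
  intro A
  induction A with
  | nil => intro _ _; trivial
  | cons x A ih =>
    intro h hc
    have h4 := ih h.tail (fun z hz y hy => hc z (List.mem_cons_of_mem _ hz) y (List.mem_cons_of_mem _ hy))
    cases A with
    | nil => trivial
    | cons y A =>
      refine ⟨h.1, (hc x (by simp) y (by simp) h.1).1 h.2.1, ?_, h4⟩
      intro z hz
      obtain ⟨h5, h6⟩ := h.2.2.1 z hz
      exact ⟨h5, fun h7 => h6 ((hc x (by simp) z (by simp [hz]) h5).2 h7)⟩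

theorem IP.shortcut {x : Cl} : ∀ {M : List Cl}, IP Adj2 M → (∃ y ∈ M, Adj2 x y ∨ x = y) →
    ∃ N, IP Adj2 (x :: N) ∧ (x :: N).getLast? = M.getLast? ∧ ∀ n ∈ N, n ∈ M := by
  intro M
  induction M with
  | nil => rintro _ ⟨y, hy, _⟩; cases hy
  | cons y t ih =>
    intro h hy
    by_cases ht : ∃ y ∈ t, Adj2 x y ∨ x = y
    · obtain ⟨N, h1, h2, h3⟩ := ih h.tail ht
      refine ⟨N, h1, ?_, fun n hn => List.mem_cons_of_mem _ (h3 n hn)⟩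
      rw [h2]
      cases t with
      | nil => obtain ⟨y, hy, _⟩ := ht; cases hy
      | cons a t => simp [List.getLast?_cons_cons]
    · obtain ⟨w, hw, hw2⟩ := hy
      have hwy : w = y := by
        rcases List.mem_cons.1 hw with h | h
        · exact h
        · exact absurd ⟨w, h, hw2⟩ ht
      subst hwy
      by_cases hxw : x = w
      · subst hxw
        exact ⟨t, h, rfl, fun n hn => List.mem_cons_of_mem _ hn⟩
      · have ha : Adj2 x w := by tauto
        refine ⟨w :: t, ⟨hxw, ha, ?_, h⟩, ?_, fun n hn => hn⟩
        · intro z hz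
          constructor
          · intro e; exact ht ⟨z, hz, Or.inr e⟩
          · intro e; exact ht ⟨z, hz, Or.inl e⟩
        · simp [List.getLast?_cons_cons]

/-- Connection inside a set. -/
def Conn (X : Set Cl) : Cl → Cl → Prop :=
  Relation.ReflTransGen (fun p q => Adj2 p q ∧ q ∈ X)

theorem Conn.mono {X Y : Set Cl} (h : X ⊆ Y) {u v : Cl} (c : Conn X u v) : Conn Y u v :=
  Relation.ReflTransGen.mono (fun _ _ hh => ⟨hh.1, h hh.2⟩) _ _ c

theorem Conn.trans {X : Set Cl} {u v w : Cl} (c : Conn X u v) (d : Conn X v w) : Conn X u w :=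
  Relation.ReflTransGen.trans c d

theorem Conn.single {X : Set Cl} {u v : Cl} (h : Adj2 u v) (hv : v ∈ X) : Conn X u v :=
  Relation.ReflTransGen.single ⟨h, hv⟩

theorem Conn.toIP {X : Set Cl} {u w : Cl} (c : Conn X u w) :
    ∃ M, IP Adj2 (u :: M) ∧ (u :: M).getLast? = some w ∧ ∀ m ∈ M, m ∈ X := by
  induction c using Relation.ReflTransGen.head_induction_on with
  | refl => exact ⟨[], trivial, rfl, by simp⟩
  | head h _ ih =>
    obtain ⟨M, h1, h2, h3⟩ := ih
    obtain ⟨N, h4, h5, h6⟩ := IP.shortcut h1 ⟨_, List.mem_cons_self, Or.inl h.1⟩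
    refine ⟨N, h4, by rw [h5, h2], ?_⟩
    intro n hn
    rcases List.mem_cons.1 (h6 n hn) with rfl | h7
    · exact h.2
    · exact h3 n h7

theorem Conn.right {X : Set Cl} {y : ℤ} {x1 x2 : ℤ} (h : x1 ≤ x2)
    (hX : ∀ x, x1 < x → x ≤ x2 → (x, y) ∈ X) : Conn X (x1, y) (x2, y) := by
  obtain ⟨n, rfl⟩ := Int.le.dest h
  clear h
  induction n with
  | zero => simp; exact Relation.ReflTransGen.refl
  | succ n ih =>
    refine Conn.trans (ih (fun x h1 h2 => hX x h1 (by push_cast; omega))) (Conn.single ?_ (hX _ ?_ ?_))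
    · rw [adj2_mk]; push_cast; omega
    · push_cast; omega
    · omega

theorem Conn.leftw {X : Set Cl} {y : ℤ} {x1 x2 : ℤ} (h : x1 ≤ x2)
    (hX : ∀ x, x1 ≤ x → x < x2 → (x, y) ∈ X) : Conn X (x2, y) (x1, y) := by
  obtain ⟨n, hn⟩ := Int.le.dest h
  clear h
  induction n generalizing x1 with
  | zero => simp at hn; subst hn; exact Relation.ReflTransGen.refl
  | succ n ih =>
    refine Conn.trans (ih (x1 := x1 + 1) (fun x h1 h2 => hX x (by omega) h2) (by push_cast at hn; omega)) (Conn.single ?_ (hX _ ?_ ?_))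
    · rw [adj2_mk]; omega
    · omega
    · push_cast at hn; omega

theorem Conn.up {X : Set Cl} {x : ℤ} {y1 y2 : ℤ} (h : y1 ≤ y2)
    (hX : ∀ y, y1 < y → y ≤ y2 → (x, y) ∈ X) : Conn X (x, y1) (x, y2) := by
  obtain ⟨n, rfl⟩ := Int.le.dest h
  clear h
  induction n with
  | zero => simp; exact Relation.ReflTransGen.refl
  | succ n ih =>
    refine Conn.trans (ih (fun x h1 h2 => hX x h1 (by push_cast; omega))) (Conn.single ?_ (hX _ ?_ ?_))
    · rw [adj2_mk]; push_cast; omega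
    · push_cast; omega
    · omega

theorem Conn.down {X : Set Cl} {x : ℤ} {y1 y2 : ℤ} (h : y1 ≤ y2)
    (hX : ∀ y, y1 ≤ y → y < y2 → (x, y) ∈ X) : Conn X (x, y2) (x, y1) := by
  obtain ⟨n, hn⟩ := Int.le.dest h
  clear h
  induction n generalizing y1 with
  | zero => simp at hn; subst hn; exact Relation.ReflTransGen.refl
  | succ n ih =>
    refine Conn.trans (ih (y1 := y1 + 1) (fun x h1 h2 => hX x (by omega) h2) (by push_cast at hn; omega)) (Conn.single ?_ (hX _ ?_ ?_))
    · rw [adj2_mk]; omega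
    · omega
    · push_cast at hn; omega

/-- Adjacency plus one virtual edge `ab`. -/
def Gam (a b u v : Cl) : Prop := Adj2 u v ∨ (u = a ∧ v = b) ∨ (u = b ∧ v = a)

theorem gam_symm {a b u v : Cl} (h : Gam a b u v) : Gam a b v u := by
  rcases h with h | h | h
  · exact Or.inl (adj2_symm h)
  · exact Or.inr (Or.inr ⟨h.2, h.1⟩)
  · exact Or.inr (Or.inl ⟨h.2, h.1⟩)

theorem gam_iff {a b u v : Cl} (ha : u ≠ a) (hb : u ≠ b) : Gam a b u v ↔ Adj2 u v := by
  unfold Gam; tauto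

theorem gam_iff' {a b u v : Cl} (ha : v ≠ a) (hb : v ≠ b) : Gam a b u v ↔ Adj2 u v := by
  unfold Gam; tauto

theorem IP.join3 {R : Cl → Cl → Prop} (hs : ∀ x y, R x y → R y x) {A B C : List Cl} {e1 e2 : Cl}
    (h1 : IP R (A ++ [e1])) (h2 : IP R (e2 :: B)) (hC : IP Adj2 (e1 :: (C ++ [e2])))
    (hsep : ∀ u ∈ A ++ [e1], ∀ v ∈ e2 :: B, u ≠ v ∧ ¬ R u v)
    (hR : ∀ c ∈ C, ∀ v, R c v ↔ Adj2 c v)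
    (hR12 : Adj2 e1 e2 → R e1 e2)
    (hnew : ∀ c ∈ C, ∀ v, (v ∈ A ++ [e1] ∨ v ∈ e2 :: B) → c ≠ v ∧ (Adj2 c v → v = e1 ∨ v = e2)) :
    IP R (A ++ e1 :: (C ++ e2 :: B)) := by
  have hR' : ∀ c ∈ C, ∀ v, R v c ↔ Adj2 v c := fun c hc v =>
    ⟨fun h => adj2_symm ((hR c hc v).1 (hs _ _ h)), fun h => hs _ _ ((hR c hc v).2 (adj2_symm h))⟩
  have hC' : IP R (e1 :: (C ++ [e2])) := by
    refine hC.congr ?_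
    intro x hx y hy hxy
    by_cases hxc : x ∈ C
    · exact (hR x hxc y).symm
    by_cases hyc : y ∈ C
    · exact (hR' y hyc x).symm
    have key : ∀ z, z ∈ e1 :: (C ++ [e2]) → z ∉ C → z = e1 ∨ z = e2 := by
      intro z hz hzc
      simp at hz; tauto
    have h12 := hsep e1 (by simp) e2 (by simp)
    rcases key x hx hxc with rfl | rfl <;> rcases key y hy hyc with rfl | rfl
    · exact absurd rfl hxy
    · exact ⟨hR12, fun h => absurd h h12.2⟩
    · exact ⟨fun h => hs _ _ (hR12 (adj2_symm h)), fun h => absurd (hs _ _ h) h12.2⟩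
    · exact absurd rfl hxy
  have h3 : IP R ((e1 :: C) ++ e2 :: B) := by
    refine IP.glue (by simpa using hC') h2 ?_
    intro x hx y hy
    rcases List.mem_cons.1 hx with rfl | hx
    · exact hsep _ (by simp) y (by simp [hy])
    · have := hnew x hx y (Or.inr (by simp [hy]))
      refine ⟨this.1, fun h => ?_⟩
      rcases this.2 ((hR x hx y).1 h) with rfl | rfl
      · exact (hsep y (by simp) y (by simp [hy])).1 rfl
      · exact h2.not_mem y hy rfl
  refine IP.glue h1 (by simpa using h3) ?_
  intro x hx y hy
  rcases List.mem_append.1 hy with hy | hy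
  · have := hnew y hy x (Or.inl (by simp [hx]))
    refine ⟨this.1.symm, fun h => ?_⟩
    rcases this.2 ((hR y hy x).1 (hs _ _ h)) with rfl | rfl
    · have h5 := IP.reverse hs h1
      simp only [List.reverse_append, List.reverse_cons, List.reverse_nil, List.nil_append, List.singleton_append] at h5
      exact h5.not_mem x (by simpa using hx) rfl
    · exact (hsep x (by simp [hx]) x (by simp)).1 rfl
  · exact hsep x (by simp [hx]) y hy

theorem ex_cons {p : List Cl → Prop} {N : List Cl} {Ls : List (List Cl)} :
    (∃ L ∈ N :: Ls, p L) ↔ p N ∨ ∃ L ∈ Ls, p L := by simp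

theorem prop_aux1 (p q r s : Prop) : ((p ∨ q ∨ r) ∨ s) ↔ (((p ∨ q) ∨ s) ∨ r) := by tauto

theorem prop_aux2 (p r s : Prop) : ((p ∨ r) ∨ s) ↔ ((p ∨ s) ∨ r) := by tauto

/-- separated lists -/
def SepL (a b : Cl) (L M : List Cl) : Prop := ∀ u ∈ L, ∀ v ∈ M, u ≠ v ∧ ¬ Gam a b u v

theorem SepL.symm {a b : Cl} {L M : List Cl} (h : SepL a b L M) : SepL a b M L :=
  fun u hu v hv => ⟨(h v hv u hu).1.symm, fun g => (h v hv u hu).2 (gam_symm g)⟩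

def IsEnd (L : List Cl) (e : Cl) : Prop := L.head? = some e ∨ L.getLast? = some e

def Good (a b : Cl) (Ls : List (List Cl)) : Prop :=
  (∀ L ∈ Ls, IP (Gam a b) L ∧ 2 ≤ L.length) ∧ Ls.Pairwise (SepL a b)

/-- A system of pairwise separated induced paths with cell set `V` and end set `E`. -/
def Sys (a b : Cl) (V E : Set Cl) : Prop :=
  a ∈ V ∧ b ∈ V ∧ ∃ Ls : List (List Cl), Good a b Ls ∧ (∀ x, x ∈ V ↔ ∃ L ∈ Ls, x ∈ L) ∧
    ∀ x, x ∈ E ↔ ∃ L ∈ Ls, IsEnd L x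

theorem Sys.congr {a b : Cl} {V E V' E' : Set Cl} (h : Sys a b V E) (hV : ∀ x, x ∈ V ↔ x ∈ V')
    (hE : ∀ x, x ∈ E ↔ x ∈ E') : Sys a b V' E' := by
  have h1 : V = V' := Set.ext hV
  have h2 : E = E' := Set.ext hE
  rw [← h1, ← h2]; exact h

theorem IsEnd.mem {L : List Cl} {e : Cl} (h : IsEnd L e) : e ∈ L := by
  rcases h with h | h
  · exact List.mem_of_mem_head? h
  · exact List.mem_of_getLast? h

theorem IsEnd.reverse {L : List Cl} {e : Cl} : IsEnd L.reverse e ↔ IsEnd L e := by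
  unfold IsEnd; simp; tauto

theorem Sys.sub {a b : Cl} {V E : Set Cl} (h : Sys a b V E) {e : Cl} (he : e ∈ E) : e ∈ V := by
  obtain ⟨_, _, Ls, _, h1, h2⟩ := h
  obtain ⟨L, hL, h3⟩ := (h2 e).1 he
  exact (h1 e).2 ⟨L, hL, h3.mem⟩

theorem Sys.finite {a b : Cl} {V E : Set Cl} (h : Sys a b V E) : V.Finite := by
  obtain ⟨_, _, Ls, _, h1, h2⟩ := h
  refine Set.Finite.subset (List.finite_toSet Ls.flatten) ?_
  intro x hx
  obtain ⟨L, hL, h3⟩ := (h1 x).1 hx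
  exact List.mem_flatten.2 ⟨L, hL, h3⟩

theorem Sys.finiteE {a b : Cl} {V E : Set Cl} (h : Sys a b V E) : E.Finite :=
  h.finite.subset (fun _ he => h.sub he)

theorem Good.perm {a b : Cl} {Ls Ms : List (List Cl)} (h : Good a b Ls) (p : Ls.Perm Ms) :
    Good a b Ms :=
  ⟨fun L hL => h.1 L (p.mem_iff.2 hL), (p.pairwise_iff (fun h => SepL.symm h)).1 h.2⟩

theorem Good.tail {a b : Cl} {L} {Ls : List (List Cl)} (h : Good a b (L :: Ls)) : Good a b Ls :=
  ⟨fun M hM => h.1 M (by simp [hM]), (List.pairwise_cons.1 h.2).2⟩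

theorem Good.sep {a b : Cl} {L} {Ls : List (List Cl)} (h : Good a b (L :: Ls)) :
    ∀ M ∈ Ls, SepL a b L M := (List.pairwise_cons.1 h.2).1

theorem Good.cons {a b : Cl} {L} {Ls : List (List Cl)} (h : Good a b Ls)
    (h1 : IP (Gam a b) L) (h2 : 2 ≤ L.length) (h3 : ∀ M ∈ Ls, SepL a b L M) : Good a b (L :: Ls) :=
  ⟨fun M hM => by
    rcases List.mem_cons.1 hM with rfl | hM
    · exact ⟨h1, h2⟩
    · exact h.1 M hM, List.pairwise_cons.2 ⟨h3, h.2⟩⟩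

theorem Good.rev {a b : Cl} {L} {Ls : List (List Cl)} (h : Good a b (L :: Ls)) :
    Good a b (L.reverse :: Ls) :=
  h.tail.cons (IP.reverse (fun _ _ => gam_symm) (h.1 L (by simp)).1) (by simpa using (h.1 L (by simp)).2)
    (fun M hM u hu v hv => h.sep M hM u (by simpa using hu) v hv)

theorem Good.uniq {a b : Cl} : ∀ {Ls : List (List Cl)} (_ : Good a b Ls) {L M : List Cl} {x : Cl},
    L ∈ Ls → M ∈ Ls → x ∈ L → x ∈ M → L = M := by
  intro Ls
  induction Ls with
  | nil => intro _ L M x h; cases h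
  | cons N Ls ih =>
    intro h L M x hL hM hx hy
    rcases List.mem_cons.1 hL with e1 | hL' <;> rcases List.mem_cons.1 hM with e2 | hM'
    · rw [e1, e2]
    · subst e1; exact absurd rfl (h.sep M hM' x hx x hy).1
    · subst e2; exact absurd rfl (h.sep L hL' x hy x hx).1
    · exact ih h.tail hL' hM' hx hy

/-- Bring a list with given end to the front, ending at that end. -/
theorem Good.front {a b : Cl} {Ls : List (List Cl)} (h : Good a b Ls) {e : Cl} {L : List Cl}
    (hL : L ∈ Ls) (he : IsEnd L e) : ∃ (f : Cl) (A : List Cl) (Ms : List (List Cl)),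
      Good a b ((f :: (A ++ [e])) :: Ms) ∧ (∀ N, N ∈ Ms → N ∈ Ls) ∧
      (∀ N, N ∈ Ls ↔ N = L ∨ N ∈ Ms) ∧ L ∉ Ms ∧ (∀ x, x ∈ L ↔ x ∈ f :: (A ++ [e])) ∧
      (∀ x, IsEnd L x ↔ (x = f ∨ x = e)) ∧ f ≠ e := by
  have p : Ls.Perm (L :: Ls.erase L) := List.perm_cons_erase hL
  have h1 := h.perm p
  have hlen := (h1.1 L (by simp)).2
  have hnm : L ∉ Ls.erase L := by
    intro hh
    obtain ⟨x, hx⟩ : ∃ x, x ∈ L := by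
      cases L with
      | nil => simp at hlen
      | cons x t => exact ⟨x, by simp⟩
    exact (h1.sep L hh x hx x hx).1 rfl
  have hor : ∃ f A, (L = f :: (A ++ [e]) ∨ L.reverse = f :: (A ++ [e])) := by
    rcases he with he | he
    · have : L.reverse.getLast? = some e := by simpa using he
      obtain ⟨ys, hys⟩ := List.getLast?_eq_some_iff.1 this
      cases ys with
      | nil => have := congrArg List.length hys; simp at this; omega
      | cons f A => exact ⟨f, A, Or.inr (by simpa using hys)⟩
    · obtain ⟨ys, hys⟩ := List.getLast?_eq_some_iff.1 he
      cases ys with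
      | nil => have := congrArg List.length hys; simp at this; omega
      | cons f A => exact ⟨f, A, Or.inl (by simpa using hys)⟩
  obtain ⟨f, A, hfA⟩ := hor
  have hg : Good a b ((f :: (A ++ [e])) :: Ls.erase L) := by
    rcases hfA with hh | hh
    · rw [← hh]; exact h1
    · rw [← hh]; exact h1.rev
  refine ⟨f, A, Ls.erase L, hg, fun N hN => List.mem_of_mem_erase hN, ?_, hnm, ?_, ?_, ?_⟩
  · intro N; rw [p.mem_iff, List.mem_cons]
  · intro x
    rcases hfA with hh | hh
    · rw [← hh]
    · rw [← hh]; simp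
  · intro x
    have key : IsEnd (f :: (A ++ [e])) x ↔ (x = f ∨ x = e) := by
      have e0 : f :: (A ++ [e]) = (f :: A) ++ [e] := rfl
      unfold IsEnd
      rw [e0, List.getLast?_append]; simp [eq_comm]
    rw [← key]
    rcases hfA with hh | hh
    · rw [← hh]
    · rw [← hh]; exact IsEnd.reverse.symm
  · exact (hg.1 _ List.mem_cons_self).1.not_mem e (by simp)

theorem conn_split {X : Set Cl} {e1 e2 : Cl} (hne : e1 ≠ e2) (hc : Conn (X ∪ {e2}) e1 e2) :
    ∃ C, IP Adj2 (e1 :: (C ++ [e2])) ∧ ∀ c ∈ C, c ∈ X := by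
  obtain ⟨M, h1, h2, h3⟩ := hc.toIP
  obtain ⟨ys, hys⟩ := List.getLast?_eq_some_iff.1 h2
  cases ys with
  | nil => simp at hys; exact absurd hys.1 hne
  | cons f C =>
    simp at hys
    obtain ⟨rfl, rfl⟩ := hys
    refine ⟨C, h1, ?_⟩
    intro c hc
    rcases h3 c (by simp [hc]) with h | h
    · exact h
    · have h4 : IP Adj2 ((e1 :: C) ++ [e2]) := by simpa using h1
      have h5 := IP.reverse (fun _ _ => adj2_symm) h4
      simp only [List.reverse_append, List.reverse_cons, List.reverse_nil, List.nil_append, List.singleton_append] at h5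
      have : e2 ≠ c := h5.not_mem c (by simp [hc])
      exact absurd h.symm this

/-- Cells of `X` are free, and touch `V` only in `S`. -/
def Clear (V S X : Set Cl) : Prop := ∀ c ∈ X, c ∉ V ∧ ∀ v ∈ V, Adj2 c v → v ∈ S

theorem Sys.join {a b : Cl} {V E : Set Cl} {e1 e2 : Cl} {X : Set Cl} {Ls : List (List Cl)}
    (ha : a ∈ V) (hb : b ∈ V) (hG : Good a b Ls) (hV : ∀ x, x ∈ V ↔ ∃ L ∈ Ls, x ∈ L)
    (hE : ∀ x, x ∈ E ↔ ∃ L ∈ Ls, IsEnd L x) {L1 L2 : List Cl}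
    (hL1 : L1 ∈ Ls) (hL2 : L2 ∈ Ls) (he1 : IsEnd L1 e1) (he2 : IsEnd L2 e2) (hne : L1 ≠ L2)
    (hX : Clear V {e1, e2} X) (hc : Conn (X ∪ {e2}) e1 e2) :
    ∃ C : Set Cl, C ⊆ X ∧ Sys a b (V ∪ C) (E \ {e1, e2}) := by
  obtain ⟨f1, A, Ms, g1, g2, g3, g4, g5, g6, g7⟩ := hG.front hL1 he1
  have hL2' : L2 ∈ Ms := ((g3 L2).1 hL2).resolve_left (Ne.symm hne)
  obtain ⟨f2, B, Ns, k1, k2, k3, k4, k5, k6, k7⟩ := g1.tail.front hL2' he2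
  have sep12 : ∀ u ∈ f1 :: (A ++ [e1]), ∀ v ∈ f2 :: (B ++ [e2]), u ≠ v ∧ ¬ Gam a b u v := by
    intro u hu v hv
    exact g1.sep L2 hL2' u hu v ((k5 v).2 hv)
  have hne12 : e1 ≠ e2 := (sep12 e1 (by simp) e2 (by simp)).1
  obtain ⟨C, hC, hCX⟩ := conn_split hne12 hc
  have hCV : ∀ c ∈ C, c ∉ V := fun c h => (hX c (hCX c h)).1
  have hCR : ∀ c ∈ C, ∀ v, Gam a b c v ↔ Adj2 c v := fun c h v =>
    gam_iff (fun hh => hCV c h (hh ▸ ha)) (fun hh => hCV c h (hh ▸ hb))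
  have inV1 : ∀ x ∈ f1 :: (A ++ [e1]), x ∈ V := fun x hx => (hV x).2 ⟨L1, hL1, (g5 x).2 hx⟩
  have inV2 : ∀ x ∈ f2 :: (B ++ [e2]), x ∈ V := fun x hx => (hV x).2 ⟨L2, hL2, (k5 x).2 hx⟩
  have hrev : IP (Gam a b) (e2 :: (B.reverse ++ [f2])) := by
    have := IP.reverse (fun _ _ => gam_symm) (k1.1 _ List.mem_cons_self).1
    simpa using this
  have hnew : IP (Gam a b) ((f1 :: A) ++ e1 :: (C ++ e2 :: (B.reverse ++ [f2]))) := by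
    refine IP.join3 (fun _ _ => gam_symm) (by simpa using (g1.1 _ List.mem_cons_self).1) hrev hC ?_ hCR
      (fun h => Or.inl h) ?_
    · intro u hu v hv
      exact sep12 u (by simpa using hu) v (by simp at hv ⊢; tauto)
    · intro c hc v hv
      have hvV : v ∈ V := by
        rcases hv with hv | hv
        · exact inV1 v (by simpa using hv)
        · exact inV2 v (by simp at hv ⊢; tauto)
      exact ⟨fun h => hCV c hc (h ▸ hvV), fun h => (hX c (hCX c hc)).2 v hvV h⟩
  have memnew : ∀ x, x ∈ (f1 :: A) ++ e1 :: (C ++ e2 :: (B.reverse ++ [f2])) ↔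
      (x ∈ L1 ∨ x ∈ L2) ∨ x ∈ C := by
    intro x; rw [g5, k5]; simp; tauto
  have e0 : ∀ x, IsEnd ((f1 :: A) ++ e1 :: (C ++ e2 :: (B.reverse ++ [f2]))) x ↔ x = f1 ∨ x = f2 := by
    intro x
    unfold IsEnd
    have : (f1 :: A) ++ e1 :: (C ++ e2 :: (B.reverse ++ [f2])) =
      ((f1 :: A) ++ e1 :: (C ++ e2 :: (B.reverse))) ++ [f2] := by simp
    rw [this, List.getLast?_append]; simp [eq_comm]
  have hlen : 2 ≤ ((f1 :: A) ++ e1 :: (C ++ e2 :: (B.reverse ++ [f2]))).length := by simp; omega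
  revert hnew memnew e0 hlen
  generalize (f1 :: A) ++ e1 :: (C ++ e2 :: (B.reverse ++ [f2])) = NL
  intro hnew memnew e0 hlen
  have hNsub : ∀ N ∈ Ns, N ∈ Ls := fun N hN => g2 N (k2 N hN)
  refine ⟨{c | c ∈ C}, hCX, Or.inl ha, Or.inl hb,
    NL :: Ns, ?_, ?_, ?_⟩
  · refine k1.tail.cons hnew hlen ?_
    intro M hM u hu v hv
    rcases (memnew u).1 hu with (hu | hu) | hu
    · exact g1.sep M (k2 M hM) u ((g5 u).1 hu) v hv
    · exact k1.sep M hM u ((k5 u).1 hu) v hv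
    · have hvV : v ∈ V := (hV v).2 ⟨M, hNsub M hM, hv⟩
      refine ⟨fun h => hCV u hu (h ▸ hvV), fun h => ?_⟩
      rcases (hX u (hCX u hu)).2 v hvV ((hCR u hu v).1 h) with h | h
      · exact (g1.sep M (k2 M hM) e1 (by simp) v hv).1 h.symm
      · exact (k1.sep M hM e2 (by simp) v hv).1 h.symm
  · intro x
    rw [ex_cons, Set.mem_union, Set.mem_ofPred_eq, hV]
    have : (∃ L ∈ Ls, x ∈ L) ↔ (x ∈ L1 ∨ x ∈ L2 ∨ ∃ L ∈ Ns, x ∈ L) := by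
      constructor
      · rintro ⟨L, hL, hx⟩
        rcases (g3 L).1 hL with rfl | h
        · exact Or.inl hx
        · rcases (k3 L).1 h with rfl | h
          · exact Or.inr (Or.inl hx)
          · exact Or.inr (Or.inr ⟨L, h, hx⟩)
      · rintro (h | h | ⟨L, hL, h⟩)
        · exact ⟨_, hL1, h⟩
        · exact ⟨_, hL2, h⟩
        · exact ⟨_, hNsub L hL, h⟩
    rw [this, memnew]
    exact prop_aux1 _ _ _ _
  · intro x
    rw [ex_cons, Set.mem_sdiff, Set.mem_insert_iff, Set.mem_singleton_iff, hE, e0]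
    constructor
    · rintro ⟨⟨L, hL, hx⟩, hx2⟩
      rcases (g3 L).1 hL with rfl | h
      · left; rcases (g6 x).1 hx with h | h <;> tauto
      · rcases (k3 L).1 h with rfl | h
        · left; rcases (k6 x).1 hx with h | h <;> tauto
        · exact Or.inr ⟨L, h, hx⟩
    · rintro ((rfl | rfl) | ⟨L, hL, hx⟩)
      · refine ⟨⟨L1, hL1, (g6 _).2 (Or.inl rfl)⟩, ?_⟩
        rintro (h | h)
        · exact g7 h
        · exact (sep12 x (by simp) e2 (by simp)).1 h
      · refine ⟨⟨L2, hL2, (k6 _).2 (Or.inl rfl)⟩, ?_⟩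
        rintro (h | h)
        · exact (sep12 e1 (by simp) x (by simp)).1 h.symm
        · exact k7 h
      · refine ⟨⟨L, hNsub L hL, hx⟩, ?_⟩
        rintro (h | h)
        · exact (g1.sep L (k2 L hL) e1 (by simp) x hx.mem).1 h.symm
        · exact (k1.sep L hL e2 (by simp) x hx.mem).1 h.symm

theorem Sys.merge3 {a b : Cl} {V E : Set Cl} (h : Sys a b V E) {e1 e2 e3 : Cl}
    (h1 : e1 ∈ E) (h2 : e2 ∈ E) (h3 : e3 ∈ E) (n12 : e1 ≠ e2) (n23 : e2 ≠ e3) (n13 : e1 ≠ e3)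
    {X Y : Set Cl} (hX : Clear V {e1, e2} X) (hcX : Conn (X ∪ {e2}) e1 e2)
    (hY : Clear V {e2, e3} Y) (hcY : Conn (Y ∪ {e3}) e2 e3) :
    (∃ C : Set Cl, C ⊆ X ∧ Sys a b (V ∪ C) (E \ {e1, e2})) ∨
    (∃ C : Set Cl, C ⊆ Y ∧ Sys a b (V ∪ C) (E \ {e2, e3})) := by
  obtain ⟨ha, hb, Ls, hG, hV, hE⟩ := h
  obtain ⟨L1, hL1, k1⟩ := (hE e1).1 h1
  obtain ⟨L2, hL2, k2⟩ := (hE e2).1 h2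
  obtain ⟨L3, hL3, k3⟩ := (hE e3).1 h3
  by_cases c12 : L1 = L2
  · by_cases c23 : L2 = L3
    · exfalso
      subst c12; subst c23
      rcases k1 with k1 | k1 <;> rcases k2 with k2 | k2 <;> rcases k3 with k3 | k3 <;>
        rw [k1] at * <;> simp_all
    · right
      exact Sys.join ha hb hG hV hE hL2 hL3 k2 k3 c23 hY hcY
  · left
    exact Sys.join ha hb hG hV hE hL1 hL2 k1 k2 c12 hX hcX

theorem Sys.extend {a b : Cl} {V E : Set Cl} (h : Sys a b V E) {e w : Cl} (he : e ∈ E)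
    {X : Set Cl} (hX : Clear V {e} X) (hc : Conn X e w) (hw : w ∈ X) :
    ∃ C : Set Cl, C ⊆ X ∧ Sys a b (V ∪ C) (E \ {e} ∪ {w}) := by
  have heV := h.sub he
  obtain ⟨ha, hb, Ls, hG, hV, hE⟩ := h
  obtain ⟨L, hL, k⟩ := (hE e).1 he
  obtain ⟨f, A, Ms, g1, g2, g3, g4, g5, g6, g7⟩ := hG.front hL k
  have hwV : w ∉ V := (hX w hw).1
  have hwe : e ≠ w := fun h => hwV (h ▸ heV)
  obtain ⟨C, hC, hCX⟩ := conn_split hwe (hc.mono (Set.subset_union_left))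
  have hDX : ∀ c ∈ C ++ [w], c ∈ X := by
    intro c hc; simp at hc; rcases hc with hc | rfl
    · exact hCX c hc
    · exact hw
  have hCV : ∀ c ∈ C ++ [w], c ∉ V := fun c h => (hX c (hDX c h)).1
  have hCR : ∀ c ∈ C ++ [w], ∀ v, Gam a b v c ↔ Adj2 v c := fun c h v =>
    gam_iff' (fun hh => hCV c h (hh ▸ ha)) (fun hh => hCV c h (hh ▸ hb))
  have inV : ∀ x ∈ f :: (A ++ [e]), x ∈ V := fun x hx => (hV x).2 ⟨L, hL, (g5 x).2 hx⟩
  have hIPe : IP (Gam a b) ((f :: A) ++ [e]) := by simpa using (g1.1 _ List.mem_cons_self).1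
  have hnew : IP (Gam a b) ((f :: A) ++ e :: (C ++ [w])) := by
    refine IP.glue hIPe ?_ ?_
    · refine hC.congr ?_
      intro x hx y hy hxy
      rcases List.mem_cons.1 hy with rfl | hy
      · rcases List.mem_cons.1 hx with rfl | hx
        · exact absurd rfl hxy
        · rw [adj2_comm, ← hCR x hx]; exact ⟨gam_symm, gam_symm⟩
      · exact (hCR y hy x).symm
    · intro x hx y hy
      have hxV : x ∈ V := inV x (by simp at hx ⊢; tauto)
      refine ⟨fun h => hCV y hy (h ▸ hxV), fun h => ?_⟩
      have := (hX y (hDX y hy)).2 x hxV (adj2_symm ((hCR y hy x).1 h))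
      have h5 := IP.reverse (fun _ _ => gam_symm) hIPe
      simp only [List.reverse_append, List.reverse_cons, List.reverse_nil, List.nil_append, List.singleton_append] at h5
      exact h5.not_mem x (by simp at hx ⊢; tauto) this.symm
  have memnew : ∀ x, x ∈ (f :: A) ++ e :: (C ++ [w]) ↔ x ∈ L ∨ x ∈ C ++ [w] := by
    intro x; rw [g5]; simp; tauto
  have e0 : ∀ x, IsEnd ((f :: A) ++ e :: (C ++ [w])) x ↔ x = f ∨ x = w := by
    intro x
    unfold IsEnd
    have : (f :: A) ++ e :: (C ++ [w]) = ((f :: A) ++ e :: C) ++ [w] := by simp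
    rw [this, List.getLast?_append]; simp [eq_comm]
  have hlen : 2 ≤ ((f :: A) ++ e :: (C ++ [w])).length := by simp; omega
  revert hnew memnew e0 hlen
  generalize (f :: A) ++ e :: (C ++ [w]) = NL
  intro hnew memnew e0 hlen
  refine ⟨{c | c ∈ C ++ [w]}, hDX, Or.inl ha, Or.inl hb, NL :: Ms, ?_, ?_, ?_⟩
  · refine g1.tail.cons hnew hlen ?_
    intro M hM u hu v hv
    rcases (memnew u).1 hu with hu | hu
    · exact g1.sep M hM u ((g5 u).1 hu) v hv
    · have hvV : v ∈ V := (hV v).2 ⟨M, g2 M hM, hv⟩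
      refine ⟨fun h => hCV u hu (h ▸ hvV), fun h => ?_⟩
      have := (hX u (hDX u hu)).2 v hvV (adj2_symm ((hCR u hu v).1 (gam_symm h)))
      exact (g1.sep M hM e (by simp) v hv).1 (Set.mem_singleton_iff.1 this).symm
  · intro x
    rw [ex_cons, Set.mem_union, Set.mem_ofPred_eq, hV]
    have : (∃ L ∈ Ls, x ∈ L) ↔ (x ∈ L ∨ ∃ L ∈ Ms, x ∈ L) := by
      constructor
      · rintro ⟨L', hL', hx⟩
        rcases (g3 L').1 hL' with rfl | h
        · exact Or.inl hx
        · exact Or.inr ⟨L', h, hx⟩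
      · rintro (h | ⟨L, hL, h⟩)
        · exact ⟨_, hL, h⟩
        · exact ⟨_, g2 L hL, h⟩
    rw [this, memnew]
    exact prop_aux2 _ _ _
  · intro x
    rw [ex_cons, Set.mem_union, Set.mem_sdiff, Set.mem_singleton_iff, Set.mem_singleton_iff, hE, e0]
    constructor
    · rintro (⟨⟨L', hL', hx⟩, hx2⟩ | rfl)
      · rcases (g3 L').1 hL' with rfl | h
        · left; rcases (g6 x).1 hx with h | h <;> tauto
        · exact Or.inr ⟨L', h, hx⟩
      · tauto
    · rintro ((rfl | rfl) | ⟨L', hL', hx⟩)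
      · exact Or.inl ⟨⟨L, hL, (g6 _).2 (Or.inl rfl)⟩, g7⟩
      · exact Or.inr rfl
      · refine Or.inl ⟨⟨L', g2 L' hL', hx⟩, ?_⟩
        intro h
        exact (g1.sep L' hL' e (by simp) x hx.mem).1 h.symm

theorem Sys.multi {a b : Cl} {E : Set Cl} (S : Finset Cl) (X : Cl → Set Cl) (w : Cl → Cl) :
    ∀ {V : Set Cl}, Sys a b V E → (∀ e ∈ S, e ∈ E) →
    (∀ e ∈ S, Clear V {e} (X e)) →
    (∀ e ∈ S, ∀ e' ∈ S, e ≠ e' → ∀ c ∈ X e, ∀ d ∈ X e', c ≠ d ∧ ¬ Adj2 c d) →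
    (∀ e ∈ S, Conn (X e) e (w e) ∧ (w e = e ∨ w e ∈ X e)) →
    ∃ C : Set Cl, (∀ c ∈ C, ∃ e ∈ S, c ∈ X e) ∧
      Sys a b (V ∪ C) {x | (x ∈ E ∧ x ∉ S) ∨ ∃ e ∈ S, x = w e} := by
  classical
  induction S using Finset.induction_on with
  | empty =>
    intro V h _ _ _ _
    refine ⟨∅, by simp, h.congr ?_ ?_⟩ <;> simp
  | insert e S heS ih =>
    intro V h hE hX hd hw
    obtain ⟨C, hC, hs⟩ := ih h (fun e he => hE e (by simp [he])) (fun e he => hX e (by simp [he]))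
      (fun e he e' he' => hd e (by simp [he]) e' (by simp [he'])) (fun e he => hw e (by simp [he]))
    have heV : ∀ e' ∈ S, w e' ≠ e := by
      intro e' he' h'
      rcases (hw e' (by simp [he'])).2 with h2 | h2
      · rw [h2] at h'; exact heS (h' ▸ he')
      · exact (hX e' (by simp [he']) _ h2).1 (h' ▸ h.sub (hE e (by simp)))
    have heX : ∀ e' ∈ S, e ∉ X e' := by
      intro e' he' h'
      exact (hX e' (by simp [he']) _ h').1 (h.sub (hE e (by simp)))
    rcases (hw e (by simp)).2 with hwe | hwe
    · refine ⟨C, fun c hc => ?_, hs.congr (fun _ => Iff.rfl) ?_⟩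
      · obtain ⟨e', h1, h2⟩ := hC c hc; exact ⟨e', by simp [h1], h2⟩
      · intro x
        simp only [Set.mem_ofPred_eq, Finset.mem_insert, exists_eq_or_imp, not_or]
        by_cases hx : x = e
        · subst hx
          simp only [hwe, heS, hE x (by simp)]; tauto
        · have : x ≠ w e := by rw [hwe]; exact hx
          tauto
    · have hcl : Clear (V ∪ C) {e} (X e) := by
        intro c hc
        have h1 := hX e (by simp) c hc
        refine ⟨?_, ?_⟩
        · rintro (h2 | h2)
          · exact h1.1 h2
          · obtain ⟨e', h3, h4⟩ := hC c h2
            exact (hd e (by simp) e' (by simp [h3]) (fun h => heS (h ▸ h3)) c hc c h4).1 rfl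
        · rintro v (h2 | h2) hv
          · exact h1.2 v h2 hv
          · obtain ⟨e', h3, h4⟩ := hC v h2
            exact absurd hv (hd e (by simp) e' (by simp [h3]) (fun h => heS (h ▸ h3)) c hc v h4).2
      obtain ⟨C', hC', hs'⟩ := hs.extend (e := e) (w := w e) (Or.inl ⟨hE e (by simp), heS⟩) hcl
        (hw e (by simp)).1 hwe
      refine ⟨C ∪ C', ?_, hs'.congr ?_ ?_⟩
      · rintro c (hc | hc)
        · obtain ⟨e', h1, h2⟩ := hC c hc; exact ⟨e', by simp [h1], h2⟩
        · exact ⟨e, by simp, hC' hc⟩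
      · intro x; simp only [Set.mem_union]; tauto
      · intro x
        simp only [Set.mem_union, Set.mem_sdiff, Set.mem_singleton_iff, Set.mem_ofPred_eq,
          Finset.mem_insert, exists_eq_or_imp, not_or]
        constructor
        · rintro (⟨h1 | h1, h2⟩ | h1) <;> tauto
        · rintro (h1 | h1 | ⟨e', h1, rfl⟩)
          · tauto
          · tauto
          · exact Or.inl ⟨Or.inr ⟨e', h1, rfl⟩, heV e' h1⟩

theorem IP.map {R S : Cl → Cl → Prop} (f : Cl → Cl) (hf : Function.Injective f)
    (hr : ∀ x y, S (f x) (f y) ↔ R x y) : ∀ {L : List Cl}, IP R L → IP S (L.map f) := by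
  intro L
  induction L with
  | nil => intro _; trivial
  | cons x t ih =>
    intro h
    cases t with
    | nil => trivial
    | cons y t =>
      refine ⟨fun e => h.1 (hf e), (hr _ _).2 h.2.1, ?_, ih h.tail⟩
      intro z hz
      obtain ⟨w, hw, rfl⟩ := List.mem_map.1 hz
      have := h.2.2.1 w hw
      exact ⟨fun e => this.1 (hf e), fun e => this.2 ((hr _ _).1 e)⟩

theorem Sys.map {a b : Cl} {V E : Set Cl} (h : Sys a b V E) (f : Cl ≃ Cl)
    (hf : ∀ x y, Adj2 (f x) (f y) ↔ Adj2 x y) :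
    Sys (f.symm a) (f.symm b) {x | f x ∈ V} {x | f x ∈ E} := by
  obtain ⟨ha, hb, Ls, hG, hV, hE⟩ := h
  have hg : ∀ x y, Gam (f.symm a) (f.symm b) (f.symm x) (f.symm y) ↔ Gam a b x y := by
    intro x y
    unfold Gam
    have := hf (f.symm x) (f.symm y)
    simp at this
    simp [this]
  refine ⟨by simpa, by simpa, Ls.map (List.map f.symm), ⟨?_, ?_⟩, ?_, ?_⟩
  · intro L hL
    obtain ⟨M, hM, rfl⟩ := List.mem_map.1 hL
    exact ⟨IP.map _ f.symm.injective hg (hG.1 M hM).1, by simpa using (hG.1 M hM).2⟩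
  · rw [List.pairwise_map]
    refine hG.2.imp ?_
    intro L M h u hu v hv
    obtain ⟨u, hu', rfl⟩ := List.mem_map.1 hu
    obtain ⟨v, hv', rfl⟩ := List.mem_map.1 hv
    rw [hg]
    replace hu := hu'
    replace hv := hv'
    exact ⟨fun e => (h u hu v hv).1 (f.symm.injective e), (h u hu v hv).2⟩
  · intro x
    simp only [Set.mem_ofPred_eq, hV, List.mem_map, exists_exists_and_eq_and]
    constructor
    · rintro ⟨L, hL, hx⟩; exact ⟨L, hL, f x, hx, by simp⟩
    · rintro ⟨L, hL, y, hx, rfl⟩; exact ⟨L, hL, by simpa⟩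
  · intro x
    simp only [Set.mem_ofPred_eq, hE, List.mem_map, exists_exists_and_eq_and]
    have : ∀ L : List Cl, IsEnd (L.map f.symm) x ↔ IsEnd L (f x) := by
      intro L
      unfold IsEnd
      simp only [List.head?_map, List.getLast?_map, Option.map_eq_some_iff, Equiv.symm_apply_eq,
        exists_eq_right]
    simp only [this]

theorem IP.consec {R : Cl → Cl → Prop} {S T : List Cl} {p q : Cl} (h : IP R (S ++ p :: T))
    (hq : q ∈ T) (hR : R p q) : ∃ T', T = q :: T' := by
  have h1 := h.right
  cases T with
  | nil => cases hq
  | cons y T =>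
    rcases List.mem_cons.1 hq with rfl | hq
    · exact ⟨T, rfl⟩
    · exact absurd hR (h1.2.2.1 q hq).2

theorem IP.consec' {R : Cl → Cl → Prop} (hs : ∀ x y, R x y → R y x) {S T : List Cl} {p q : Cl}
    (h : IP R (S ++ p :: T)) (hq : q ∈ S) (hR : R p q) : ∃ S', S = S' ++ [q] := by
  have h1 := IP.reverse hs h
  have h2 : IP R (T.reverse ++ p :: S.reverse) := by simpa using h1
  obtain ⟨T', hT'⟩ := h2.consec (q := q) (by simpa using hq) hR
  refine ⟨T'.reverse, ?_⟩
  have := congrArg List.reverse hT'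
  simpa using this

theorem final_aux {a b e1 e2 : Cl} {S T C : List Cl} (h : IP (Gam a b) (S ++ a :: b :: T))
    (hnadj : ¬ Adj2 a b) (h2 : (S ++ [a]).head? = some e2) (h1 : (b :: T).getLast? = some e1)
    (hC : IP Adj2 (e1 :: (C ++ [e2])))
    (hnew : ∀ c ∈ C, ∀ v ∈ S ++ a :: b :: T, c ≠ v ∧ (Adj2 c v → v = e1 ∨ v = e2)) :
    ∃ P, IP Adj2 P ∧ P.head? = some b ∧ P.getLast? = some a ∧
      ∀ x, x ∈ P ↔ x ∈ S ++ a :: b :: T ∨ x ∈ C := by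
  have hb : b ∉ S ++ [a] := by
    intro hb
    have k1 : IP (Gam a b) ((S ++ [a]) ++ b :: T) := by simpa using h
    have k2 := IP.reverse (fun _ _ => gam_symm) k1.left
    rcases List.mem_append.1 hb with hb | hb
    · exact (h.cross b hb b (by simp)).1 rfl
    · simp at hb; exact (h.right.1) hb.symm
  have ha : a ∉ b :: T := by
    intro ha
    exact h.right.not_mem a ha rfl
  have k1 : IP (Gam a b) ((S ++ [a]) ++ b :: T) := by simpa using h
  have i1 : IP Adj2 (S ++ [a]) := by
    refine k1.left.congr ?_
    intro x hx y hy _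
    unfold Gam
    constructor
    · rintro (h | h | h)
      · exact h
      · exact absurd (h.2 ▸ hy) hb
      · exact absurd (h.1 ▸ hx) hb
    · exact Or.inl
  have i2 : IP Adj2 (b :: T) := by
    refine k1.right.congr ?_
    intro x hx y hy _
    unfold Gam
    constructor
    · rintro (h | h | h)
      · exact h
      · exact absurd (h.1 ▸ hx) ha
      · exact absurd (h.2 ▸ hy) ha
    · exact Or.inl
  have sp : ∀ u ∈ b :: T, ∀ v ∈ S ++ [a], u ≠ v ∧ ¬ Adj2 u v := by
    intro u hu v hv
    refine ⟨?_, ?_⟩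
    · rintro rfl
      rcases List.mem_append.1 hv with hv | hv
      · exact (h.cross u hv u hu).1 rfl
      · simp at hv; exact ha (hv ▸ hu)
    · intro hadj
      rcases List.mem_append.1 hv with hv | hv
      · exact (h.cross v hv u hu).2 (gam_symm (Or.inl hadj))
      · simp at hv; subst hv
        rcases List.mem_cons.1 hu with rfl | hu
        · exact hnadj (adj2_symm hadj)
        · exact (h.right.2.2.1 u hu).2 (gam_symm (Or.inl hadj))
  obtain ⟨A, hA⟩ := List.getLast?_eq_some_iff.1 h1
  obtain ⟨B, hB⟩ : ∃ B, S ++ [a] = e2 :: B := by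
    generalize hM : S ++ [a] = M at h2
    cases M with
    | nil => simp at h2
    | cons x t => simp at h2; exact ⟨t, by rw [h2]⟩
  have key := IP.join3 (R := Adj2) (fun _ _ => adj2_symm) (A := A) (B := B) (C := C) (e1 := e1) (e2 := e2)
    (hA ▸ i2) (hB ▸ i1) hC (by rw [← hA, ← hB]; exact sp) (fun _ _ _ => Iff.rfl) id (by
      intro c hc v hv
      rw [← hA, ← hB] at hv
      refine hnew c hc v ?_
      simp at hv ⊢; tauto)
  refine ⟨_, key, ?_, ?_, ?_⟩
  · cases A with
    | nil => simp at hA ⊢; exact hA.1.symm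
    | cons x t => simp at hA ⊢; exact hA.1.symm
  · have e : A ++ e1 :: (C ++ e2 :: B) = (A ++ e1 :: C) ++ (e2 :: B) := by simp
    rw [e, List.getLast?_append, ← hB]; simp
  · intro x
    have e : A ++ e1 :: (C ++ e2 :: B) = ((A ++ [e1]) ++ C) ++ (e2 :: B) := by simp
    rw [e, ← hA, ← hB]
    simp; tauto

theorem Sys.final {a b : Cl} {V X : Set Cl} {e1 e2 : Cl} (h : Sys a b V {e1, e2}) (h12 : e1 ≠ e2)
    (hab : a ≠ b) (hnadj : ¬ Adj2 a b) (hX : Clear V {e1, e2} X) (hc : Conn (X ∪ {e2}) e1 e2) :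
    ∃ C P : List Cl, IP Adj2 (e1 :: (C ++ [e2])) ∧ (∀ c ∈ C, c ∈ X) ∧
      IP Adj2 P ∧ P.head? = some a ∧ P.getLast? = some b ∧ ∀ x, x ∈ P ↔ x ∈ V ∨ x ∈ C := by
  obtain ⟨ha, hb, Ls, hG, hV, hE⟩ := h
  obtain ⟨L, hL, k⟩ := (hE e1).1 (by simp)
  obtain ⟨f, A, Ms, g1, g2, g3, g4, g5, g6, g7⟩ := hG.front hL k
  have hf : f = e2 := by
    have : f ∈ ({e1, e2} : Set Cl) := (hE f).2 ⟨L, hL, (g6 f).2 (Or.inl rfl)⟩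
    rcases this with h | h
    · exact absurd h g7
    · exact h
  subst hf
  have hMs : ∀ M, M ∉ Ms := by
    intro M hM
    have hlen := (hG.1 M (g2 M hM)).2
    cases M with
    | nil => simp at hlen
    | cons x t =>
      have hx : IsEnd (x :: t) x := Or.inl rfl
      have : x ∈ ({e1, f} : Set Cl) := (hE x).2 ⟨_, g2 _ hM, hx⟩
      rcases this with h | h
      · exact (g1.sep _ hM e1 (by simp) x (by simp)).1 h.symm
      · exact (g1.sep _ hM f (by simp) x (by simp)).1 h.symm
  have hVL : ∀ x, x ∈ V ↔ x ∈ f :: (A ++ [e1]) := by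
    intro x
    rw [hV]
    constructor
    · rintro ⟨M, hM, hx⟩
      rcases (g3 M).1 hM with rfl | h
      · exact (g5 x).1 hx
      · exact absurd h (hMs M)
    · intro hx; exact ⟨L, hL, (g5 x).2 hx⟩
  obtain ⟨C, hC, hCX⟩ := conn_split h12 hc
  have hI : IP (Gam a b) (f :: (A ++ [e1])) := (g1.1 _ List.mem_cons_self).1
  have hlast : (f :: (A ++ [e1])).getLast? = some e1 := by
    have : f :: (A ++ [e1]) = (f :: A) ++ [e1] := rfl
    rw [this, List.getLast?_append]; simp
  have hhead : (f :: (A ++ [e1])).head? = some f := rfl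
  generalize hM : f :: (A ++ [e1]) = M at *
  have haM := (hVL a).1 ha
  obtain ⟨S, T, rfl⟩ := List.append_of_mem haM
  have hbM := (hVL b).1 hb
  refine ⟨C, ?_⟩
  rcases List.mem_append.1 hbM with hbS | hbT
  · obtain ⟨S', rfl⟩ := hI.consec' (fun _ _ => gam_symm) hbS (Or.inr (Or.inl ⟨rfl, rfl⟩))
    have hI' : IP (Gam b a) (S' ++ b :: a :: T) := by
      have : S' ++ b :: a :: T = S' ++ [b] ++ a :: T := by simp
      rw [this]
      refine hI.congr ?_
      intro x _ y _ _
      unfold Gam; tauto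
    obtain ⟨P, p1, p2, p3, p4⟩ := final_aux (e1 := e1) (e2 := f) (C := C) hI' (fun h => hnadj (adj2_symm h))
      (by cases S' <;> simpa using hhead) (by
        rw [List.getLast?_append] at hlast
        cases h : (a :: T).getLast? with
        | none => simp at h
        | some z => rw [h] at hlast; simpa using hlast) hC (by
        intro c hc v hv
        have hv' : v ∈ V := (hVL v).2 (by simpa using hv)
        have := hX c (hCX c hc)
        exact ⟨fun h => this.1 (h ▸ hv'), this.2 v hv'⟩)
    refine ⟨P, hC, hCX, p1, p2, p3, ?_⟩
    intro x; rw [p4, hVL]; simp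
  · have hbT' : b ∈ T := (List.mem_cons.1 hbT).resolve_left (Ne.symm hab)
    obtain ⟨T', rfl⟩ := hI.consec hbT' (Or.inr (Or.inl ⟨rfl, rfl⟩))
    obtain ⟨P, p1, p2, p3, p4⟩ := final_aux (e1 := e1) (e2 := f) (C := C) hI hnadj
      (by cases S <;> simpa using hhead) (by
        rw [List.getLast?_append, List.getLast?_cons_cons] at hlast
        cases h : (b :: T').getLast? with
        | none => simp at h
        | some z => rw [h] at hlast; simpa using hlast) hC (by
        intro c hc v hv
        have hv' : v ∈ V := (hVL v).2 hv
        have := hX c (hCX c hc)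
        exact ⟨fun h => this.1 (h ▸ hv'), this.2 v hv'⟩)
    refine ⟨P.reverse, hC, hCX, IP.reverse (fun _ _ => adj2_symm) p1, by simpa using p3, by simpa using p2, ?_⟩
    intro x; rw [List.mem_reverse, p4, hVL]

/-- Splitting an induced path into runs. -/
theorem runs_exist {a b : Cl} (W : Set Cl) : ∀ {L : List Cl}, IP (Gam a b) L →
    ∃ Ls : List (List Cl), (∀ M ∈ Ls, M ≠ [] ∧ IP (Gam a b) M) ∧ Ls.Pairwise (SepL a b) ∧
      (∀ x, (∃ M ∈ Ls, x ∈ M) ↔ x ∈ L ∧ x ∈ W) ∧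
      (∀ S p T, L = S ++ p :: T → p ∈ W →
        ((∃ M ∈ Ls, M.head? = some p) ↔ ∀ q, S.getLast? = some q → q ∉ W) ∧
        ((∃ M ∈ Ls, M.getLast? = some p) ↔ ∀ q, T.head? = some q → q ∉ W)) := by
  intro L
  induction L with
  | nil => intro _; exact ⟨[], by simp, by simp, by simp, by simp⟩
  | cons x t ih =>
    intro h
    obtain ⟨Ls, r1, r2, r3, r4⟩ := ih h.tail
    have sub : ∀ M ∈ Ls, ∀ y ∈ M, y ∈ t := fun M hM y hy => ((r3 y).1 ⟨M, hM, hy⟩).1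
    have hxt : ∀ M ∈ Ls, x ∉ M := fun M hM hx => h.not_mem x (sub M hM x hx) rfl
    have hd0 : ∀ M ∈ Ls, M.head? ≠ some x := fun M hM hh => hxt M hM (List.mem_of_mem_head? hh)
    have hl0 : ∀ M ∈ Ls, M.getLast? ≠ some x := fun M hM hh => hxt M hM (List.mem_of_getLast? hh)
    by_cases hx : x ∈ W
    · by_cases hy : ∃ y t', t = y :: t' ∧ y ∈ W
      · obtain ⟨y, t', rfl, hyW⟩ := hy
        obtain ⟨M, hM, hMy⟩ := ((r4 [] y t' rfl hyW).1).2 (by simp)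
        obtain ⟨M', rfl⟩ : ∃ M', M = y :: M' := by
          cases M with
          | nil => simp at hMy
          | cons z M' => simp at hMy; exact ⟨M', by rw [hMy]⟩
        have p := List.perm_cons_erase hM
        have r2' := (p.pairwise_iff (fun h => SepL.symm h)).1 r2
        have hsep := (List.pairwise_cons.1 r2').1
        have mem : ∀ N, N ∈ Ls ↔ N = y :: M' ∨ N ∈ Ls.erase (y :: M') := fun N => by
          rw [p.mem_iff, List.mem_cons]
        have xsep : ∀ z ∈ t', x ≠ z ∧ ¬ Gam a b x z := h.2.2.1
        have yM' : ∀ z ∈ M', z ∈ t' := by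
          intro z hz
          have := sub _ hM z (by simp [hz])
          rcases List.mem_cons.1 this with rfl | h'
          · exact absurd rfl ((r1 _ hM).2.not_mem z hz)
          · exact h'
        have yE : ∀ N ∈ Ls.erase (y :: M'), ∀ z ∈ N, z ∈ t' := by
          intro N hN z hz
          have := sub N (List.mem_of_mem_erase hN) z hz
          rcases List.mem_cons.1 this with rfl | h'
          · exact absurd rfl (hsep N hN z (by simp) z hz).1
          · exact h'
        refine ⟨(x :: y :: M') :: Ls.erase (y :: M'), ?_, ?_, ?_, ?_⟩
        · intro N hN
          rcases List.mem_cons.1 hN with rfl | hN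
          · exact ⟨by simp, h.1, h.2.1, fun z hz => xsep z (yM' z hz), (r1 _ hM).2⟩
          · exact r1 N (List.mem_of_mem_erase hN)
        · refine List.pairwise_cons.2 ⟨?_, (List.pairwise_cons.1 r2').2⟩
          intro N hN u hu v hv
          rcases List.mem_cons.1 hu with rfl | hu
          · exact xsep v (yE N hN v hv)
          · exact hsep N hN u hu v hv
        · intro z
          rw [ex_cons]
          have h3 := r3 z
          have : (∃ M ∈ Ls, z ∈ M) ↔ (z ∈ y :: M' ∨ ∃ M ∈ Ls.erase (y :: M'), z ∈ M) := by
            constructor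
            · rintro ⟨N, hN, hz⟩
              rcases (mem N).1 hN with rfl | hN
              · exact Or.inl hz
              · exact Or.inr ⟨N, hN, hz⟩
            · rintro (hz | ⟨N, hN, hz⟩)
              · exact ⟨_, hM, hz⟩
              · exact ⟨N, (mem N).2 (Or.inr hN), hz⟩
          rw [this] at h3
          rw [List.mem_cons (a := z) (b := x), List.mem_cons (a := z) (b := x), or_assoc, h3]
          constructor
          · rintro (rfl | h')
            · exact ⟨Or.inl rfl, hx⟩
            · exact ⟨Or.inr h'.1, h'.2⟩
          · rintro ⟨rfl | h', h''⟩
            · exact Or.inl rfl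
            · exact Or.inr ⟨h', h''⟩
        · intro S p T hS hp
          cases S with
          | nil =>
            simp at hS
            obtain ⟨rfl, rfl⟩ := hS
            constructor
            · simp
            · simp only [List.head?_cons, Option.some.injEq, forall_eq']
              refine ⟨?_, fun h' => absurd hyW h'⟩
              rintro ⟨N, hN, hh⟩
              rcases List.mem_cons.1 hN with rfl | hN
              · rw [List.getLast?_cons_cons] at hh
                exact absurd hh (hl0 _ hM)
              · exact absurd hh (hl0 _ (List.mem_of_mem_erase hN))
          | cons s S =>
            simp at hS
            obtain ⟨rfl, hS⟩ := hS
            have h4 := r4 S p T hS hp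
            constructor
            · cases S with
              | nil =>
                simp at hS
                obtain ⟨rfl, rfl⟩ := hS
                simp only [List.getLast?_singleton, Option.some.injEq, forall_eq']
                refine ⟨?_, fun h' => absurd hx h'⟩
                rintro ⟨N, hN, hh⟩
                rcases List.mem_cons.1 hN with rfl | hN
                · simp at hh; exact absurd hh h.1
                · exact absurd rfl (hsep N hN y (by simp) y (List.mem_of_mem_head? hh)).1
              | cons s' S =>
                rw [List.getLast?_cons_cons, ← h4.1]
                simp at hS
                obtain ⟨rfl, hS⟩ := hS
                have hpy : y ≠ p := h.tail.not_mem p (by rw [hS]; simp)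
                have hpx : x ≠ p := h.not_mem p (by rw [hS]; simp)
                constructor
                · rintro ⟨N, hN, hh⟩
                  rcases List.mem_cons.1 hN with rfl | hN
                  · simp at hh; exact absurd hh hpx
                  · exact ⟨N, List.mem_of_mem_erase hN, hh⟩
                · rintro ⟨N, hN, hh⟩
                  rcases (mem N).1 hN with rfl | hN
                  · simp at hh; exact absurd hh hpy
                  · exact ⟨N, by simp [hN], hh⟩
            · rw [← h4.2]
              constructor
              · rintro ⟨N, hN, hh⟩
                rcases List.mem_cons.1 hN with rfl | hN
                · rw [List.getLast?_cons_cons] at hh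
                  exact ⟨_, hM, hh⟩
                · exact ⟨N, List.mem_of_mem_erase hN, hh⟩
              · rintro ⟨N, hN, hh⟩
                rcases (mem N).1 hN with rfl | hN
                · exact ⟨x :: y :: M', by simp, by rw [List.getLast?_cons_cons]; exact hh⟩
                · exact ⟨N, by simp [hN], hh⟩
      · push Not at hy
        have xsep : ∀ z ∈ t, z ∈ W → x ≠ z ∧ ¬ Gam a b x z := by
          intro z hz hzW
          cases t with
          | nil => cases hz
          | cons y t =>
            rcases List.mem_cons.1 hz with rfl | hz
            · exact absurd hzW (hy _ _ rfl)
            · exact h.2.2.1 z hz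
        refine ⟨[x] :: Ls, ?_, ?_, ?_, ?_⟩
        · intro N hN
          rcases List.mem_cons.1 hN with rfl | hN
          · exact ⟨by simp, trivial⟩
          · exact r1 N hN
        · refine List.pairwise_cons.2 ⟨?_, r2⟩
          intro N hN u hu v hv
          simp at hu; subst hu
          have := (r3 v).1 ⟨N, hN, hv⟩
          exact xsep v this.1 this.2
        · intro z
          rw [ex_cons, r3]
          simp only [List.mem_cons, List.not_mem_nil, or_false]
          constructor
          · rintro (rfl | h')
            · exact ⟨Or.inl rfl, hx⟩
            · exact ⟨Or.inr h'.1, h'.2⟩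
          · rintro ⟨rfl | h', h''⟩
            · exact Or.inl rfl
            · exact Or.inr ⟨h', h''⟩
        · intro S p T hS hp
          cases S with
          | nil =>
            simp at hS
            obtain ⟨rfl, rfl⟩ := hS
            constructor
            · simp
            · constructor
              · intro _ q hq
                cases t with
                | nil => simp at hq
                | cons y t => simp at hq; subst hq; exact hy _ _ rfl
              · intro _; exact ⟨[x], by simp, by simp⟩
          | cons s S =>
            simp at hS
            obtain ⟨rfl, hS⟩ := hS
            have h4 := r4 S p T hS hp
            have hpx : x ≠ p := h.not_mem p (by rw [hS]; simp)
            rw [ex_cons, ex_cons, ← h4.2]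
            constructor
            · cases S with
              | nil =>
                simp at hS
                obtain rfl := hS
                exact absurd hp (hy _ _ rfl)
              | cons s' S =>
                rw [List.getLast?_cons_cons, ← h4.1]
                simp [hpx]
            · simp [hpx]
    · refine ⟨Ls, r1, r2, ?_, ?_⟩
      · intro z
        rw [r3]
        constructor
        · rintro ⟨h1, h2⟩; exact ⟨by simp [h1], h2⟩
        · rintro ⟨h1, h2⟩
          rcases List.mem_cons.1 h1 with rfl | h1
          · exact absurd h2 hx
          · exact ⟨h1, h2⟩
      · intro S p T hS hp
        cases S with
        | nil =>
          simp at hS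
          exact absurd (hS.1 ▸ hp) hx
        | cons s S =>
          simp at hS
          obtain ⟨rfl, hS⟩ := hS
          have h4 := r4 S p T hS hp
          refine ⟨?_, h4.2⟩
          rw [h4.1]
          cases S with
          | nil => simp [hx]
          | cons s' S => rw [List.getLast?_cons_cons]

theorem sys_init {a b O : Cl} {P : List Cl} (hP : IP Adj2 P) (ha : P.head? = some a)
    (hb : P.getLast? = some b) (hO : O ∈ P) (W : Set Cl) (hOW : O ∉ W) (haW : a ∈ W) (hbW : b ∈ W)
    (hWP : ∀ x ∈ W, x ∈ P) (hW2 : ∀ x ∈ W, ∃ y ∈ W, Adj2 x y) :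
    Sys a b W {p | p ∈ W ∧ ∃ q ∈ P, q ∉ W ∧ Adj2 p q} := by
  obtain ⟨P1, P2, rfl⟩ := List.append_of_mem hO
  have haP1 : ∃ t1, P1 = a :: t1 := by
    cases P1 with
    | nil => simp at ha; exact absurd (ha ▸ haW) hOW
    | cons x t => simp at ha; exact ⟨t, by rw [ha]⟩
  have hbP2 : ∃ t2, P2 = t2 ++ [b] := by
    have : P2.getLast? = some b := by
      rw [List.getLast?_append] at hb
      cases P2 with
      | nil => simp at hb; exact absurd (hb ▸ hbW) hOW
      | cons y t =>
        rw [List.getLast?_cons_cons] at hb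
        cases h : (y :: t).getLast? with
        | none => simp at h
        | some z => rw [h] at hb; simpa using hb
    exact List.getLast?_eq_some_iff.1 this
  obtain ⟨t1, rfl⟩ := haP1
  obtain ⟨t2, rfl⟩ := hbP2
  have cr := hP.cross
  have hbn1 : b ∉ a :: t1 := fun h => (cr b h b (by simp)).1 rfl
  have han2 : a ∉ t2 ++ [b] := fun h => (cr a (by simp) a h).1 rfl
  have hab : a ≠ b := fun h => han2 (by simp [h])
  have i1 : IP (Gam a b) (a :: t1) := by
    refine hP.left.congr ?_
    intro x hx y hy _
    unfold Gam
    constructor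
    · exact Or.inl
    · rintro (h | h | h)
      · exact h
      · exact absurd (h.2 ▸ hy) hbn1
      · exact absurd (h.1 ▸ hx) hbn1
  have i2 : IP (Gam a b) (t2 ++ [b]) := by
    refine hP.right.tail.congr ?_
    intro x hx y hy _
    unfold Gam
    constructor
    · exact Or.inl
    · rintro (h | h | h)
      · exact h
      · exact absurd (h.1 ▸ hx) han2
      · exact absurd (h.2 ▸ hy) han2
  have crG : ∀ u ∈ a :: t1, ∀ v ∈ t2 ++ [b], ¬ (u = a ∧ v = b) → ¬ Gam a b v u := by
    intro u hu v hv hn hg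
    rcases hg with hg | hg | hg
    · exact (cr u hu v hv).2 (adj2_symm hg)
    · exact han2 (hg.1 ▸ hv)
    · exact hn ⟨hg.2, hg.1⟩
  have i3 : IP (Gam a b) (t2 ++ b :: (a :: t1)) := by
    refine IP.glue i2 ⟨hab.symm, Or.inr (Or.inr ⟨rfl, rfl⟩), ?_, i1⟩ ?_
    · intro z hz
      refine ⟨fun h => hbn1 (by simp [h, hz]), crG z (by simp [hz]) b (by simp) ?_⟩
      rintro ⟨h, _⟩
      exact i1.not_mem z hz h.symm
    · intro x hx y hy
      refine ⟨fun h => (cr y hy x (by simp [hx])).1 h.symm, crG y hy x (by simp [hx]) ?_⟩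
      rintro ⟨_, h⟩
      have h5 := IP.reverse (fun _ _ => gam_symm) i2
      simp only [List.reverse_append, List.reverse_cons, List.reverse_nil, List.nil_append, List.singleton_append] at h5
      exact h5.not_mem x (by simpa using hx) h.symm
  obtain ⟨Ls, r1, r2, r3, r4⟩ := runs_exist W i3
  have memL : ∀ x, x ∈ (a :: t1) ++ O :: (t2 ++ [b]) ↔ x = O ∨ x ∈ t2 ++ b :: (a :: t1) := by
    intro x; simp; tauto
  have hWL : ∀ x ∈ W, x ∈ t2 ++ b :: (a :: t1) := by
    intro x hx
    rcases (memL x).1 (hWP x hx) with h | h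
    · exact absurd (h ▸ hx) hOW
    · exact h
  have hVc : ∀ x, x ∈ W ↔ ∃ L ∈ Ls, x ∈ L := by
    intro x; rw [r3]; exact ⟨fun h => ⟨hWL x h, h⟩, fun h => h.2⟩
  refine ⟨haW, hbW, Ls, ⟨?_, r2⟩, hVc, ?_⟩
  · intro L hL
    refine ⟨(r1 L hL).2, ?_⟩
    have hne := (r1 L hL).1
    match L, hL, hne with
    | [], _, hne => exact absurd rfl hne
    | [x], hL, _ =>
      exfalso
      have hxW : x ∈ W := (hVc x).2 ⟨_, hL, by simp⟩
      obtain ⟨y, hy, hxy⟩ := hW2 x hxW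
      obtain ⟨M, hM, hyM⟩ := (hVc y).1 hy
      have p := List.perm_cons_erase hL
      have r2' := (p.pairwise_iff (fun h => SepL.symm h)).1 r2
      rcases List.mem_cons.1 (p.mem_iff.1 hM) with rfl | hM'
      · simp at hyM; exact adj2_ne hxy hyM.symm
      · exact ((List.pairwise_cons.1 r2').1 M hM' x (by simp) y hyM).2 (Or.inl hxy)
    | x :: y :: t, _, _ => simp
  · intro p
    rw [Set.mem_ofPred_eq]
    have hsplit : (∃ L ∈ Ls, IsEnd L p) ↔ ((∃ M ∈ Ls, M.head? = some p) ∨ ∃ M ∈ Ls, M.getLast? = some p) := by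
      unfold IsEnd
      constructor
      · rintro ⟨L, hL, h | h⟩
        · exact Or.inl ⟨L, hL, h⟩
        · exact Or.inr ⟨L, hL, h⟩
      · rintro (⟨L, hL, h⟩ | ⟨L, hL, h⟩)
        · exact ⟨L, hL, Or.inl h⟩
        · exact ⟨L, hL, Or.inr h⟩
    have hpW : (∃ L ∈ Ls, IsEnd L p) → p ∈ W := by
      rintro ⟨L, hL, h⟩; exact (hVc p).2 ⟨L, hL, h.mem⟩
    by_cases hp : p ∈ W
    swap
    · exact ⟨fun h => absurd h.1 hp, fun h => absurd (hpW h) hp⟩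
    obtain ⟨S, T, hST⟩ := List.append_of_mem (hWL p hp)
    have h4 := r4 S p T hST hp
    rw [hsplit, h4.1, h4.2]
    have i4 : IP (Gam a b) (S ++ p :: T) := hST ▸ i3
    have notab : ∀ q, q ∉ W → Gam a b p q → Adj2 p q := by
      intro q hq hg
      refine (gam_iff' ?_ ?_).1 hg
      · rintro rfl; exact hq haW
      · rintro rfl; exact hq hbW
    have inP : ∀ q, q ∈ S ∨ q ∈ T → q ∈ (a :: t1) ++ O :: (t2 ++ [b]) := by
      intro q hq
      rw [memL, hST]; simp; tauto
    constructor
    · rintro ⟨_, q, hqP, hqW, hpq⟩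
      rcases (memL q).1 hqP with rfl | hq
      · rcases List.mem_append.1 ((memL p).2 (Or.inr (hWL p hp))) with h1 | h1
        · right
          obtain ⟨S', hS'⟩ := hP.consec' (fun _ _ => adj2_symm) h1 (adj2_symm hpq)
          have : T = [] := by
            have e1 : (t2 ++ b :: (a :: t1)).getLast? = some p := by
              have e2 : t2 ++ b :: (S' ++ [p]) = (t2 ++ b :: S') ++ [p] := by simp
              rw [hS', e2, List.getLast?_append]; simp
            cases T with
            | nil => rfl
            | cons y T =>
              rw [hST, List.getLast?_append, List.getLast?_cons_cons] at e1
              cases h : (y :: T).getLast? with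
              | none => simp at h
              | some z =>
                rw [h] at e1
                simp at e1
                have := List.mem_of_getLast? h
                exact absurd e1.symm (i4.right.not_mem z this)
          simp [this]
        · left
          have h1' : p ∈ t2 ++ [b] := (List.mem_cons.1 h1).resolve_left (by rintro rfl; exact hOW hp)
          obtain ⟨T', hT'⟩ := hP.consec h1' (adj2_symm hpq)
          have : S = [] := by
            have e1 : t2 ++ b :: (a :: t1) = p :: (T' ++ (a :: t1)) := by
              have : t2 ++ b :: (a :: t1) = (t2 ++ [b]) ++ (a :: t1) := by simp
              rw [this, hT']; simp
            cases S with
            | nil => rfl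
            | cons s S =>
              rw [e1] at hST
              simp at hST
              have i5 := i4
              rw [← hST.1] at i5
              exact absurd rfl (IP.not_mem i5 p (by simp))
          simp [this]
      · have hqn : q ≠ p := (adj2_ne hpq).symm
        rw [hST] at hq
        have hq' : q ∈ S ∨ q ∈ T := by simp at hq; tauto
        rcases hq' with hq' | hq'
        · left
          obtain ⟨S', rfl⟩ := i4.consec' (fun _ _ => gam_symm) hq' (Or.inl hpq)
          intro q' h'; simp at h'; rw [← h']; exact hqW
        · right
          obtain ⟨T', rfl⟩ := i4.consec hq' (Or.inl hpq)
          intro q' h'; simp at h'; rw [← h']; exact hqW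
    · intro h
      refine ⟨hp, ?_⟩
      rcases h with h | h
      · rcases List.eq_nil_or_concat S with rfl | ⟨S', q, rfl⟩
        · -- p is the head of P2
          refine ⟨O, by simp, hOW, ?_⟩
          have h6 := hP.right
          cases t2 with
          | nil => simp at hST; rw [← hST.1]; exact adj2_symm h6.2.1
          | cons y t2 => simp at hST; rw [← hST.1]; exact adj2_symm h6.2.1
        · refine ⟨q, inP q (by simp), h q (by simp), notab q (h q (by simp)) ?_⟩
          have i5 : IP (Gam a b) (S' ++ q :: p :: T) := by simpa using i4
          exact gam_symm i5.right.2.1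
      · cases T with
        | nil =>
          refine ⟨O, by simp, hOW, ?_⟩
          have e1 : (a :: t1).getLast? = some p := by
            have : (t2 ++ b :: (a :: t1)).getLast? = some p := by rw [hST]; simp
            rw [List.getLast?_append, List.getLast?_cons_cons] at this
            cases h : (a :: t1).getLast? with
            | none => simp at h
            | some z => rw [h] at this; simpa using this
          obtain ⟨A, hA⟩ := List.getLast?_eq_some_iff.1 e1
          have : IP Adj2 (A ++ p :: O :: (t2 ++ [b])) := by
            have e : A ++ p :: O :: (t2 ++ [b]) = (a :: t1) ++ O :: (t2 ++ [b]) := by rw [hA]; simp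
            rw [e]; exact hP
          exact this.right.2.1
        | cons q T =>
          exact ⟨q, inP q (by simp), h q (by simp), notab q (h q (by simp)) i4.right.2.1⟩

def Zone (Xm Yl : ℤ) (z : Cl) : Prop := 1 ≤ z.1 ∧ z.1 ≤ Xm ∧ Yl ≤ z.2 ∧ 1 ≤ z.1 + z.2 ∧ z.2 ≤ z.1

def CondP (l : List ℤ) (z : Cl) : Prop := z.2 ≤ (z.1 - 1) / 2 - 2 ∨
  ∃ x ∈ l, (z.2 = (x - 1) / 2 ∧ x < z.1 ∧ z.1 ≤ x + 3) ∨ (z.2 = (x - 1) / 2 - 1 ∧ (z.1 = x ∨ z.1 = x + 1))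

/-- hypothesis for the carry lemma -/
def CHyp (V : Set Cl) (Xm Yl Xc Yc : ℤ) (l : List ℤ) : Prop :=
  ∀ z : Cl, Zone Xm Yl z →
    ((Xc + 2 ≤ z.1 ∧ CondP l z) ∨ (Xc ≤ z.1 ∧ z.1 ≤ Xc + 1 ∧ z.2 ≤ Yc ∧ ¬ (z.1 = Xc ∧ z.2 = Yc)) ∨
      (Yc = (Xc - 1) / 2 ∧ z.2 = Yc ∧ Xc < z.1 ∧ z.1 ≤ Xc + 3)) →
    z ∉ V ∧ ∀ v ∈ V, Adj2 z v → (v.1 = Xc ∧ v.2 = Yc) ∨ ∃ x ∈ l, v.1 = x ∧ v.2 = (x - 1) / 2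

theorem cl_ext {u : Cl} {x y : ℤ} (h1 : u.1 = x) (h2 : u.2 = y) : u = (x, y) := Prod.ext h1 h2

theorem cl_eq_iff (u : Cl) (x y : ℤ) : u = (x, y) ↔ u.1 = x ∧ u.2 = y :=
  ⟨fun h => by rw [h]; exact ⟨rfl, rfl⟩, fun h => Prod.ext h.1 h.2⟩

/-- path: horizontally right then vertically up -/
theorem conn_right_up {X : Set Cl} {x1 y1 x2 y2 : ℤ} (hx : x1 ≤ x2) (hy : y1 ≤ y2)
    (h1 : ∀ x, x1 < x → x ≤ x2 → (x, y1) ∈ X) (h2 : ∀ y, y1 < y → y ≤ y2 → (x2, y) ∈ X) :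
    Conn X (x1, y1) (x2, y2) := (Conn.right hx h1).trans (Conn.up hy h2)

theorem conn_right_down {X : Set Cl} {x1 y1 x2 y2 : ℤ} (hx : x1 ≤ x2) (hy : y2 ≤ y1)
    (h1 : ∀ x, x1 < x → x ≤ x2 → (x, y1) ∈ X) (h2 : ∀ y, y2 ≤ y → y < y1 → (x2, y) ∈ X) :
    Conn X (x1, y1) (x2, y2) := (Conn.right hx h1).trans (Conn.down hy h2)

theorem place_c {a b : Cl} {Xm Yl T : ℤ} (hYl : Yl ≤ -2) (hT : 1 ≤ T - 2 + Yl) (hTm : T ≤ Xm)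
    {V E : Set Cl} {Xc Yc : ℤ} {l : List ℤ} (hS : Sys a b V E) (hcE : (Xc, Yc) ∈ E)
    (hst : Yc = (Xc - 1) / 2 ∨ (-1 ≤ Yc ∧ Yc ≤ (Xc - 1) / 2 - 3)) (h1 : 1 ≤ Xc) (h2 : Xc ≤ Xm)
    (h3 : 1 ≤ Xc + Yc) (hl : ∀ x ∈ l, Xc + 2 ≤ x ∧ x ≤ Xm) (hH : CHyp V Xm Yl Xc Yc l) :
    ∃ C : Set Cl, (∀ z ∈ C, Zone Xm Yl z ∧ (z.2 = Yl → z.1 = max Xc (T - 2)) ∧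
        z.1 ≤ max Xc (T - 2) ∧ Xc ≤ z.1 ∧ ((z.1 ≤ Xc + 1 ∧ z.2 ≤ Yc) ∨ z.2 ≤ (Xc - 1) / 2 - 1)) ∧
      Sys a b (V ∪ C) (E \ {(Xc, Yc)} ∪ {(max Xc (T - 2), Yl)}) := by
  have gen : ∀ (X : Set Cl), (∀ z ∈ X, Zone Xm Yl z ∧ ((Xc + 2 ≤ z.1 ∧ z.2 ≤ (z.1 - 1) / 2 - 2) ∨
      (Xc ≤ z.1 ∧ z.1 ≤ Xc + 1 ∧ z.2 ≤ Yc ∧ ¬ (z.1 = Xc ∧ z.2 = Yc))) ∧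
      ((z.1 ≤ Xc + 1 ∧ z.2 ≤ Yc) ∨ z.2 ≤ (Xc - 1) / 2 - 1)) → Clear V {(Xc, Yc)} X := by
    intro X hX z hz
    obtain ⟨k1, k2, k3⟩ := hX z hz
    have := hH z k1 (by
      rcases k2 with k2 | k2
      · exact Or.inl ⟨k2.1, Or.inl k2.2⟩
      · exact Or.inr (Or.inl k2))
    refine ⟨this.1, fun v hv hadj => ?_⟩
    rcases this.2 v hv hadj with h | ⟨x, hx, h⟩
    · exact cl_ext h.1 h.2
    · exfalso
      have := hl x hx
      rw [adj2_iff] at hadj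
      omega
  by_cases hc : T - 2 ≤ Xc
  · have hm : max Xc (T - 2) = Xc := max_eq_left hc
    rw [hm]
    set X : Set Cl := {z | z.1 = Xc ∧ Yl ≤ z.2 ∧ z.2 < Yc} with hXd
    obtain ⟨C, hC, hs⟩ := hS.extend hcE (X := X) (w := (Xc, Yl)) (gen X (by
        rintro z ⟨k1, k2, k3⟩
        unfold Zone
        refine ⟨?_, ?_, ?_⟩ <;> omega)) (Conn.down (by omega) (fun y _ _ => ⟨rfl, by simp; omega, by simp; omega⟩))
      ⟨rfl, by simp, by simp; omega⟩
    refine ⟨C, ?_, hs⟩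
    intro z hz
    obtain ⟨k1, k2, k3⟩ := hC hz
    unfold Zone
    refine ⟨?_, ?_, ?_, ?_, ?_⟩ <;> omega
  · have hm : max Xc (T - 2) = T - 2 := max_eq_right (by omega)
    rw [hm]
    rcases hst with hf | hr
    · set X : Set Cl := {z | (z.1 = Xc + 1 ∧ z.2 = Yc) ∨ (z.2 = Yc - 1 ∧ Xc + 1 ≤ z.1 ∧ z.1 ≤ T - 2) ∨
        (z.1 = T - 2 ∧ Yl ≤ z.2 ∧ z.2 ≤ Yc - 1)} with hXd
      have hX : ∀ z, z ∈ X ↔ ((z.1 = Xc + 1 ∧ z.2 = Yc) ∨ (z.2 = Yc - 1 ∧ Xc + 1 ≤ z.1 ∧ z.1 ≤ T - 2) ∨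
        (z.1 = T - 2 ∧ Yl ≤ z.2 ∧ z.2 ≤ Yc - 1)) := fun z => Iff.rfl
      clear_value X
      obtain ⟨C, hC, hs⟩ := hS.extend hcE (X := X) (w := (T - 2, Yl)) (gen X (by
          intro z hz
          rw [hX] at hz
          unfold Zone
          refine ⟨?_, ?_, ?_⟩ <;> omega)) (by
          refine Conn.trans (Conn.single (v := (Xc + 1, Yc)) (by rw [adj2_mk]; omega) ((hX _).2 (by simp))) ?_
          refine Conn.trans (Conn.single (v := (Xc + 1, Yc - 1)) (by rw [adj2_mk]; omega) ((hX _).2 (by simp; omega))) ?_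
          exact conn_right_down (by omega) (by omega) (fun x _ _ => (hX _).2 (by simp; omega))
            (fun y _ _ => (hX _).2 (by simp; omega)))
        ((hX _).2 (by simp; omega))
      refine ⟨C, ?_, hs⟩
      intro z hz
      have := (hX z).1 (hC hz)
      unfold Zone
      refine ⟨?_, ?_, ?_, ?_, ?_⟩ <;> omega
    · set X : Set Cl := {z | (z.2 = Yc ∧ Xc + 1 ≤ z.1 ∧ z.1 ≤ T - 2) ∨
        (z.1 = T - 2 ∧ Yl ≤ z.2 ∧ z.2 ≤ Yc)} with hXd
      have hX : ∀ z, z ∈ X ↔ ((z.2 = Yc ∧ Xc + 1 ≤ z.1 ∧ z.1 ≤ T - 2) ∨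
        (z.1 = T - 2 ∧ Yl ≤ z.2 ∧ z.2 ≤ Yc)) := fun z => Iff.rfl
      clear_value X
      obtain ⟨C, hC, hs⟩ := hS.extend hcE (X := X) (w := (T - 2, Yl)) (gen X (by
          intro z hz
          rw [hX] at hz
          unfold Zone
          refine ⟨?_, ?_, ?_⟩ <;> omega)) (by
          exact conn_right_down (by omega) (by omega) (fun x _ _ => (hX _).2 (by simp; omega))
            (fun y _ _ => (hX _).2 (by simp; omega)))
        ((hX _).2 (by simp; omega))
      refine ⟨C, ?_, hs⟩
      intro z hz
      have := (hX z).1 (hC hz)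
      unfold Zone
      refine ⟨?_, ?_, ?_, ?_, ?_⟩ <;> omega

theorem ex3_aux (v : Cl) (x1 x2 : ℤ) (t : List ℤ) : (∃ x ∈ x1 :: x2 :: t, v.1 = x ∧ v.2 = (x - 1) / 2) ↔
    (v.1 = x1 ∧ v.2 = (x1 - 1) / 2) ∨ (v.1 = x2 ∧ v.2 = (x2 - 1) / 2) ∨ ∃ x ∈ t, v.1 = x ∧ v.2 = (x - 1) / 2 := by
  simp only [List.mem_cons, exists_eq_or_imp]

theorem core_p1 (e c x1 x2 t R : Prop) : ((e ∧ ¬ c ∧ ¬ x1) ∧ ¬ x2 ∧ t) ∨ R ↔ (e ∧ ¬ c ∧ ¬ x1 ∧ ¬ x2 ∧ t) ∨ R := by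
  tauto

theorem core_p2 (e c x1 x2 t R n : Prop) (h : e → ¬ n) :
    ((((e ∧ ¬ x1 ∧ ¬ x2) ∧ ¬ c) ∨ n) ∧ ¬ n ∧ t) ∨ R ↔ (e ∧ ¬ c ∧ ¬ x1 ∧ ¬ x2 ∧ t) ∨ R := by
  tauto

set_option maxHeartbeats 8000000 in
theorem core_aux {a b : Cl} {Xm Yl T : ℤ} (hYl : Yl ≤ -2) (hT : 1 ≤ T - 2 + Yl) (hTm : T ≤ Xm) :
    ∀ (n : ℕ) (l : List ℤ), l.length ≤ n → ∀ (V E : Set Cl) (Xc Yc : ℤ), Sys a b V E →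
    (Xc, Yc) ∈ E → (∀ x ∈ l, (x, (x - 1) / 2) ∈ E) →
    (Yc = (Xc - 1) / 2 ∨ (-1 ≤ Yc ∧ Yc ≤ (Xc - 1) / 2 - 3)) → 1 ≤ Xc → Xc ≤ Xm →
    1 ≤ Xc + Yc → (∀ x ∈ l, Xc + 2 ≤ x ∧ x ≤ Xm) → l.Pairwise (fun x y => x + 2 ≤ y) →
    CHyp V Xm Yl Xc Yc l →
    ∃ (C : Set Cl) (F : Set ℤ), (∀ z ∈ C, Zone Xm Yl z ∧ (z.2 = Yl → z.1 ∈ F)) ∧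
      (∀ u ∈ F, T - 2 ≤ u ∧ u ≤ Xm) ∧ (∀ u ∈ F, ∀ v ∈ F, u < v → u + 2 ≤ v) ∧
      (∃ u1 u2, ∀ u ∈ F, u = u1 ∨ u = u2) ∧
      Sys a b (V ∪ C) {z | (z ∈ E ∧ ¬ (z.1 = Xc ∧ z.2 = Yc) ∧ ∀ x ∈ l, ¬ (z.1 = x ∧ z.2 = (x - 1) / 2)) ∨
        (z.2 = Yl ∧ z.1 ∈ F)} := by
  intro n
  induction n with
  | zero =>
    intro l hlen V E Xc Yc hS hcE hlE hst h1 h2 h3 hl hp hH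
    have : l = [] := by cases l with
      | nil => rfl
      | cons x t => simp at hlen
    subst this
    obtain ⟨C, hC, hs⟩ := place_c hYl hT hTm hS hcE hst h1 h2 h3 hl hH
    refine ⟨C, {max Xc (T - 2)}, ?_, ?_, ?_, ?_, hs.congr (fun _ => Iff.rfl) ?_⟩
    · intro z hz; exact ⟨(hC z hz).1, (hC z hz).2.1⟩
    · rintro u rfl; omega
    · rintro u rfl v rfl h; omega
    · exact ⟨_, 0, fun u hu => Or.inl hu⟩
    · intro z
      simp only [Set.mem_union, Set.mem_sdiff, Set.mem_singleton_iff, Set.mem_ofPred_eq, cl_eq_iff]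
      constructor
      · rintro (⟨h1, h2⟩ | h1)
        · exact Or.inl ⟨h1, h2, by simp⟩
        · exact Or.inr ⟨h1.2, h1.1⟩
      · rintro (⟨h1, h2, h3⟩ | h1)
        · exact Or.inl ⟨h1, h2⟩
        · exact Or.inr ⟨h1.2, h1.1⟩
  | succ n ih =>
    intro l hlen V E Xc Yc hS hcE hlE hst h1 h2 h3 hl hp hH
    match l, hlen, hlE, hl, hp, hH with
    | [], _, hlE, hl, hp, hH => exact ih [] (by simp) V E Xc Yc hS hcE hlE hst h1 h2 h3 hl hp hH
    | [x], _, hlE, hl, hp, hH =>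
      obtain ⟨C, hC, hs⟩ := place_c hYl hT hTm hS hcE hst h1 h2 h3 hl hH
      have hx := hl x (by simp)
      have hxE := hlE x (by simp)
      have cl : ∀ X : Set Cl, (∀ z ∈ X, Zone Xm Yl z ∧ x ≤ z.1 ∧ CondP [x] z ∧
          (max Xc (T - 2) + 2 ≤ z.1 ∨ (z.2 = (x - 1) / 2 ∧ x < z.1))) →
          Clear (V ∪ C) {(x, (x - 1) / 2)} X := by
        intro X hX z hz
        obtain ⟨k1, k2, k3, k4⟩ := hX z hz
        have hh := hH z k1 (Or.inl ⟨by omega, k3⟩)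
        constructor
        · rintro (h | h)
          · exact hh.1 h
          · have := hC z h; omega
        · rintro v (hv | hv) hadj
          · rcases hh.2 v hv hadj with h | ⟨y, hy, h⟩
            · rw [adj2_iff] at hadj; omega
            · simp at hy; subst hy; exact cl_ext h.1 h.2
          · have := hC v hv
            rw [adj2_iff] at hadj; omega
      have hxE' : (x, (x - 1) / 2) ∈ E \ {(Xc, Yc)} ∪ {(max Xc (T - 2), Yl)} := by
        left
        refine ⟨hxE, ?_⟩
        intro h
        rw [Set.mem_singleton_iff, Prod.mk.injEq] at h; omega
      have fin : ∀ u : ℤ, max Xc (T - 2) + 2 ≤ u → u ≤ Xm → (∃ C' : Set Cl, (∀ z ∈ C', Zone Xm Yl z ∧ (z.2 = Yl → z.1 = u)) ∧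
          Sys a b (V ∪ C ∪ C') (((E \ {(Xc, Yc)} ∪ {(max Xc (T - 2), Yl)}) \ {(x, (x - 1) / 2)}) ∪ {(u, Yl)})) →
          ∃ (C : Set Cl) (F : Set ℤ), (∀ z ∈ C, Zone Xm Yl z ∧ (z.2 = Yl → z.1 ∈ F)) ∧
            (∀ u ∈ F, T - 2 ≤ u ∧ u ≤ Xm) ∧ (∀ u ∈ F, ∀ v ∈ F, u < v → u + 2 ≤ v) ∧
            (∃ u1 u2, ∀ u ∈ F, u = u1 ∨ u = u2) ∧
            Sys a b (V ∪ C) {z | (z ∈ E ∧ ¬ (z.1 = Xc ∧ z.2 = Yc) ∧ ∀ y ∈ [x], ¬ (z.1 = y ∧ z.2 = (y - 1) / 2)) ∨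
              (z.2 = Yl ∧ z.1 ∈ F)} := by
        rintro u hu1 hu2 ⟨C', hC', hs'⟩
        refine ⟨C ∪ C', {max Xc (T - 2), u}, ?_, ?_, ?_, ?_, hs'.congr ?_ ?_⟩
        · rintro z (hz | hz)
          · exact ⟨(hC z hz).1, fun h => Or.inl ((hC z hz).2.1 h)⟩
          · exact ⟨(hC' z hz).1, fun h => Or.inr ((hC' z hz).2 h)⟩
        · rintro v (rfl | rfl) <;> omega
        · rintro v (rfl | rfl) w (rfl | rfl) <;> omega
        · exact ⟨_, _, fun v hv => hv⟩
        · intro z; rw [Set.union_assoc]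
        · intro z
          simp only [Set.mem_union, Set.mem_sdiff, Set.mem_singleton_iff, Set.mem_ofPred_eq, cl_eq_iff,
            List.mem_singleton, forall_eq, Set.mem_insert_iff]
          constructor
          · rintro (⟨⟨h1, h2⟩ | h1, h3⟩ | h1)
            · exact Or.inl ⟨h1, h2, h3⟩
            · exact Or.inr ⟨h1.2, Or.inl h1.1⟩
            · exact Or.inr ⟨h1.2, Or.inr h1.1⟩
          · rintro (⟨h1, h2, h3⟩ | ⟨h1, h2 | h2⟩)
            · exact Or.inl ⟨Or.inl ⟨h1, h2⟩, h3⟩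
            · left; refine ⟨Or.inr ⟨h2, h1⟩, ?_⟩; omega
            · exact Or.inr ⟨h2, h1⟩
      by_cases hxT : T ≤ x
      · refine fin x (by omega) (by omega) ?_
        set X : Set Cl := {z | z.1 = x ∧ Yl ≤ z.2 ∧ z.2 < (x - 1) / 2} with hXd
        have hX : ∀ z, z ∈ X ↔ (z.1 = x ∧ Yl ≤ z.2 ∧ z.2 < (x - 1) / 2) := fun z => Iff.rfl
        clear_value X
        obtain ⟨C', hC', hs'⟩ := hs.extend hxE' (X := X) (w := (x, Yl)) (cl X (by
            intro z hz
            rw [hX] at hz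
            refine ⟨by unfold Zone; omega, by omega, ?_, by omega⟩
            unfold CondP
            by_cases h : z.2 ≤ (z.1 - 1) / 2 - 2
            · exact Or.inl h
            · exact Or.inr ⟨x, by simp, by omega⟩))
          (Conn.down (by omega) (fun y _ _ => (hX _).2 (by simp; omega))) ((hX _).2 (by simp; omega))
        refine ⟨C', ?_, hs'⟩
        intro z hz
        have := (hX z).1 (hC' hz)
        unfold Zone; omega
      · refine fin T (by omega) (by omega) ?_
        set X : Set Cl := {z | (z.2 = (x - 1) / 2 ∧ x < z.1 ∧ z.1 ≤ T) ∨ (z.1 = T ∧ Yl ≤ z.2 ∧ z.2 ≤ (x - 1) / 2)} with hXd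
        have hX : ∀ z, z ∈ X ↔ ((z.2 = (x - 1) / 2 ∧ x < z.1 ∧ z.1 ≤ T) ∨ (z.1 = T ∧ Yl ≤ z.2 ∧ z.2 ≤ (x - 1) / 2)) := fun z => Iff.rfl
        clear_value X
        obtain ⟨C', hC', hs'⟩ := hs.extend hxE' (X := X) (w := (T, Yl)) (cl X (by
            intro z hz
            rw [hX] at hz
            refine ⟨by unfold Zone; omega, by omega, ?_, by omega⟩
            unfold CondP
            by_cases h : z.2 ≤ (z.1 - 1) / 2 - 2
            · exact Or.inl h
            · exact Or.inr ⟨x, by simp, by omega⟩))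
          (conn_right_down (by omega) (by omega) (fun y _ _ => (hX _).2 (by simp; omega))
            (fun y _ _ => (hX _).2 (by simp; omega))) ((hX _).2 (by simp; omega))
        refine ⟨C', ?_, hs'⟩
        intro z hz
        have := (hX z).1 (hC' hz)
        unfold Zone; omega
    | x1 :: x2 :: t, hlen, hlE, hl, hp, hH =>
      have q1 := hl x1 (by simp)
      have q2 := hl x2 (by simp)
      have hp1 : x1 + 2 ≤ x2 := (List.pairwise_cons.1 hp).1 x2 (by simp)
      have hp' := (List.pairwise_cons.1 hp).2
      have hp2 : ∀ x ∈ t, x2 + 2 ≤ x := (List.pairwise_cons.1 hp').1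
      have hpt := (List.pairwise_cons.1 hp').2
      have hlt : ∀ x ∈ t, x2 + 2 ≤ x ∧ x ≤ Xm := fun x hx => ⟨hp2 x hx, (hl x (by simp [hx])).2⟩
      have hlen' : t.length ≤ n := by simp at hlen; omega
      set X : Set Cl := {z | (z.2 = Yc ∧ Xc < z.1 ∧ z.1 ≤ x1) ∨ (z.1 = x1 ∧ Yc ≤ z.2 ∧ z.2 < (x1 - 1) / 2)} with hXd
      have hX : ∀ z, z ∈ X ↔ ((z.2 = Yc ∧ Xc < z.1 ∧ z.1 ≤ x1) ∨ (z.1 = x1 ∧ Yc ≤ z.2 ∧ z.2 < (x1 - 1) / 2)) := fun z => Iff.rfl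
      clear_value X
      set Y : Set Cl := {z | (z.2 = (x1 - 1) / 2 ∧ x1 < z.1 ∧ z.1 ≤ x2) ∨ (z.1 = x2 ∧ (x1 - 1) / 2 ≤ z.2 ∧ z.2 < (x2 - 1) / 2)} with hYd
      have hY : ∀ z, z ∈ Y ↔ ((z.2 = (x1 - 1) / 2 ∧ x1 < z.1 ∧ z.1 ≤ x2) ∨ (z.1 = x2 ∧ (x1 - 1) / 2 ≤ z.2 ∧ z.2 < (x2 - 1) / 2)) := fun z => Iff.rfl
      clear_value Y
      have condx : ∀ (z : Cl), (z.2 ≤ (z.1 - 1) / 2 - 2 ∨ ((z.2 = (x1 - 1) / 2 ∧ x1 < z.1 ∧ z.1 ≤ x1 + 3) ∨ (z.2 = (x1 - 1) / 2 - 1 ∧ (z.1 = x1 ∨ z.1 = x1 + 1))) ∨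
          ((z.2 = (x2 - 1) / 2 ∧ x2 < z.1 ∧ z.1 ≤ x2 + 3) ∨ (z.2 = (x2 - 1) / 2 - 1 ∧ (z.1 = x2 ∨ z.1 = x2 + 1)))) →
          CondP (x1 :: x2 :: t) z := by
        rintro z (h | h | h)
        · exact Or.inl h
        · exact Or.inr ⟨x1, by simp, h⟩
        · exact Or.inr ⟨x2, by simp, h⟩
      have condt : ∀ z, CondP t z → CondP (x1 :: x2 :: t) z := by
        rintro z (h | ⟨x, hx, h⟩)
        · exact Or.inl h
        · exact Or.inr ⟨x, by simp [hx], h⟩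
      have hXc : ∀ z ∈ X, Zone Xm Yl z := by
        intro z hz; rw [hX] at hz; unfold Zone; omega
      have hYc : ∀ z ∈ Y, Zone Xm Yl z := by
        intro z hz; rw [hY] at hz; unfold Zone; omega
      have ex3 : ∀ v : Cl, (∃ x ∈ x1 :: x2 :: t, v.1 = x ∧ v.2 = (x - 1) / 2) ↔
          (v.1 = x1 ∧ v.2 = (x1 - 1) / 2) ∨ (v.1 = x2 ∧ v.2 = (x2 - 1) / 2) ∨ ∃ x ∈ t, v.1 = x ∧ v.2 = (x - 1) / 2 := by
        exact fun v => ex3_aux v x1 x2 t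
      have clX : Clear V {(Xc, Yc), (x1, (x1 - 1) / 2)} X := by
        intro z hz
        have hz0 := hXc z hz
        rw [hX] at hz
        have := hH z hz0 (by
          by_cases hh : Xc + 2 ≤ z.1
          · by_cases hh2 : Yc = (Xc - 1) / 2 ∧ z.2 = Yc ∧ Xc < z.1 ∧ z.1 ≤ Xc + 3
            · exact Or.inr (Or.inr hh2)
            · exact Or.inl ⟨hh, condx z (by omega)⟩
          · right; left; omega)
        refine ⟨this.1, fun v hv hadj => ?_⟩
        have h5 := this.2 v hv hadj
        rw [ex3] at h5
        rw [adj2_iff] at hadj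
        rcases h5 with h | h | h | ⟨x, hx, h⟩
        · exact Or.inl (cl_ext h.1 h.2)
        · exact Or.inr (cl_ext h.1 h.2)
        · omega
        · have := hlt x hx; omega
      have clY : Clear V {(x1, (x1 - 1) / 2), (x2, (x2 - 1) / 2)} Y := by
        intro z hz
        have hz0 := hYc z hz
        rw [hY] at hz
        have := hH z hz0 (Or.inl ⟨by omega, condx z (by omega)⟩)
        refine ⟨this.1, fun v hv hadj => ?_⟩
        have h5 := this.2 v hv hadj
        rw [ex3] at h5
        rw [adj2_iff] at hadj
        rcases h5 with h | h | h | ⟨x, hx, h⟩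
        · omega
        · exact Or.inl (cl_ext h.1 h.2)
        · exact Or.inr (cl_ext h.1 h.2)
        · have := hlt x hx; omega
      have n12 : (Xc, Yc) ≠ (x1, (x1 - 1) / 2) := by intro h; rw [Prod.mk.injEq] at h; omega
      have n23 : (x1, (x1 - 1) / 2) ≠ (x2, (x2 - 1) / 2) := by intro h; rw [Prod.mk.injEq] at h; omega
      have n13 : (Xc, Yc) ≠ (x2, (x2 - 1) / 2) := by intro h; rw [Prod.mk.injEq] at h; omega
      have cX : Conn (X ∪ {(x1, (x1 - 1) / 2)}) (Xc, Yc) (x1, (x1 - 1) / 2) := by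
        refine conn_right_up (by omega) (by omega) (fun x _ _ => Or.inl ((hX _).2 (by simp; omega))) ?_
        intro y hy1 hy2
        by_cases h : y = (x1 - 1) / 2
        · right; rw [h]; rfl
        · left; rw [hX]; simp; omega
      have cY : Conn (Y ∪ {(x2, (x2 - 1) / 2)}) (x1, (x1 - 1) / 2) (x2, (x2 - 1) / 2) := by
        refine conn_right_up (by omega) (by omega) (fun x _ _ => Or.inl ((hY _).2 (by simp; omega))) ?_
        intro y hy1 hy2
        by_cases h : y = (x2 - 1) / 2
        · right; rw [h]; rfl
        · left; rw [hY]; simp; omega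
      rcases hS.merge3 hcE (hlE x1 (by simp)) (hlE x2 (by simp)) n12 n23 n13 clX cX clY cY with
        ⟨C, hC, hs⟩ | ⟨C, hC, hs⟩
      · -- c joined with first
        have hHn : CHyp (V ∪ C) Xm Yl x2 ((x2 - 1) / 2) t := by
          intro z hz0 hz
          have hz1 : x2 ≤ z.1 := by rcases hz with hz | hz | hz <;> omega
          have := hH z hz0 (Or.inl ⟨by omega, by
            rcases hz with hz | hz | hz
            · exact condt z hz.2
            · exact condx z (by omega)
            · exact condx z (by omega)⟩)
          constructor
          · rintro (h | h)
            · exact this.1 h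
            · have := (hX z).1 (hC h); omega
          · rintro v (hv | hv) hadj
            · have h5 := this.2 v hv hadj
              rw [ex3] at h5
              rw [adj2_iff] at hadj
              rcases h5 with h | h | h | h
              · omega
              · omega
              · exact Or.inl h
              · exact Or.inr h
            · have := (hX v).1 (hC hv)
              rw [adj2_iff] at hadj; omega
        have memE : ∀ x, x1 + 2 ≤ x → (x, (x - 1) / 2) ∈ E → (x, (x - 1) / 2) ∈ E \ {(Xc, Yc), (x1, (x1 - 1) / 2)} := by
          intro x hx hxE
          refine ⟨hxE, ?_⟩
          rintro (h | h)
          · rw [Prod.mk.injEq] at h; omega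
          · rw [Set.mem_singleton_iff, Prod.mk.injEq] at h; omega
        obtain ⟨C', F, r1, r2, r3, r4, r5⟩ := ih t hlen' _ _ x2 ((x2 - 1) / 2) hs
          (memE x2 hp1 (hlE x2 (by simp)))
          (fun x hx => memE x (by have := hlt x hx; omega) (hlE x (by simp [hx]))) (Or.inl rfl) (by omega) (by omega)
          (by omega) hlt hpt hHn
        refine ⟨C ∪ C', F, ?_, r2, r3, r4, r5.congr ?_ ?_⟩
        · rintro z (hz | hz)
          · refine ⟨hXc z (hC hz), fun h => ?_⟩
            have := (hX z).1 (hC hz); omega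
          · exact r1 z hz
        · intro z; rw [Set.union_assoc]
        · intro z
          simp only [Set.mem_sdiff, Set.mem_insert_iff, Set.mem_singleton_iff, Set.mem_ofPred_eq, cl_eq_iff,
            List.mem_cons, forall_eq_or_imp, not_or]
          exact core_p1 _ _ _ _ _ _
      · -- first two joined; move c
        have ex2 : ∃ (Yn : ℤ) (C2 : Set Cl), (-1 ≤ Yn ∧ Yn ≤ (x2 - 1) / 2 - 3) ∧ Yn ≤ (Xc - 1) / 2 - 1 ∧ 1 ≤ Xc + 1 + Yn ∧
            (∀ z ∈ C2, Zone Xm Yl z ∧ z.2 ≠ Yl ∧ z.1 ≤ x2 ∧ ((z.1 = Xc + 1 ∧ z.2 = Yn + 1) ∨ z.2 = Yn)) ∧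
            Sys a b (V ∪ C ∪ C2) ((E \ {(x1, (x1 - 1) / 2), (x2, (x2 - 1) / 2)}) \ {(Xc, Yc)} ∪ {(x2, Yn)}) := by
          have hcE' : (Xc, Yc) ∈ E \ {(x1, (x1 - 1) / 2), (x2, (x2 - 1) / 2)} := by
            refine ⟨hcE, ?_⟩
            rintro (h | h)
            · exact n12 h
            · exact n13 h
          have gen : ∀ (Z : Set Cl), (∀ z ∈ Z, Zone Xm Yl z ∧ ((Xc + 2 ≤ z.1 ∧ z.2 ≤ (z.1 - 1) / 2 - 2) ∨
              (Xc ≤ z.1 ∧ z.1 ≤ Xc + 1 ∧ z.2 ≤ Yc ∧ ¬ (z.1 = Xc ∧ z.2 = Yc))) ∧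
              ((z.1 ≤ Xc + 1 ∧ z.2 ≤ Yc) ∨ z.2 ≤ (Xc - 1) / 2 - 1)) → Clear (V ∪ C) {(Xc, Yc)} Z := by
            intro Z hZ z hz
            obtain ⟨k1, k2, k3⟩ := hZ z hz
            have := hH z k1 (by
              rcases k2 with k2 | k2
              · exact Or.inl ⟨k2.1, Or.inl k2.2⟩
              · exact Or.inr (Or.inl k2))
            constructor
            · rintro (h | h)
              · exact this.1 h
              · have := (hY z).1 (hC h); omega
            · rintro v (hv | hv) hadj
              · have h5 := this.2 v hv hadj
                rw [adj2_iff] at hadj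
                rcases h5 with h | ⟨x, hx, h⟩
                · exact cl_ext h.1 h.2
                · have := hl x hx; omega
              · have := (hY v).1 (hC hv)
                rw [adj2_iff] at hadj; omega
          rcases hst with hf | hr
          · set Z : Set Cl := {z | (z.1 = Xc + 1 ∧ z.2 = Yc) ∨ (z.2 = Yc - 1 ∧ Xc + 1 ≤ z.1 ∧ z.1 ≤ x2)} with hZd
            have hZ : ∀ z, z ∈ Z ↔ ((z.1 = Xc + 1 ∧ z.2 = Yc) ∨ (z.2 = Yc - 1 ∧ Xc + 1 ≤ z.1 ∧ z.1 ≤ x2)) := fun z => Iff.rfl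
            clear_value Z
            obtain ⟨C2, hC2, hs2⟩ := hs.extend hcE' (X := Z) (w := (x2, Yc - 1)) (gen Z (by
              intro z hz
              rw [hZ] at hz
              unfold Zone
              refine ⟨?_, ?_, ?_⟩ <;> omega)) (by
              refine Conn.trans (Conn.single (v := (Xc + 1, Yc)) (by rw [adj2_mk]; omega) ((hZ _).2 (by simp))) ?_
              refine Conn.trans (Conn.single (v := (Xc + 1, Yc - 1)) (by rw [adj2_mk]; omega) ((hZ _).2 (by simp; omega))) ?_
              exact Conn.right (by omega) (fun x _ _ => (hZ _).2 (by simp; omega)))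
              ((hZ _).2 (by simp; omega))
            refine ⟨Yc - 1, C2, ?_, ?_, ?_, ?_, hs2⟩
            · omega
            · omega
            · omega
            · intro z hz
              have := (hZ z).1 (hC2 hz)
              unfold Zone; omega
          · set Z : Set Cl := {z | z.2 = Yc ∧ Xc + 1 ≤ z.1 ∧ z.1 ≤ x2} with hZd
            have hZ : ∀ z, z ∈ Z ↔ (z.2 = Yc ∧ Xc + 1 ≤ z.1 ∧ z.1 ≤ x2) := fun z => Iff.rfl
            clear_value Z
            obtain ⟨C2, hC2, hs2⟩ := hs.extend hcE' (X := Z) (w := (x2, Yc)) (gen Z (by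
              intro z hz
              rw [hZ] at hz
              unfold Zone
              refine ⟨?_, ?_, ?_⟩ <;> omega)) (Conn.right (by omega) (fun x _ _ => (hZ _).2 (by simp; omega)))
              ((hZ _).2 (by simp; omega))
            refine ⟨Yc, C2, ?_, ?_, ?_, ?_, hs2⟩
            · omega
            · omega
            · omega
            · intro z hz
              have := (hZ z).1 (hC2 hz)
              unfold Zone; omega
        obtain ⟨Yn, C2, hYn, hYn2, hYn3, hC2, hs2⟩ := ex2
        have hHn : CHyp (V ∪ C ∪ C2) Xm Yl x2 Yn t := by
          intro z hz0 hz
          have hz1 : x2 ≤ z.1 := by rcases hz with hz | hz | hz <;> omega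
          have hz2 : z.1 ≤ x2 + 1 → z.2 ≤ Yn ∧ ¬ (z.1 = x2 ∧ z.2 = Yn) := by rcases hz with hz | hz | hz <;> omega
          have := hH z hz0 (Or.inl ⟨by omega, by
            rcases hz with hz | hz | hz
            · exact condt z hz.2
            · exact condx z (by omega)
            · exact condx z (by omega)⟩)
          constructor
          · rintro ((h | h) | h)
            · exact this.1 h
            · have := (hY z).1 (hC h); omega
            · have := hC2 z h; omega
          · rintro v ((hv | hv) | hv) hadj
            · have h5 := this.2 v hv hadj
              rw [ex3] at h5
              rw [adj2_iff] at hadj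
              rcases h5 with h | h | h | h
              · omega
              · omega
              · omega
              · exact Or.inr h
            · have := (hY v).1 (hC hv)
              rw [adj2_iff] at hadj; omega
            · have := (hC2 v hv).2
              rw [adj2_iff] at hadj; left; omega
        have memE : ∀ x, x2 + 2 ≤ x → (x, (x - 1) / 2) ∈ E → (x, (x - 1) / 2) ∈
            (E \ {(x1, (x1 - 1) / 2), (x2, (x2 - 1) / 2)}) \ {(Xc, Yc)} ∪ {(x2, Yn)} := by
          intro x hx hxE
          refine Or.inl ⟨⟨hxE, ?_⟩, ?_⟩
          · rintro (h | h)
            · rw [Prod.mk.injEq] at h; omega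
            · rw [Set.mem_singleton_iff, Prod.mk.injEq] at h; omega
          · intro h
            rw [Set.mem_singleton_iff, Prod.mk.injEq] at h; omega
        obtain ⟨C', F, r1, r2, r3, r4, r5⟩ := ih t hlen' _ _ x2 Yn hs2
          (Or.inr rfl)
          (fun x hx => memE x (hlt x hx).1 (hlE x (by simp [hx]))) (Or.inr hYn) (by omega) (by omega)
          (by omega) hlt hpt hHn
        have hnE : (x2, Yn) ∉ E := by
          intro hE'
          have := (hH (x2, Yn) (by unfold Zone; simp only; omega) (Or.inl ⟨by simp only; omega, Or.inl (by simp only; omega)⟩)).1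
          exact this (hS.sub hE')
        refine ⟨C ∪ C2 ∪ C', F, ?_, r2, r3, r4, r5.congr ?_ ?_⟩
        · rintro z ((hz | hz) | hz)
          · refine ⟨hYc z (hC hz), fun h => ?_⟩
            have := (hY z).1 (hC hz); omega
          · exact ⟨(hC2 z hz).1, fun h => absurd h (hC2 z hz).2.1⟩
          · exact r1 z hz
        · intro z; rw [Set.union_assoc, Set.union_assoc, Set.union_assoc]
        · intro z
          have hz : z ∈ E → ¬ (z.1 = x2 ∧ z.2 = Yn) := by
            intro h1 h2
            exact hnE ((cl_ext h2.1 h2.2) ▸ h1)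
          simp only [Set.mem_sdiff, Set.mem_insert_iff, Set.mem_singleton_iff, Set.mem_ofPred_eq, cl_eq_iff,
            List.mem_cons, forall_eq_or_imp, not_or, Set.mem_union]
          exact core_p2 _ _ _ _ _ _ _ hz

/-- The carry lemma: a sorted family of pending ends `(x, (x-1)/2)` is reduced to at most two ends. -/
theorem core {a b : Cl} {Xm Yl T : ℤ} (hYl : Yl ≤ -2) (hT : 1 ≤ T - 2 + Yl) (hTm : T ≤ Xm)
    {V E : Set Cl} (hS : Sys a b V E) (I : Set ℤ) (hIE : ∀ x ∈ I, (x, (x - 1) / 2) ∈ E)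
    (hI : ∀ x ∈ I, 1 ≤ x ∧ x ≤ Xm) (hsp : ∀ x ∈ I, ∀ y ∈ I, x < y → x + 2 ≤ y)
    (hH : ∀ z : Cl, Zone Xm Yl z → (z.2 ≤ (z.1 - 1) / 2 - 2 ∨
      ∃ x ∈ I, (z.2 = (x - 1) / 2 ∧ x < z.1 ∧ z.1 ≤ x + 3) ∨ (z.2 = (x - 1) / 2 - 1 ∧ (z.1 = x ∨ z.1 = x + 1))) →
      z ∉ V ∧ ∀ v ∈ V, Adj2 z v → ∃ x ∈ I, v.1 = x ∧ v.2 = (x - 1) / 2) :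
    ∃ (C : Set Cl) (F : Set ℤ), (∀ z ∈ C, Zone Xm Yl z ∧ (z.2 = Yl → z.1 ∈ F)) ∧
      (∀ u ∈ F, T - 2 ≤ u ∧ u ≤ Xm) ∧ (∀ u ∈ F, ∀ v ∈ F, u < v → u + 2 ≤ v) ∧
      (∃ u1 u2, ∀ u ∈ F, u = u1 ∨ u = u2) ∧
      Sys a b (V ∪ C) {z | (z ∈ E ∧ ∀ x ∈ I, ¬ (z.1 = x ∧ z.2 = (x - 1) / 2)) ∨ (z.2 = Yl ∧ z.1 ∈ F)} := by
  have hfin : I.Finite := (Set.finite_Icc 1 Xm).subset (fun x hx => hI x hx)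
  obtain ⟨l, hl, hsort⟩ : ∃ l : List ℤ, (∀ x, x ∈ l ↔ x ∈ I) ∧ l.Pairwise (fun x y => x + 2 ≤ y) := by
    refine ⟨hfin.toFinset.sort (· ≤ ·), fun x => by simp, ?_⟩
    have h1 : (hfin.toFinset.sort (· ≤ ·)).Pairwise (· < ·) := Finset.sortedLT_sort _ |>.pairwise
    refine List.Pairwise.imp_of_mem ?_ h1
    intro x y hx hy hxy
    exact hsp x (by simpa using hx) y (by simpa using hy) hxy
  cases l with
  | nil =>
    have hI0 : ∀ x, x ∉ I := fun x hx => by simpa using (hl x).2 hx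
    refine ⟨∅, ∅, by simp, by simp, by simp, ⟨0, 0, by simp⟩, hS.congr (by simp) ?_⟩
    intro z
    simp only [Set.mem_ofPred_eq, Set.mem_empty_iff_false, and_false, or_false]
    exact ⟨fun h => ⟨h, fun x hx => absurd hx (hI0 x)⟩, fun h => h.1⟩
  | cons x0 l =>
    have hx0 := (hl x0).1 (by simp)
    have q0 := hI x0 hx0
    have hlI : ∀ x ∈ l, x ∈ I := fun x hx => (hl x).1 (by simp [hx])
    have hs1 := List.pairwise_cons.1 hsort
    obtain ⟨C, F, r1, r2, r3, r4, r5⟩ := core_aux hYl hT hTm l.length l le_rfl V E x0 ((x0 - 1) / 2) hS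
      (hIE x0 hx0) (fun x hx => hIE x (hlI x hx)) (Or.inl rfl) q0.1 q0.2 (by omega)
      (fun x hx => ⟨hs1.1 x hx, (hI x (hlI x hx)).2⟩) hs1.2 (by
        intro z hz0 hz
        have := hH z hz0 (by
          rcases hz with ⟨_, h | ⟨x, hx, h⟩⟩ | h | h
          · exact Or.inl h
          · exact Or.inr ⟨x, hlI x hx, h⟩
          · by_cases h' : z.2 ≤ (z.1 - 1) / 2 - 2
            · exact Or.inl h'
            · exact Or.inr ⟨x0, hx0, by omega⟩
          · exact Or.inr ⟨x0, hx0, by omega⟩)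
        refine ⟨this.1, fun v hv hadj => ?_⟩
        obtain ⟨x, hx, h⟩ := this.2 v hv hadj
        rcases List.mem_cons.1 ((hl x).2 hx) with rfl | hx'
        · exact Or.inl h
        · exact Or.inr ⟨x, hx', h⟩)
    refine ⟨C, F, r1, r2, r3, r4, r5.congr (fun _ => Iff.rfl) ?_⟩
    intro z
    have : (∀ x ∈ I, ¬ (z.1 = x ∧ z.2 = (x - 1) / 2)) ↔
        (¬ (z.1 = x0 ∧ z.2 = (x0 - 1) / 2) ∧ ∀ x ∈ l, ¬ (z.1 = x ∧ z.2 = (x - 1) / 2)) := by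
      constructor
      · intro h; exact ⟨h x0 hx0, fun x hx => h x (hlI x hx)⟩
      · rintro ⟨h1, h2⟩ x hx
        rcases List.mem_cons.1 ((hl x).2 hx) with rfl | hx'
        · exact h1
        · exact h2 x hx'
    simp only [Set.mem_ofPred_eq, this]

def KK (P D : Set Cl) : Set Cl := {p | p ∈ P ∧ p ∉ D ∧ ∃ q ∈ P, q ∉ D ∧ Adj2 p q}

def VV (P D : Set Cl) : Set Cl := {p | p ∈ P ∧ (p ∈ KK P D ∨ ∃ q ∈ KK P D, Adj2 p q)}

def EE (P D : Set Cl) : Set Cl := {p | p ∈ VV P D ∧ ∃ q ∈ P, q ∉ VV P D ∧ Adj2 p q}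

theorem KK_VV {P D : Set Cl} {p : Cl} (h : p ∈ KK P D) : p ∈ VV P D := ⟨h.1, Or.inl h⟩

theorem KK_nb {P D : Set Cl} {p : Cl} (h : p ∈ KK P D) : ∃ q ∈ KK P D, Adj2 p q := by
  obtain ⟨h1, h2, q, h3, h4, h5⟩ := h
  exact ⟨q, ⟨h3, h4, p, h1, h2, adj2_symm h5⟩, h5⟩

theorem VV_nb {P D : Set Cl} {p : Cl} (h : p ∈ VV P D) : ∃ q ∈ KK P D, Adj2 p q := by
  rcases h.2 with h | h
  · exact KK_nb h
  · exact h

theorem EE_D {P D : Set Cl} {p : Cl} (h : p ∈ EE P D) : p ∈ D := by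
  by_contra hD
  obtain ⟨⟨h1, h2⟩, q, h3, h4, h5⟩ := h
  have hK : p ∈ KK P D := by
    rcases h2 with h2 | ⟨q, hq, hpq⟩
    · exact h2
    · exact ⟨h1, hD, q, hq.1, hq.2.1, hpq⟩
  exact h4 ⟨h3, Or.inr ⟨p, hK, adj2_symm h5⟩⟩

def Deg3 (P : Set Cl) : Prop := ∀ p ∈ P, ∀ q1 ∈ P, ∀ q2 ∈ P, ∀ q3 ∈ P, Adj2 p q1 → Adj2 p q2 → Adj2 p q3 →
  q1 ≠ q2 → q1 ≠ q3 → q2 ≠ q3 → False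

def Deg2 (P D : Set Cl) : Prop := ∀ z ∈ P, z ∈ D → ∀ p, ∃ q ∈ P, q ≠ p ∧ Adj2 z q

/-- `D` is the hypograph of `h` on a window -/
structure Roof (D : Set Cl) (x0 x1 y0 : ℤ) (h : ℤ → ℤ) : Prop where
  mem : ∀ z : Cl, x0 ≤ z.1 → z.1 ≤ x1 → y0 ≤ z.2 → (z ∈ D ↔ z.2 ≤ h z.1)
  step : ∀ x, x0 ≤ x → x + 1 ≤ x1 → h x - 1 ≤ h (x + 1) ∧ h (x + 1) ≤ h x + 1
  step2 : ∀ x, x0 ≤ x → x + 2 ≤ x1 → h x - 1 ≤ h (x + 2) ∧ h (x + 2) ≤ h x + 1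

theorem Roof.top {P D : Set Cl} {x0 x1 y0 : ℤ} {h : ℤ → ℤ} (H : Roof D x0 x1 y0 h) {z : Cl}
    (hz : z ∈ VV P D) (hD : z ∈ D) (h0 : x0 < z.1) (h1 : z.1 < x1) (h2 : y0 < z.2) : z.2 = h z.1 := by
  obtain ⟨p, hp, hadj⟩ := VV_nb hz
  have e1 := (H.mem z (by omega) (by omega) h2.le).1 hD
  by_contra hne
  refine hp.2.1 ?_
  have s1 := H.step z.1 (by omega) (by omega)
  have s2 := H.step (z.1 - 1) (by omega) (by omega)
  rw [show z.1 - 1 + 1 = z.1 by ring] at s2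
  rw [adj2_iff] at hadj
  refine (H.mem p (by omega) (by omega) (by omega)).2 ?_
  have : p.1 = z.1 ∨ p.1 = z.1 + 1 ∨ p.1 = z.1 - 1 := by omega
  rcases this with h | h | h <;> rw [h] <;> omega

theorem far_geom {x0 x1 : ℤ} {h : ℤ → ℤ} (step : ∀ x, x0 ≤ x → x + 1 ≤ x1 → h x - 1 ≤ h (x + 1) ∧ h (x + 1) ≤ h x + 1)
    (step2 : ∀ x, x0 ≤ x → x + 2 ≤ x1 → h x - 1 ≤ h (x + 2) ∧ h (x + 2) ≤ h x + 1) (x : ℤ) (p q : Cl)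
    (h0 : x0 < x) (h1 : x + 1 < x1) (hp : Adj2 (x, h x) p) (hq : Adj2 (x + 1, h (x + 1)) q)
    (mp : h p.1 < p.2) (mq : h q.1 < q.2) (A : ¬ Adj2 (x, h x) (x + 1, h (x + 1)))
    (B : ¬ Adj2 p (x + 1, h (x + 1))) (C : ¬ Adj2 (x, h x) q) : False := by
  have s1 := step (x - 1) (by omega) (by omega)
  have s2 := step x (by omega) (by omega)
  have s3 := step (x + 1) (by omega) (by omega)
  have s4 := step2 (x - 1) (by omega) (by omega)
  have s5 := step2 x (by omega) (by omega)
  rw [show x - 1 + 1 = x by ring] at s1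
  rw [show x + 1 + 1 = x + 2 by ring] at s3
  rw [show x - 1 + 2 = x + 1 by ring] at s4
  obtain ⟨p1, p2⟩ := p
  obtain ⟨q1, q2⟩ := q
  rw [adj2_mk] at hp hq A B C
  have mp' : (p1 = x ∧ h x < p2) ∨ (p1 = x - 1 ∧ h (x - 1) < p2) ∨ (p1 = x + 1 ∧ h (x + 1) < p2) := by
    have : p1 = x ∨ p1 = x - 1 ∨ p1 = x + 1 := by omega
    rcases this with e | e | e <;> simp only [e] at mp <;> omega
  have mq' : (q1 = x ∧ h x < q2) ∨ (q1 = x + 2 ∧ h (x + 2) < q2) ∨ (q1 = x + 1 ∧ h (x + 1) < q2) := by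
    have : q1 = x ∨ q1 = x + 2 ∨ q1 = x + 1 := by omega
    rcases this with e | e | e <;> simp only [e] at mq <;> omega
  clear mp mq step step2
  generalize h (x - 1) = g0 at *
  generalize h x = g1 at *
  generalize h (x + 1) = g2 at *
  generalize h (x + 2) = g3 at *
  have : g2 = g1 ∨ g2 = g1 + 1 ∨ g2 = g1 - 1 := by omega
  rcases this with e | e | e
  · omega
  · clear mq' C hq s3 s5
    rcases mp' with mp' | mp' | mp' <;> omega
  · clear mp' B hp s1 s4
    rcases mq' with mp' | mp' | mp' <;> omega

theorem Roof.far {P D : Set Cl} {x0 x1 y0 : ℤ} {h : ℤ → ℤ} (H : Roof D x0 x1 y0 h) (hd : Deg3 P) {z w : Cl}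
    (hz : z ∈ EE P D) (hw : w ∈ VV P D) (hwD : w ∈ D) (h0 : x0 < z.1) (h1 : z.1 < x1) (h2 : y0 < z.2)
    (h0' : x0 < w.1) (h1' : w.1 < x1) (h2' : y0 < w.2) (hn : z.1 = w.1 + 1 ∨ w.1 = z.1 + 1) : False := by
  have hzD := EE_D hz
  have tz := H.top hz.1 hzD h0 h1 h2
  have tw := H.top hw hwD h0' h1' h2'
  obtain ⟨p, hp, zp⟩ := VV_nb hz.1
  obtain ⟨p', hp', wp⟩ := VV_nb hw
  obtain ⟨hzV, r, hr, hrV, zr⟩ := hz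
  have ne1 : p ≠ r := fun e => hrV (e ▸ KK_VV hp)
  have ne2 : w ≠ r := fun e => hrV (e ▸ hw)
  have ne3 : p' ≠ r := fun e => hrV (e ▸ KK_VV hp')
  have A : ¬ Adj2 z w := fun e => hd z hzV.1 p hp.1 w hw.1 r hr zp e zr
    (fun e => hp.2.1 (e ▸ hwD)) ne1 ne2
  have B : ¬ Adj2 p w := by
    intro e
    obtain ⟨hpP, hpD, q, hq, hqD, pq⟩ := hp
    exact hd p hpP z hzV.1 w hw.1 q hq (adj2_symm zp) e pq (by rintro rfl; omega)
      (fun e => hqD (e ▸ hzD)) (fun e => hqD (e ▸ hwD))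
  have C : ¬ Adj2 z p' := by
    intro e
    by_cases hpp : p = p'
    · subst hpp; exact B (adj2_symm wp)
    · exact hd z hzV.1 p hp.1 p' hp'.1 r hr zp e zr hpp ne1 ne3
  have hpD := hp.2.1
  have hpD' := hp'.2.1
  have m1 : h p.1 < p.2 := by
    by_contra hh
    have zp' := (adj2_iff _ _).1 zp
    exact hpD ((H.mem p (by omega) (by omega) (by omega)).2 (by omega))
  have m2 : h p'.1 < p'.2 := by
    by_contra hh
    have wp' := (adj2_iff _ _).1 wp
    exact hpD' ((H.mem p' (by omega) (by omega) (by omega)).2 (by omega))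
  have ez : z = (z.1, h z.1) := Prod.ext rfl tz
  have ew : w = (w.1, h w.1) := Prod.ext rfl tw
  rcases hn with hn | hn
  · rw [hn] at ez
    rw [ez] at zp A C
    rw [ew] at wp A B
    exact far_geom H.step H.step2 w.1 p' p h0' (by omega) wp zp m2 m1 (fun e => A (adj2_symm e))
      (fun e => C (adj2_symm e)) (fun e => B (adj2_symm e))
  · rw [hn] at ew
    rw [ez] at zp A C
    rw [ew] at wp A B
    exact far_geom H.step H.step2 z.1 p p' h0 (by omega) zp wp m1 m2 A B C

theorem sector {a b : Cl} {P D V E : Set Cl} {Xm Yl T : ℤ} (hYl : Yl ≤ -2) (hT : 1 ≤ T - 2 + Yl) (hTm : T ≤ Xm)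
    (hd : Deg3 P) (h2 : Deg2 P D) (h00 : ((0 : ℤ), (0 : ℤ)) ∉ P)
    (R : Roof D 0 (Xm + 4) (Yl - 4) (fun x => x / 2)) (hS : Sys a b V E)
    (hV : ∀ z : Cl, 0 ≤ z.1 → z.1 ≤ Xm + 1 → 0 ≤ z.1 + z.2 → Yl - 1 ≤ z.2 →
      ((z ∈ V ↔ z ∈ VV P D) ∧ (z ∈ E ↔ z ∈ EE P D))) :
    ∃ (C : Set Cl) (F : Set ℤ), (∀ z ∈ C, Zone Xm Yl z ∧ (z.2 = Yl → z.1 ∈ F)) ∧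
      (∀ u ∈ F, T - 2 ≤ u ∧ u ≤ Xm) ∧ (∀ u ∈ F, ∀ v ∈ F, u < v → u + 2 ≤ v) ∧
      Sys a b (V ∪ C) {z | (z ∈ E ∧ ¬ Zone Xm Yl z) ∨ (z.2 = Yl ∧ z.1 ∈ F)} := by
  have tV : ∀ z ∈ V, 1 ≤ z.1 → z.1 ≤ Xm + 1 → 0 ≤ z.1 + z.2 → Yl - 1 ≤ z.2 → z.2 ≤ z.1 / 2 → z.2 = z.1 / 2 := by
    intro z hz a1 a2 a3 a4 a5
    exact R.top (((hV z (by omega) a2 a3 a4).1).1 hz) ((R.mem z (by omega) (by omega) (by omega)).2 a5)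
      (by omega) (by omega) (by omega)
  have tE : ∀ z ∈ E, 1 ≤ z.1 → z.1 ≤ Xm + 1 → 0 ≤ z.1 + z.2 → Yl - 1 ≤ z.2 → z.2 = z.1 / 2 := by
    intro z hz a1 a2 a3 a4
    have hz' := ((hV z (by omega) a2 a3 a4).2).1 hz
    exact R.top hz'.1 (EE_D hz') (by omega) (by omega) (by omega)
  set I : Set ℤ := {x | 1 ≤ x ∧ x ≤ Xm ∧ (x, x / 2) ∈ E} with hId
  have hI : ∀ x, x ∈ I ↔ (1 ≤ x ∧ x ≤ Xm ∧ (x, x / 2) ∈ E) := fun x => Iff.rfl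
  clear_value I
  have fE : ∀ x ∈ I, ∀ y, 1 ≤ y → y ≤ Xm + 1 → (y = x + 1 ∨ x = y + 1) → (y, y / 2) ∉ V := by
    intro x hx y y1 y2 hxy hyV
    obtain ⟨x1, x2, x3⟩ := (hI x).1 hx
    have e1 := ((hV (x, x / 2) (by simp only; omega) (by simp only; omega) (by simp only; omega) (by simp only; omega)).2).1 x3
    have e2 := ((hV (y, y / 2) (by simp only; omega) (by simp only; omega) (by simp only; omega) (by simp only; omega)).1).1 hyV
    exact R.far hd e1 e2 ((R.mem _ (by simp only; omega) (by simp only; omega) (by simp only; omega)).2 (le_refl _))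
      (by simp only; omega) (by simp only; omega) (by simp only; omega) (by simp only; omega) (by simp only; omega)
      (by simp only; omega) (by simp only; omega)
  have f5 : ∀ k : ℤ, 0 ≤ k → 2 * k + 1 ≤ Xm → (2 * k + 1, k) ∈ V → (2 * k + 1, k) ∉ E → (2 * k, k) ∈ V := by
    intro k k0 k1 kV kE
    have e1 := ((hV (2 * k + 1, k) (by simp only; omega) (by simp only; omega) (by simp only; omega) (by simp only; omega)).1).1 kV
    have e2 : (2 * k + 1, k) ∉ EE P D := fun h =>
      kE (((hV (2 * k + 1, k) (by simp only; omega) (by simp only; omega) (by simp only; omega) (by simp only; omega)).2).2 h)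
    have kD : (2 * k + 1, k) ∈ D := (R.mem _ (by simp only; omega) (by simp only; omega) (by simp only; omega)).2 (by simp only; omega)
    obtain ⟨q, hq, hqp, hadj⟩ := h2 _ e1.1 kD (2 * k + 1, k + 1)
    have qV : q ∈ VV P D := by
      by_contra hq'
      exact e2 ⟨e1, q, hq, hq', hadj⟩
    rw [adj2_iff] at hadj
    have hqn : ¬ (q.1 = 2 * k + 1 ∧ q.2 = k + 1) := fun h => hqp (cl_ext h.1 h.2)
    simp only at hadj
    have qD : q ∈ D := (R.mem _ (by omega) (by omega) (by omega)).2 (by omega)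
    by_cases h0 : q.1 = 0
    · exfalso
      have : q = (0, 0) := cl_ext h0 (by omega)
      exact h00 (this ▸ hq)
    · have := R.top qV qD (by omega) (by omega) (by omega)
      have hq2 : q = (2 * k, k) := cl_ext (by omega) (by omega)
      rw [← hq2]
      exact ((hV q (by omega) (by omega) (by omega) (by omega)).1).2 qV
  -- normalization
  have hfin : ({z | z ∈ E ∧ z.1 % 2 = 0 ∧ 1 ≤ z.1 ∧ z.1 ≤ Xm ∧ z.2 = z.1 / 2} : Set Cl).Finite :=
    hS.finiteE.subset (fun z hz => hz.1)
  obtain ⟨S, hSm⟩ : ∃ S : Finset Cl, ∀ z, z ∈ S ↔ (z ∈ E ∧ z.1 % 2 = 0 ∧ 1 ≤ z.1 ∧ z.1 ≤ Xm ∧ z.2 = z.1 / 2) :=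
    ⟨hfin.toFinset, fun z => by rw [Set.Finite.mem_toFinset]; rfl⟩
  have SI : ∀ z ∈ S, z.1 ∈ I := by
    intro z hz
    obtain ⟨b1, b2, b3, b4, b5⟩ := (hSm z).1 hz
    exact (hI _).2 ⟨b3, b4, by rw [← b5]; exact b1⟩
  obtain ⟨C1, hC1, hs1⟩ := hS.multi S (fun e => {(e.1, e.2 - 1)}) (fun e => (e.1, e.2 - 1))
    (fun e he => ((hSm e).1 he).1)
    (by
      intro e he c hc
      rw [Set.mem_singleton_iff] at hc
      subst hc
      have heI := SI e he
      obtain ⟨b1, b2, b3, b4, b5⟩ := (hSm e).1 he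
      constructor
      · intro h
        have := tV _ h b3 (by simp only; omega) (by simp only; omega) (by simp only; omega) (by simp only; omega)
        simp only at this; omega
      · intro v hv hadj
        rw [adj2_iff] at hadj
        simp only at hadj
        have := tV v hv (by omega) (by omega) (by omega) (by omega) (by omega)
        by_cases hve : v.1 = e.1
        · exact Prod.ext hve (by omega)
        · exfalso
          refine fE e.1 heI v.1 (by omega) (by omega) (by omega) ?_
          rw [← this]; exact hv)
    (by
      intro e he e' he' hne c hc d hd'
      rw [Set.mem_singleton_iff] at hc hd'
      obtain ⟨b1, b2, b3, b4, b5⟩ := (hSm e).1 he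
      obtain ⟨c1, c2, c3, c4, c5⟩ := (hSm e').1 he'
      have : e.1 ≠ e'.1 := fun h => hne (Prod.ext h (by rw [b5, c5, h]))
      subst hc; subst hd'
      rw [adj2_iff, Ne, Prod.mk.injEq]
      simp only
      omega)
    (by
      intro e he
      have : Conn ({(e.1, e.2 - 1)} : Set Cl) e (e.1, e.2 - 1) := Conn.single ((adj2_iff _ _).2 (Or.inl ⟨rfl, Or.inl (by show e.2 = e.2 - 1 + 1; ring)⟩)) rfl
      exact ⟨this, Or.inr rfl⟩)
  have hC1' : ∀ c ∈ C1, (c.1 ∈ I ∧ c.1 % 2 = 0 ∧ 2 ≤ c.1 ∧ c.1 ≤ Xm ∧ c.2 = c.1 / 2 - 1) := by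
    intro c hc
    obtain ⟨e, he, hce⟩ := hC1 c hc
    have hce' : c = (e.1, e.2 - 1) := hce
    obtain ⟨b1, b2, b3, b4, b5⟩ := (hSm e).1 he
    rw [hce']
    exact ⟨SI e he, b2, by simp only; omega, by simp only; omega, by simp only; omega⟩
  have hsp : ∀ x ∈ I, ∀ y ∈ I, x < y → x + 2 ≤ y := by
    intro x hx y hy hxy
    by_contra hh
    have hy' := (hI y).1 hy
    exact fE x hx y (by omega) (by omega) (by omega) (hS.sub hy'.2.2)
  obtain ⟨C2, F, r1, r2, r3, r4, r5⟩ := core hYl hT hTm hs1 I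
    (by
      intro x hx
      have hx' := (hI x).1 hx
      by_cases hp : x % 2 = 0
      · right
        exact ⟨(x, x / 2), (hSm _).2 ⟨hx'.2.2, hp, hx'.1, hx'.2.1, rfl⟩, Prod.ext rfl (by simp only; omega)⟩
      · left
        rw [show (x - 1) / 2 = x / 2 by omega]
        exact ⟨hx'.2.2, fun h => hp ((hSm _).1 h).2.1⟩)
    (fun x hx => ⟨((hI x).1 hx).1, ((hI x).1 hx).2.1⟩) hsp
    (by
      intro z hz hc
      unfold Zone at hz
      have low : ∀ v : Cl, 1 ≤ v.1 → v.1 ≤ Xm + 1 → 0 ≤ v.1 + v.2 → Yl - 1 ≤ v.2 → v.2 ≤ v.1 / 2 → v ∈ V ∪ C1 →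
          (v.2 = v.1 / 2 ∧ v ∈ V) ∨ (v.2 = v.1 / 2 - 1 ∧ v.1 ∈ I ∧ v.1 % 2 = 0) := by
        rintro v a1 a2 a3 a4 a5 (h | h)
        · exact Or.inl ⟨tV v h a1 a2 a3 a4 a5, h⟩
        · have := hC1' v h
          exact Or.inr ⟨this.2.2.2.2, this.1, this.2.1⟩
      rcases hc with hc | ⟨x, hx, hc⟩
      · constructor
        · intro h
          have := low z (by omega) (by omega) (by omega) (by omega) (by omega) h
          omega
        · intro v hv hadj
          exfalso
          rw [adj2_iff] at hadj
          have := low v (by omega) (by omega) (by omega) (by omega) (by omega) hv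
          omega
      · have hx' := (hI x).1 hx
        have nR : ∀ v : Cl, v.1 = x + 1 → v.2 = (x + 1) / 2 → x + 1 ≤ Xm + 1 → v ∉ V := by
          intro v e1 e2 e3 hv
          refine fE x hx (x + 1) (by omega) e3 (Or.inl rfl) ?_
          rw [← e2, ← e1]; exact hv
        have nL : ∀ v : Cl, v.1 = x - 1 → v.2 = (x - 1) / 2 → 1 ≤ x - 1 → v ∉ V := by
          intro v e1 e2 e3 hv
          refine fE x hx (x - 1) e3 (by omega) (Or.inr (by ring)) ?_
          rw [← e2, ← e1]; exact hv
        have nRI : x + 1 ∉ I := fun h => by have := hsp x hx (x + 1) h (by omega); omega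
        have nLI : x - 1 ∉ I := fun h => by have := hsp (x - 1) h x hx (by omega); omega
        have nI : ∀ v : Cl, v.1 ∈ I → v.1 ≠ x + 1 ∧ v.1 ≠ x - 1 := fun v hv =>
          ⟨fun e => nRI (e ▸ hv), fun e => nLI (e ▸ hv)⟩
        constructor
        · intro h
          have hl := low z (by omega) (by omega) (by omega) (by omega) (by omega) h
          rcases hl with ⟨hl1, hl2⟩ | ⟨hl1, hl2, hl3⟩
          · have := nR z; omega
          · have := nI z hl2; omega
        · intro v hv hadj
          have hadj' := (adj2_iff _ _).1 hadj
          have hl := low v (by omega) (by omega) (by omega) (by omega) (by omega) hv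
          by_cases hvx : v.1 = x
          · refine ⟨x, hx, hvx, ?_⟩
            omega
          rcases hl with ⟨hl1, hl2⟩ | ⟨hl1, hl2, hl3⟩
          · by_cases hvE : v ∈ E
            · have hvI : v.1 ∈ I := (hI _).2 ⟨by omega, by omega, by rw [← hl1]; exact hvE⟩
              refine ⟨v.1, hvI, rfl, ?_⟩
              have := nI v hvI
              omega
            · exfalso
              have q1 := nR v
              have q2 := nL v
              have hv3 : v.1 = x + 2 ∧ x % 2 = 1 := by
                by_cases a1 : v.1 = x + 1
                · exact absurd hl2 (q1 a1 (by omega) (by omega))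
                · by_cases a2 : v.1 = x - 1
                  · exact absurd hl2 (q2 a2 (by omega) (by omega))
                  · omega
              have hv4 : v = (2 * (v.1 / 2) + 1, v.1 / 2) := Prod.ext (by simp only; omega) hl1
              have := f5 (v.1 / 2) (by omega) (by omega) (hv4 ▸ hl2) (hv4 ▸ hvE)
              exact nR (2 * (v.1 / 2), v.1 / 2) (by simp only; omega) (by simp only; omega) (by omega) this
          · have := nI v hl2
            exact ⟨v.1, hl2, rfl, by omega⟩)
  refine ⟨C1 ∪ C2, F, ?_, r2, r3, r5.congr ?_ ?_⟩
  · rintro z (hz | hz)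
    · have := hC1' z hz
      refine ⟨?_, fun h => ?_⟩
      · unfold Zone; omega
      · omega
    · exact r1 z hz
  · intro z; rw [Set.union_assoc]
  · intro z
    simp only [Set.mem_ofPred_eq]
    refine or_congr_left ?_
    constructor
    · rintro ⟨h1 | ⟨e, he, h1⟩, h3⟩
      · refine ⟨h1.1, fun hz => ?_⟩
        unfold Zone at hz
        have t := tE z h1.1 (by omega) (by omega) (by omega) (by omega)
        by_cases hp : z.1 % 2 = 0
        · exact h1.2 ((hSm _).2 ⟨h1.1, hp, by omega, by omega, t⟩)
        · exact h3 z.1 ((hI _).2 ⟨by omega, by omega, by rw [← t]; exact h1.1⟩) ⟨rfl, by omega⟩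
      · exfalso
        obtain ⟨b1, b2, b3, b4, b5⟩ := (hSm e).1 he
        refine h3 e.1 (SI e he) ⟨by rw [h1], by rw [h1]; simp only; omega⟩
    · rintro ⟨h1, h3⟩
      refine ⟨Or.inl ⟨h1, fun hz => ?_⟩, fun x hx hz => ?_⟩
      · obtain ⟨b1, b2, b3, b4, b5⟩ := (hSm z).1 hz
        apply h3; unfold Zone; omega
      · have hx' := (hI x).1 hx
        apply h3; unfold Zone; omega

theorem iso_symm {f : Cl ≃ Cl} (hf : ∀ x y, Adj2 (f x) (f y) ↔ Adj2 x y) (x y : Cl) :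
    Adj2 (f.symm x) (f.symm y) ↔ Adj2 x y := by
  have := hf (f.symm x) (f.symm y)
  simpa using this.symm

theorem ex_equiv (f : Cl ≃ Cl) (p : Cl → Prop) : (∃ q, p q) ↔ ∃ x, p (f x) :=
  ⟨fun ⟨q, hq⟩ => ⟨f.symm q, by simpa using hq⟩, fun ⟨x, hx⟩ => ⟨f x, hx⟩⟩

theorem KK_map {f : Cl ≃ Cl} (hf : ∀ x y, Adj2 (f x) (f y) ↔ Adj2 x y) (P D : Set Cl) (z : Cl) :
    z ∈ KK {x | f x ∈ P} {x | f x ∈ D} ↔ f z ∈ KK P D := by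
  unfold KK
  simp only [Set.mem_ofPred_eq]
  rw [ex_equiv f (fun q => q ∈ P ∧ q ∉ D ∧ Adj2 (f z) q)]
  simp only [hf]

theorem VV_map {f : Cl ≃ Cl} (hf : ∀ x y, Adj2 (f x) (f y) ↔ Adj2 x y) (P D : Set Cl) (z : Cl) :
    z ∈ VV {x | f x ∈ P} {x | f x ∈ D} ↔ f z ∈ VV P D := by
  unfold VV
  simp only [Set.mem_ofPred_eq, KK_map hf]
  rw [ex_equiv f (fun q => q ∈ KK P D ∧ Adj2 (f z) q)]
  simp only [hf]

theorem EE_map {f : Cl ≃ Cl} (hf : ∀ x y, Adj2 (f x) (f y) ↔ Adj2 x y) (P D : Set Cl) (z : Cl) :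
    z ∈ EE {x | f x ∈ P} {x | f x ∈ D} ↔ f z ∈ EE P D := by
  unfold EE
  simp only [Set.mem_ofPred_eq, VV_map hf]
  rw [ex_equiv f (fun q => q ∈ P ∧ q ∉ VV P D ∧ Adj2 (f z) q)]
  simp only [hf]

theorem Deg3.map {P : Set Cl} (h : Deg3 P) {f : Cl ≃ Cl} (hf : ∀ x y, Adj2 (f x) (f y) ↔ Adj2 x y) :
    Deg3 {x | f x ∈ P} := by
  intro p hp q1 h1 q2 h2 q3 h3 a1 a2 a3 n1 n2 n3
  exact h (f p) hp (f q1) h1 (f q2) h2 (f q3) h3 ((hf _ _).2 a1) ((hf _ _).2 a2) ((hf _ _).2 a3)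
    (f.injective.ne n1) (f.injective.ne n2) (f.injective.ne n3)

theorem Deg2.map {P D : Set Cl} (h : Deg2 P D) {f : Cl ≃ Cl} (hf : ∀ x y, Adj2 (f x) (f y) ↔ Adj2 x y) :
    Deg2 {x | f x ∈ P} {x | f x ∈ D} := by
  intro z hz hzD p
  obtain ⟨q, h1, h2, h3⟩ := h (f z) hz hzD (f p)
  refine ⟨f.symm q, by simpa using h1, ?_, ?_⟩
  · rintro rfl; simp at h2
  · rw [← hf]; simpa using h3

theorem sector_f {a b : Cl} {P D V E : Set Cl} {Xm Yl T : ℤ} (f : Cl ≃ Cl) (hf : ∀ x y, Adj2 (f x) (f y) ↔ Adj2 x y)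
    (hYl : Yl ≤ -2) (hT : 1 ≤ T - 2 + Yl) (hTm : T ≤ Xm)
    (hd : Deg3 P) (h2 : Deg2 P D) (h00 : f (0, 0) ∉ P)
    (R : Roof {x | f x ∈ D} 0 (Xm + 4) (Yl - 4) (fun x => x / 2)) (hS : Sys a b V E)
    (hV : ∀ z : Cl, 0 ≤ z.1 → z.1 ≤ Xm + 1 → 0 ≤ z.1 + z.2 → Yl - 1 ≤ z.2 →
      ((f z ∈ V ↔ f z ∈ VV P D) ∧ (f z ∈ E ↔ f z ∈ EE P D))) :
    ∃ (C : Set Cl) (F : Set ℤ), (∀ y ∈ C, Zone Xm Yl (f.symm y) ∧ ((f.symm y).2 = Yl → (f.symm y).1 ∈ F)) ∧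
      (∀ u ∈ F, T - 2 ≤ u ∧ u ≤ Xm) ∧ (∀ u ∈ F, ∀ v ∈ F, u < v → u + 2 ≤ v) ∧
      Sys a b (V ∪ C) {y | (y ∈ E ∧ ¬ Zone Xm Yl (f.symm y)) ∨ ((f.symm y).2 = Yl ∧ (f.symm y).1 ∈ F)} := by
  obtain ⟨C, F, r1, r2, r3, r4⟩ := sector hYl hT hTm (hd.map hf) (h2.map hf) h00 R (hS.map f hf) (by
    intro z a1 a2 a3 a4
    rw [VV_map hf, EE_map hf]
    exact hV z a1 a2 a3 a4)
  refine ⟨{y | f.symm y ∈ C}, F, fun y hy => r1 _ hy, r2, r3, ?_⟩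
  have := r4.map f.symm (iso_symm hf)
  simp only [Equiv.symm_symm, Equiv.apply_symm_apply] at this
  refine this.congr ?_ ?_
  · intro y
    simp only [Set.mem_ofPred_eq, Set.mem_union, Equiv.apply_symm_apply]
  · intro y
    simp only [Set.mem_ofPred_eq, Equiv.apply_symm_apply]

/-- translation frame -/
def fL (v : Cl) : Cl ≃ Cl where
  toFun z := (v.1 + z.1, v.2 + z.2)
  invFun z := (z.1 - v.1, z.2 - v.2)
  left_inv z := by ext <;> simp
  right_inv z := by ext <;> simp

/-- reflected frame -/
def fR (v : Cl) : Cl ≃ Cl where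
  toFun z := (v.1 - z.1, v.2 + z.2)
  invFun z := (v.1 - z.1, z.2 - v.2)
  left_inv z := by ext <;> simp
  right_inv z := by ext <;> simp

/-- rotation frame -/
def fT : Cl ≃ Cl where
  toFun z := (-z.2, z.1)
  invFun z := (z.2, -z.1)
  left_inv z := by ext <;> simp
  right_inv z := by ext <;> simp

theorem fL_iso (v x y : Cl) : Adj2 (fL v x) (fL v y) ↔ Adj2 x y := by
  rw [adj2_iff, adj2_iff]; simp only [fL, Equiv.coe_fn_mk]; omega

theorem fR_iso (v x y : Cl) : Adj2 (fR v x) (fR v y) ↔ Adj2 x y := by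
  rw [adj2_iff, adj2_iff]; simp only [fR, Equiv.coe_fn_mk]; omega

theorem fT_iso (x y : Cl) : Adj2 (fT x) (fT y) ↔ Adj2 x y := by
  rw [adj2_iff, adj2_iff]; simp only [fT, Equiv.coe_fn_mk]; omega

def Oct (v1 v2 v3 v4 : Cl) : Set Cl := {z |
  (2 * (z.2 - v1.2) ≤ z.1 - v1.1 ∧ z.2 - v1.2 ≤ 2 * (z.1 - v1.1)) ∧
  (2 * (z.2 - v2.2) ≤ v2.1 - z.1 ∧ z.2 - v2.2 ≤ 2 * (v2.1 - z.1)) ∧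
  (2 * (v3.2 - z.2) ≤ v3.1 - z.1 ∧ v3.2 - z.2 ≤ 2 * (v3.1 - z.1)) ∧
  (2 * (v4.2 - z.2) ≤ z.1 - v4.1 ∧ v4.2 - z.2 ≤ 2 * (z.1 - v4.1))}

structure Corners (L : ℤ) (v1 v2 v3 v4 : Cl) : Prop where
  hL : 100 ≤ L
  h1 : (-L - 1 ≤ v1.1 ∧ v1.1 ≤ -L) ∧ (L ≤ v1.2 ∧ v1.2 ≤ L + 1)
  h2 : (L ≤ v2.1 ∧ v2.1 ≤ L + 1) ∧ (L ≤ v2.2 ∧ v2.2 ≤ L + 1)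
  h3 : (L ≤ v3.1 ∧ v3.1 ≤ L + 1) ∧ (-L - 1 ≤ v3.2 ∧ v3.2 ≤ -L)
  h4 : (-L - 1 ≤ v4.1 ∧ v4.1 ≤ -L) ∧ (-L - 1 ≤ v4.2 ∧ v4.2 ≤ -L)

def NR (L : ℤ) (v1 v2 z : Cl) : Prop :=
  L - 19 ≤ z.2 ∧ v1.1 + v1.2 + 1 ≤ z.1 + z.2 ∧ v2.2 - v2.1 + 1 ≤ z.2 - z.1 ∧ z.2 ≤ 2 * L

def NRc (L : ℤ) (v1 v2 z : Cl) : Prop :=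
  L - 20 ≤ z.2 ∧ v1.1 + v1.2 ≤ z.1 + z.2 ∧ v2.2 - v2.1 ≤ z.2 - z.1

theorem oct_roof {L : ℤ} {v1 v2 v3 v4 : Cl} (K : Corners L v1 v2 v3 v4) :
    Roof (Oct v1 v2 v3 v4) v1.1 v2.1 (L - 25) (fun x => min (v1.2 + (x - v1.1) / 2) (v2.2 + (v2.1 - x) / 2)) := by
  obtain ⟨hL, h1, h2, h3, h4⟩ := K
  refine ⟨?_, ?_, ?_⟩
  · intro z a1 a2 a3
    unfold Oct
    simp only [Set.mem_ofPred_eq]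
    omega
  · intro x a1 a2; omega
  · intro x a1 a2; omega

theorem oct_roofL {L : ℤ} {v1 v2 v3 v4 : Cl} (K : Corners L v1 v2 v3 v4) {Xm Yl : ℤ} (hX : Xm ≤ -7 - v1.1)
    (hY : L - 19 - v1.2 = Yl) :
    Roof {x | fL v1 x ∈ Oct v1 v2 v3 v4} 0 (Xm + 4) (Yl - 4) (fun x => x / 2) := by
  obtain ⟨hL, h1, h2, h3, h4⟩ := K
  refine ⟨?_, ?_, ?_⟩
  · intro z a1 a2 a3
    unfold Oct
    simp only [Set.mem_ofPred_eq, fL, Equiv.coe_fn_mk]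
    omega
  · intro x a1 a2; omega
  · intro x a1 a2; omega

theorem oct_roofR {L : ℤ} {v1 v2 v3 v4 : Cl} (K : Corners L v1 v2 v3 v4) {Xm Yl : ℤ} (hX : Xm ≤ v2.1 - 7)
    (hY : L - 19 - v2.2 = Yl) :
    Roof {x | fR v2 x ∈ Oct v1 v2 v3 v4} 0 (Xm + 4) (Yl - 4) (fun x => x / 2) := by
  obtain ⟨hL, h1, h2, h3, h4⟩ := K
  refine ⟨?_, ?_, ?_⟩
  · intro z a1 a2 a3
    unfold Oct
    simp only [Set.mem_ofPred_eq, fR, Equiv.coe_fn_mk]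
    omega
  · intro x a1 a2; omega
  · intro x a1 a2; omega

theorem side_p (e zl fl zr fr s t nr F : Prop) (h1 : e → nr → zl ∨ zr ∨ s) (h2 : zl → nr) (h3 : zr → nr) (h4 : s → nr)
    (h5 : fl → ¬ zr) (h6 : fl → ¬ s) (h7 : fr → ¬ s) (h8 : fl ∨ fr ∨ t ↔ F) :
    ((((((e ∧ ¬ zl) ∨ fl) ∧ ¬ zr) ∨ fr) ∧ ¬ s) ∨ t) ↔ ((e ∧ ¬ nr) ∨ F) := by
  by_cases e <;> by_cases nr <;> by_cases zl <;> by_cases fl <;> by_cases fr <;> by_cases s <;> simp_all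

set_option maxHeartbeats 4000000 in
theorem side {a b : Cl} {P V E : Set Cl} {L : ℤ} {v1 v2 v3 v4 : Cl} (K : Corners L v1 v2 v3 v4)
    (hd : Deg3 P) (h2 : Deg2 P (Oct v1 v2 v3 v4)) (n1 : v1 ∉ P) (n2 : v2 ∉ P) (hS : Sys a b V E)
    (hV : ∀ z, NRc L v1 v2 z → ((z ∈ V ↔ z ∈ VV P (Oct v1 v2 v3 v4)) ∧ (z ∈ E ↔ z ∈ EE P (Oct v1 v2 v3 v4)))) :
    ∃ (C : Set Cl) (F : Set ℤ), (∀ z ∈ C, NR L v1 v2 z ∧ (z.2 = L - 19 → z.1 ∈ F)) ∧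
      (∀ u ∈ F, -22 ≤ u ∧ u ≤ 22) ∧ (∀ u ∈ F, ∀ v ∈ F, u < v → u + 2 ≤ v) ∧
      Sys a b (V ∪ C) {z | (z ∈ E ∧ ¬ NR L v1 v2 z) ∨ (z.2 = L - 19 ∧ z.1 ∈ F)} := by
  have R := oct_roof K
  set D := Oct v1 v2 v3 v4 with hD
  have hDm : ∀ z, z ∈ D ↔ ((2 * (z.2 - v1.2) ≤ z.1 - v1.1 ∧ z.2 - v1.2 ≤ 2 * (z.1 - v1.1)) ∧
    (2 * (z.2 - v2.2) ≤ v2.1 - z.1 ∧ z.2 - v2.2 ≤ 2 * (v2.1 - z.1)) ∧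
    (2 * (v3.2 - z.2) ≤ v3.1 - z.1 ∧ v3.2 - z.2 ≤ 2 * (v3.1 - z.1)) ∧
    (2 * (v4.2 - z.2) ≤ z.1 - v4.1 ∧ v4.2 - z.2 ≤ 2 * (z.1 - v4.1))) := fun z => Iff.rfl
  have RL := fun Xm Yl => @oct_roofL L v1 v2 v3 v4 K Xm Yl
  have RR := fun Xm Yl => @oct_roofR L v1 v2 v3 v4 K Xm Yl
  rw [← hD] at RL RR
  clear_value D
  obtain ⟨hL, k1, k2, k3, k4⟩ := K
  unfold NRc at hV
  unfold NR
  have hEc : ∀ z ∈ E, (L - 19 ≤ z.2 ∧ v1.1 + v1.2 + 1 ≤ z.1 + z.2 ∧ v2.2 - v2.1 + 1 ≤ z.2 - z.1 ∧ z.2 ≤ 2 * L) →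
      v1.1 < z.1 ∧ z.1 < v2.1 ∧ z.2 - v1.2 ≤ z.1 - v1.1 ∧ z.2 - v2.2 ≤ v2.1 - z.1 := by
    intro z hz hn
    have := (hDm z).1 (EE_D (((hV z (by omega)).2).1 hz))
    omega
  have farE : ∀ z ∈ E, ∀ w ∈ V, w ∈ D → -20 ≤ z.1 → z.1 ≤ 20 → -20 ≤ w.1 → w.1 ≤ 20 → L - 20 ≤ z.2 → L - 20 ≤ w.2 →
      (z.1 = w.1 + 1 ∨ w.1 = z.1 + 1) → False := by
    intro z hz w hw hwD a1 a2 a3 a4 a5 a6 a7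
    exact R.far hd (((hV z (by omega)).2).1 hz) (((hV w (by omega)).1).1 hw) hwD (by omega) (by omega) (by omega)
      (by omega) (by omega) (by omega) a7
  have hED : ∀ z ∈ E, -20 ≤ z.1 → z.1 ≤ 20 → L - 20 ≤ z.2 → z ∈ D := fun z hz a1 a2 a3 =>
    EE_D (((hV z (by omega)).2).1 hz)
  have hpick : ∀ c : ℤ, -15 ≤ c → c ≤ 15 → ∃ d, (d = c ∨ d = c + 1) ∧ ∀ z ∈ E, L - 20 ≤ z.2 → z.1 ≠ d := by
    intro c ha hb
    by_contra hcon
    push Not at hcon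
    obtain ⟨z, z1, z2, z3⟩ := hcon c (Or.inl rfl)
    obtain ⟨w, w1, w2, w3⟩ := hcon (c + 1) (Or.inr rfl)
    exact farE z z1 w (hS.sub w1) (hED w w1 (by omega) (by omega) w2) (by omega) (by omega) (by omega) (by omega) z2 w2 (by omega)
  obtain ⟨c1, hc1, hc1E⟩ := hpick (-7) (by norm_num) (by norm_num)
  obtain ⟨c2, hc2, hc2E⟩ := hpick 6 (by norm_num) (by norm_num)
  have hn1 : fL v1 (0, 0) ∉ P := by simpa [fL] using n1
  have hn2 : fR v2 (0, 0) ∉ P := by simpa [fR] using n2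
  obtain ⟨CL, FL, L1, L2, L3, SL⟩ := sector_f (V := V) (E := E) (a := a) (b := b) (Xm := c1 - 1 - v1.1) (Yl := L - 19 - v1.2) (T := -20 - v1.1) (fL v1) (fL_iso v1)
    (by omega) (by omega) (by omega) hd h2 hn1 (RL _ _ (by omega) rfl) hS (by
      intro z a1 a2 a3 a4
      apply hV
      simp only [fL, Equiv.coe_fn_mk]
      omega)
  simp only [Zone, fL, Equiv.coe_fn_symm_mk] at L1 SL
  have hE1 : ∀ z : Cl, c2 ≤ z.1 → (z ∈ {y : Cl | (y ∈ E ∧ ¬ (1 ≤ y.1 - v1.1 ∧ y.1 - v1.1 ≤ c1 - 1 - v1.1 ∧ L - 19 - v1.2 ≤ y.2 - v1.2 ∧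
      1 ≤ y.1 - v1.1 + (y.2 - v1.2) ∧ y.2 - v1.2 ≤ y.1 - v1.1)) ∨ (y.2 - v1.2 = L - 19 - v1.2 ∧ y.1 - v1.1 ∈ FL)} ↔ z ∈ E) := by
    intro z hz
    simp only [Set.mem_ofPred_eq]
    constructor
    · rintro (h | ⟨h, h'⟩)
      · exact h.1
      · have := L2 _ h'; omega
    · intro h
      exact Or.inl ⟨h, by omega⟩
  have hV1 : ∀ z : Cl, c2 ≤ z.1 → (z ∈ V ∪ CL ↔ z ∈ V) := by
    intro z hz
    constructor
    · rintro (h | h)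
      · exact h
      · have := (L1 z h).1; omega
    · exact Or.inl
  obtain ⟨CR, FR, R1, R2, R3, SR⟩ := sector_f (Xm := v2.1 - c2 - 1) (Yl := L - 19 - v2.2) (T := v2.1 - 20) (fR v2) (fR_iso v2)
    (by omega) (by omega) (by omega) hd h2 hn2 (RR _ _ (by omega) rfl) SL (by
      intro z a1 a2 a3 a4
      rw [hE1 _ (by simp only [fR, Equiv.coe_fn_mk]; omega), hV1 _ (by simp only [fR, Equiv.coe_fn_mk]; omega)]
      apply hV
      simp only [fR, Equiv.coe_fn_mk]
      omega)
  simp only [Zone, fR, Equiv.coe_fn_symm_mk, Set.mem_ofPred_eq] at R1 SR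
  set S0 : Set Cl := {z | z ∈ E ∧ L - 19 ≤ z.2 ∧ c1 < z.1 ∧ z.1 < c2} with hS0
  have mS0 : ∀ z, z ∈ S0 ↔ (z ∈ E ∧ L - 19 ≤ z.2 ∧ c1 < z.1 ∧ z.1 < c2) := fun z => Iff.rfl
  have S0fin : S0.Finite := hS.finiteE.subset (fun z hz => ((mS0 z).1 hz).1)
  clear_value S0
  have mS : ∀ z, z ∈ S0fin.toFinset ↔ (z ∈ E ∧ L - 19 ≤ z.2 ∧ c1 < z.1 ∧ z.1 < c2) := by
    intro z; rw [Set.Finite.mem_toFinset]; exact mS0 z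
  have topV : ∀ z ∈ V, z ∈ D → -20 ≤ z.1 → z.1 ≤ 20 → L - 20 ≤ z.2 →
      z.2 = min (v1.2 + (z.1 - v1.1) / 2) (v2.2 + (v2.1 - z.1) / 2) := by
    intro z hz hzD a1 a2 a3
    exact R.top (((hV z (by omega)).1).1 hz) hzD (by omega) (by omega) (by omega)
  have inD : ∀ z : Cl, -20 ≤ z.1 → z.1 ≤ 20 → L - 20 ≤ z.2 →
      z.2 ≤ min (v1.2 + (z.1 - v1.1) / 2) (v2.2 + (v2.1 - z.1) / 2) → z ∈ D := by
    intro z a1 a2 a3 a4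
    exact (R.mem z (by omega) (by omega) (by omega)).2 a4
  have topS : ∀ z ∈ S0fin.toFinset, z ∈ E ∧ L - 19 ≤ z.2 ∧ c1 < z.1 ∧ z.1 < c2 ∧
      z.2 = min (v1.2 + (z.1 - v1.1) / 2) (v2.2 + (v2.1 - z.1) / 2) := by
    intro z hz
    obtain ⟨a1, a2, a3, a4⟩ := (mS z).1 hz
    exact ⟨a1, a2, a3, a4, topV z (hS.sub a1) (hED z a1 (by omega) (by omega) (by omega)) (by omega) (by omega) (by omega)⟩
  have colS : ∀ e ∈ S0fin.toFinset, ∀ e' ∈ S0fin.toFinset, e ≠ e' → e.1 + 2 ≤ e'.1 ∨ e'.1 + 2 ≤ e.1 := by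
    intro e he e' he' hne
    obtain ⟨a1, a2, a3, a4, a5⟩ := topS e he
    obtain ⟨b1, b2, b3, b4, b5⟩ := topS e' he'
    have h1 : e.1 ≠ e'.1 := by
      intro h
      exact hne (cl_ext h (by rw [a5, b5, h]))
    by_contra hcon
    exact farE e a1 e' (hS.sub b1) (hED _ b1 (by omega) (by omega) (by omega)) (by omega) (by omega) (by omega) (by omega)
      (by omega) (by omega) (by omega)
  obtain ⟨CM, M1, SM⟩ := Sys.multi S0fin.toFinset (fun e => {z | z.1 = e.1 ∧ L - 19 ≤ z.2 ∧ z.2 < e.2})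
    (fun e => (e.1, L - 19)) SR (by
      intro e he
      obtain ⟨a1, a2, a3, a4, a5⟩ := topS e he
      simp only [Set.mem_ofPred_eq]
      refine Or.inl ⟨Or.inl ⟨a1, by omega⟩, by omega⟩) (by
      intro e he c hc
      obtain ⟨a1, a2, a3, a4, a5⟩ := topS e he
      obtain ⟨b1, b2, b3⟩ := hc
      constructor
      · rintro ((h | h) | h)
        · have := topV c h (inD c (by omega) (by omega) (by omega) (by rw [b1]; omega)) (by omega) (by omega) (by omega)
          rw [b1] at this
          omega
        · have := (L1 c h).1; omega
        · have := (R1 c h).1; omega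
      · intro v hv hadj
        rw [adj2_iff] at hadj
        rcases hv with (h | h) | h
        · by_cases hcol : v.1 = e.1
          · have hvD : v ∈ D := inD v (by omega) (by omega) (by omega) (by rw [hcol]; omega)
            have := topV v h hvD (by omega) (by omega) (by omega)
            exact cl_ext hcol (by rw [this, a5, hcol])
          · exfalso
            refine farE e a1 v h (inD v (by omega) (by omega) (by omega) ?_) (by omega) (by omega) (by omega) (by omega)
              (by omega) (by omega) (by omega)
            omega
        · have := (L1 v h).1; omega
        · have := (R1 v h).1; omega) (by
      intro e he e' he' hne c hc d hd'
      have := colS e he e' he' hne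
      obtain ⟨b1, b2, b3⟩ := hc
      obtain ⟨d1, d2, d3⟩ := hd'
      rw [adj2_iff]
      refine ⟨fun h => ?_, by omega⟩
      rw [h] at b1; omega) (by
      intro e he
      obtain ⟨a1, a2, a3, a4, a5⟩ := topS e he
      refine ⟨Conn.down a2 (fun y y1 y2 => ⟨rfl, y1, y2⟩), Or.inr ⟨rfl, le_refl _, by simp only; omega⟩⟩)
  simp only [Set.mem_ofPred_eq] at M1 SM
  refine ⟨CL ∪ CR ∪ CM, {x | x - v1.1 ∈ FL ∨ v2.1 - x ∈ FR ∨ ∃ e ∈ S0fin.toFinset, x = e.1}, ?_, ?_, ?_, ?_⟩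
  · rintro z ((h | h) | h)
    · obtain ⟨h1, h3⟩ := L1 z h
      exact ⟨by omega, fun hz => Or.inl (h3 (by omega))⟩
    · obtain ⟨h1, h3⟩ := R1 z h
      exact ⟨by omega, fun hz => Or.inr (Or.inl (h3 (by omega)))⟩
    · obtain ⟨e, he, h1, h3, h4⟩ := M1 z h
      obtain ⟨a1, a2, a3, a4, a5⟩ := topS e he
      exact ⟨by omega, fun hz => Or.inr (Or.inr ⟨e, he, h1⟩)⟩
  · rintro u (h | h | ⟨e, he, h⟩)
    · have := L2 _ h; omega
    · have := R2 _ h; omega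
    · have := topS e he; omega
  · rintro u (h | h | ⟨e, he, h⟩) v (h' | h' | ⟨e', he', h'⟩) huv
    · have := L3 _ h _ h'; omega
    · have := L2 _ h; have := R2 _ h'; omega
    · have := L2 _ h; have := topS _ he'; omega
    · have := R2 _ h; have := L2 _ h'; omega
    · have := R3 _ h' _ h; omega
    · have := R2 _ h; have := topS _ he'; omega
    · have := topS _ he; have := L2 _ h'; omega
    · have := topS _ he; have := R2 _ h'; omega
    · have := colS e he e' he' (by rintro rfl; omega); omega
  · refine SM.congr (fun z => ?_) (fun z => ?_)
    · simp only [Set.mem_union, or_assoc]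
    · simp only [Set.mem_ofPred_eq]
      refine side_p _ _ _ _ _ _ _ _ _ ?_ ?_ ?_ ?_ ?_ ?_ ?_ ?_
      · intro hz hn
        have a1 := hEc z hz hn
        have a2 := hc1E z hz (by omega)
        have a3 := hc2E z hz (by omega)
        by_cases q1 : z.1 < c1
        · left; omega
        · by_cases q2 : c2 < z.1
          · right; left; omega
          · right; right; rw [mS]; exact ⟨hz, by omega, by omega, by omega⟩
      · intro h; omega
      · intro h; omega
      · intro h; have := topS z h; omega
      · rintro ⟨h, h'⟩; have := L2 _ h'; omega
      · rintro ⟨h, h'⟩ h3; have := L2 _ h'; have := topS _ h3; omega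
      · rintro ⟨h, h'⟩ h3; have := R2 _ h'; have := topS _ h3; omega
      · constructor
        · rintro (⟨h, h'⟩ | ⟨h, h'⟩ | ⟨e, he, h⟩)
          · exact ⟨by omega, Or.inl h'⟩
          · exact ⟨by omega, Or.inr (Or.inl h')⟩
          · rw [h]; exact ⟨rfl, Or.inr (Or.inr ⟨e, he, rfl⟩)⟩
        · rintro ⟨h, h' | h' | ⟨e, he, h'⟩⟩
          · exact Or.inl ⟨by omega, h'⟩
          · exact Or.inr (Or.inl ⟨by omega, h'⟩)
          · exact Or.inr (Or.inr ⟨e, he, cl_ext h' h⟩)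

theorem side_f {a b : Cl} {P D V E : Set Cl} {L : ℤ} {v1 v2 v3 v4 : Cl} (K : Corners L v1 v2 v3 v4)
    (f : Cl ≃ Cl) (hf : ∀ x y, Adj2 (f x) (f y) ↔ Adj2 x y) (hD : ∀ x, f x ∈ D ↔ x ∈ Oct v1 v2 v3 v4)
    (hd : Deg3 P) (h2 : Deg2 P D) (n1 : f v1 ∉ P) (n2 : f v2 ∉ P) (hS : Sys a b V E)
    (hV : ∀ z, NRc L v1 v2 (f.symm z) → ((z ∈ V ↔ z ∈ VV P D) ∧ (z ∈ E ↔ z ∈ EE P D))) :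
    ∃ (C : Set Cl) (F : Set ℤ), (∀ z ∈ C, NR L v1 v2 (f.symm z) ∧ ((f.symm z).2 = L - 19 → (f.symm z).1 ∈ F)) ∧
      (∀ u ∈ F, -22 ≤ u ∧ u ≤ 22) ∧ (∀ u ∈ F, ∀ v ∈ F, u < v → u + 2 ≤ v) ∧
      Sys a b (V ∪ C) {z | (z ∈ E ∧ ¬ NR L v1 v2 (f.symm z)) ∨ ((f.symm z).2 = L - 19 ∧ (f.symm z).1 ∈ F)} := by
  have hD' : {x | f x ∈ D} = Oct v1 v2 v3 v4 := Set.ext hD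
  have h2' := h2.map hf
  rw [hD'] at h2'
  obtain ⟨C, F, r1, r2, r3, r4⟩ := side K (hd.map hf) h2' n1 n2 (hS.map f hf) (by
    intro z hz
    rw [← hD', VV_map hf, EE_map hf]
    exact hV (f z) (by simpa using hz))
  refine ⟨{y | f.symm y ∈ C}, F, fun y hy => r1 _ hy, r2, r3, ?_⟩
  have := r4.map f.symm (iso_symm hf)
  simp only [Equiv.symm_symm, Equiv.apply_symm_apply] at this
  refine this.congr ?_ ?_
  · intro y
    simp only [Set.mem_ofPred_eq, Set.mem_union, Equiv.apply_symm_apply]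
  · intro y
    simp only [Set.mem_ofPred_eq, Equiv.apply_symm_apply]

/-- half turn -/
def fS : Cl ≃ Cl where
  toFun z := (-z.1, -z.2)
  invFun z := (-z.1, -z.2)
  left_inv z := by ext <;> simp
  right_inv z := by ext <;> simp

/-- clockwise turn -/
def fE : Cl ≃ Cl where
  toFun z := (z.2, -z.1)
  invFun z := (-z.2, z.1)
  left_inv z := by ext <;> simp
  right_inv z := by ext <;> simp

theorem fS_iso (x y : Cl) : Adj2 (fS x) (fS y) ↔ Adj2 x y := by
  rw [adj2_iff, adj2_iff]; simp only [fS, Equiv.coe_fn_mk]; omega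

theorem fE_iso (x y : Cl) : Adj2 (fE x) (fE y) ↔ Adj2 x y := by
  rw [adj2_iff, adj2_iff]; simp only [fE, Equiv.coe_fn_mk]; omega

theorem four_p (e N W S O n w s o : Prop) (h0 : e → N ∨ W ∨ S ∨ O) (h1 : n → ¬ W) (h2 : n → ¬ S) (h3 : n → ¬ O)
    (h4 : w → ¬ S) (h5 : w → ¬ O) (h6 : s → ¬ O) :
    ((((((((e ∧ ¬ N) ∨ n) ∧ ¬ W) ∨ w) ∧ ¬ S) ∨ s) ∧ ¬ O) ∨ o) ↔ (n ∨ w ∨ s ∨ o) := by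
  by_cases e <;> by_cases n <;> by_cases w <;> by_cases s <;> by_cases N <;> by_cases W <;> by_cases S <;> simp_all

theorem stage_p (e N n : Prop) (h1 : ¬ N) (h2 : ¬ n) : ((e ∧ ¬ N) ∨ n) ↔ e := by
  simp_all

theorem EE_apex {P D : Set Cl} {z v : Cl} (h : z ∈ EE P D) (hv : v ∉ P) : z.1 ≠ v.1 ∨ z.2 ≠ v.2 := by
  by_contra hc
  push Not at hc
  have e : z = v := cl_ext hc.1 hc.2
  exact hv (e ▸ h.1.1)

theorem four {a b : Cl} {P : Set Cl} {L : ℤ} {v1 v2 v3 v4 : Cl} (K : Corners L v1 v2 v3 v4)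
    (hd : Deg3 P) (h2 : Deg2 P (Oct v1 v2 v3 v4)) (n1 : v1 ∉ P) (n2 : v2 ∉ P) (n3 : v3 ∉ P) (n4 : v4 ∉ P)
    (hS : Sys a b (VV P (Oct v1 v2 v3 v4)) (EE P (Oct v1 v2 v3 v4))) :
    ∃ (C : Set Cl) (FN FW FS FE : Set ℤ),
      (∀ z ∈ C, (-(2 * L + 2) ≤ z.1 ∧ z.1 ≤ 2 * L + 2 ∧ -(2 * L + 2) ≤ z.2 ∧ z.2 ≤ 2 * L + 2) ∧
        ((L - 19 ≤ z.2 ∧ (z.2 = L - 19 → z.1 ∈ FN)) ∨ (L - 19 ≤ -z.1 ∧ (-z.1 = L - 19 → z.2 ∈ FW)) ∨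
         (L - 19 ≤ -z.2 ∧ (-z.2 = L - 19 → -z.1 ∈ FS)) ∨ (L - 19 ≤ z.1 ∧ (z.1 = L - 19 → -z.2 ∈ FE)))) ∧
      ((∀ u ∈ FN, -22 ≤ u ∧ u ≤ 22) ∧ (∀ u ∈ FN, ∀ v ∈ FN, u < v → u + 2 ≤ v)) ∧
      ((∀ u ∈ FW, -22 ≤ u ∧ u ≤ 22) ∧ (∀ u ∈ FW, ∀ v ∈ FW, u < v → u + 2 ≤ v)) ∧
      ((∀ u ∈ FS, -22 ≤ u ∧ u ≤ 22) ∧ (∀ u ∈ FS, ∀ v ∈ FS, u < v → u + 2 ≤ v)) ∧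
      ((∀ u ∈ FE, -22 ≤ u ∧ u ≤ 22) ∧ (∀ u ∈ FE, ∀ v ∈ FE, u < v → u + 2 ≤ v)) ∧
      Sys a b (VV P (Oct v1 v2 v3 v4) ∪ C) {z | (z.2 = L - 19 ∧ z.1 ∈ FN) ∨ (-z.1 = L - 19 ∧ z.2 ∈ FW) ∨
        (-z.2 = L - 19 ∧ -z.1 ∈ FS) ∨ (z.1 = L - 19 ∧ -z.2 ∈ FE)} := by
  obtain ⟨hL, k1, k2, k3, k4⟩ := id K
  set D := Oct v1 v2 v3 v4 with hD
  have hDm : ∀ z, z ∈ D ↔ ((2 * (z.2 - v1.2) ≤ z.1 - v1.1 ∧ z.2 - v1.2 ≤ 2 * (z.1 - v1.1)) ∧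
    (2 * (z.2 - v2.2) ≤ v2.1 - z.1 ∧ z.2 - v2.2 ≤ 2 * (v2.1 - z.1)) ∧
    (2 * (v3.2 - z.2) ≤ v3.1 - z.1 ∧ v3.2 - z.2 ≤ 2 * (v3.1 - z.1)) ∧
    (2 * (v4.2 - z.2) ≤ z.1 - v4.1 ∧ v4.2 - z.2 ≤ 2 * (z.1 - v4.1))) := fun z => Iff.rfl
  -- north
  obtain ⟨C1, F1, a1, a2, a3, S1⟩ := side (K := K) hd h2 n1 n2 hS (fun z _ => ⟨Iff.rfl, Iff.rfl⟩)
  simp only [NR] at a1 S1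
  -- west
  obtain ⟨C2, F2, b1, b2, b3, S2⟩ := side_f (D := D) (v1 := (v4.2, -v4.1)) (v2 := (v1.2, -v1.1)) (v3 := (v2.2, -v2.1)) (v4 := (v3.2, -v3.1))
    (L := L) ⟨hL, by simp only; omega, by simp only; omega, by simp only; omega, by simp only; omega⟩ fT fT_iso (by
      intro x; rw [hDm]
      unfold Oct
      simp only [Set.mem_ofPred_eq, fT, Equiv.coe_fn_mk]
      omega) hd h2 (by simpa [fT] using n4) (by simpa [fT] using n1) S1 (by
      intro z hz
      simp only [NRc, fT, Equiv.coe_fn_symm_mk] at hz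
      constructor
      · simp only [Set.mem_union]
        refine or_iff_left ?_
        intro h; have := (a1 z h).1; omega
      · simp only [Set.mem_ofPred_eq]
        refine stage_p _ _ _ (by omega) ?_
        rintro ⟨h, h'⟩; have := a2 _ h'; omega)
  simp only [NR, fT, Equiv.coe_fn_symm_mk, Set.mem_ofPred_eq] at b1 S2
  -- south
  obtain ⟨C3, F3, c1, c2, c3, S3⟩ := side_f (D := D) (v1 := (-v3.1, -v3.2)) (v2 := (-v4.1, -v4.2)) (v3 := (-v1.1, -v1.2)) (v4 := (-v2.1, -v2.2))
    (L := L) ⟨hL, by simp only; omega, by simp only; omega, by simp only; omega, by simp only; omega⟩ fS fS_iso (by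
      intro x; rw [hDm]
      unfold Oct
      simp only [Set.mem_ofPred_eq, fS, Equiv.coe_fn_mk]
      omega) hd h2 (by simpa [fS] using n3) (by simpa [fS] using n4) S2 (by
      intro z hz
      simp only [NRc, fS, Equiv.coe_fn_symm_mk] at hz
      constructor
      · simp only [Set.mem_union]
        rw [or_iff_left, or_iff_left]
        · intro h; have := (a1 z h).1; omega
        · intro h; have := (b1 z h).1; omega
      · simp only [Set.mem_ofPred_eq]
        rw [stage_p _ _ _ (by omega), stage_p _ _ _ (by omega)]
        · rintro ⟨h, h'⟩; have := a2 _ h'; omega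
        · rintro ⟨h, h'⟩; have := b2 _ h'; omega)
  simp only [NR, fS, Equiv.coe_fn_symm_mk, Set.mem_ofPred_eq] at c1 S3
  -- east
  obtain ⟨C4, F4, d1, d2, d3, S4⟩ := side_f (D := D) (v1 := (-v2.2, v2.1)) (v2 := (-v3.2, v3.1)) (v3 := (-v4.2, v4.1)) (v4 := (-v1.2, v1.1))
    (L := L) ⟨hL, by simp only; omega, by simp only; omega, by simp only; omega, by simp only; omega⟩ fE fE_iso (by
      intro x; rw [hDm]
      unfold Oct
      simp only [Set.mem_ofPred_eq, fE, Equiv.coe_fn_mk]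
      omega) hd h2 (by simpa [fE] using n2) (by simpa [fE] using n3) S3 (by
      intro z hz
      simp only [NRc, fE, Equiv.coe_fn_symm_mk] at hz
      constructor
      · simp only [Set.mem_union]
        rw [or_iff_left, or_iff_left, or_iff_left]
        · intro h; have := (a1 z h).1; omega
        · intro h; have := (b1 z h).1; omega
        · intro h; have := (c1 z h).1; omega
      · simp only [Set.mem_ofPred_eq]
        rw [stage_p _ _ _ (by omega), stage_p _ _ _ (by omega), stage_p _ _ _ (by omega)]
        · rintro ⟨h, h'⟩; have := a2 _ h'; omega
        · rintro ⟨h, h'⟩; have := b2 _ h'; omega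
        · rintro ⟨h, h'⟩; have := c2 _ h'; omega)
  simp only [NR, fE, Equiv.coe_fn_symm_mk, Set.mem_ofPred_eq] at d1 S4
  refine ⟨C1 ∪ C2 ∪ C3 ∪ C4, F1, F2, F3, F4, ?_, ⟨a2, a3⟩, ⟨b2, b3⟩, ⟨c2, c3⟩, ⟨d2, d3⟩, ?_⟩
  · rintro z (((h | h) | h) | h)
    · obtain ⟨g, g'⟩ := a1 z h
      exact ⟨by omega, Or.inl ⟨by omega, g'⟩⟩
    · obtain ⟨g, g'⟩ := b1 z h
      exact ⟨by omega, Or.inr (Or.inl ⟨by omega, g'⟩)⟩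
    · obtain ⟨g, g'⟩ := c1 z h
      exact ⟨by omega, Or.inr (Or.inr (Or.inl ⟨by omega, g'⟩))⟩
    · obtain ⟨g, g'⟩ := d1 z h
      exact ⟨by omega, Or.inr (Or.inr (Or.inr ⟨by omega, g'⟩))⟩
  · refine S4.congr (fun z => by simp only [Set.mem_union, or_assoc]) (fun z => ?_)
    simp only [Set.mem_ofPred_eq]
    refine four_p _ _ _ _ _ _ _ _ _ ?_ ?_ ?_ ?_ ?_ ?_ ?_
    · intro hz
      have e1 := EE_apex hz n1
      have e2 := EE_apex hz n2
      have e3 := EE_apex hz n3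
      have e4 := EE_apex hz n4
      have e5 := (hDm z).1 (EE_D hz)
      obtain ⟨q, hq, hadj⟩ := VV_nb hz.1
      have e6 := hq.2.1
      rw [hDm] at e6
      rw [adj2_iff] at hadj
      clear S1 S2 S3 S4 a1 b1 c1 d1 a2 b2 c2 d2 a3 b3 c3 d3
      rcases le_total z.1 0 with hx | hx <;> rcases le_total z.2 0 with hy | hy
      · by_cases g : z.1 - z.2 ≤ v4.1 - v4.2
        · right; left; omega
        · right; right; left; omega
      · by_cases g : z.1 + z.2 ≤ v1.1 + v1.2
        · right; left; omega
        · left; omega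
      · by_cases g : z.1 + z.2 ≤ v3.1 + v3.2
        · right; right; left; omega
        · right; right; right; omega
      · by_cases g : z.1 - z.2 ≤ v2.1 - v2.2
        · left; omega
        · right; right; right; omega
    · rintro ⟨h, h'⟩; have := a2 _ h'; omega
    · rintro ⟨h, h'⟩; have := a2 _ h'; omega
    · rintro ⟨h, h'⟩; have := a2 _ h'; omega
    · rintro ⟨h, h'⟩; have := b2 _ h'; omega
    · rintro ⟨h, h'⟩; have := b2 _ h'; omega
    · rintro ⟨h, h'⟩; have := c2 _ h'; omega

def ln (x : ℤ) : ℤ := -280 + (x + 199) / 2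

def EndN (m : ℤ) (e : Cl) : Prop := e.2 = 3 * m + 2001 ∧ -22 ≤ e.1 ∧ e.1 ≤ 22
def EndW (m : ℤ) (e : Cl) : Prop := e.1 = -3 * m - 2001 ∧ -22 ≤ e.2 ∧ e.2 ≤ 22
def EndE (m : ℤ) (e : Cl) : Prop := e.1 = 3 * m + 2001 ∧ -22 ≤ e.2 ∧ e.2 ≤ 22
def EndS (m : ℤ) (e : Cl) : Prop := e.2 = -3 * m - 2001 ∧ -22 ≤ e.1 ∧ e.1 ≤ 22

def TubN (m : ℤ) (e z : Cl) : Prop := z.1 = e.1 ∧ ln e.1 ≤ z.2 ∧ z.2 ≤ 3 * m + 2000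
def TubW (m : ℤ) (e z : Cl) : Prop := (z.2 = e.2 ∧ -3 * m - 2000 ≤ z.1 ∧ z.1 ≤ e.2 - 60) ∨
  (z.1 = e.2 - 60 ∧ ln (e.2 - 60) ≤ z.2 ∧ z.2 ≤ e.2)
def TubE (m : ℤ) (e z : Cl) : Prop := (z.2 = e.2 ∧ z.1 ≤ 3 * m + 2000 ∧ 60 - e.2 ≤ z.1) ∨
  (z.1 = 60 - e.2 ∧ ln (60 - e.2) ≤ z.2 ∧ z.2 ≤ e.2)
def TubS (m : ℤ) (e z : Cl) : Prop := (z.1 = e.1 ∧ -3 * m - 2000 ≤ z.2 ∧ z.2 ≤ -3 * m - 1940 + e.1) ∨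
  (z.2 = -3 * m - 1940 + e.1 ∧ e.1 - m - 600 ≤ z.1 ∧ z.1 ≤ e.1) ∨
  (z.1 = e.1 - m - 600 ∧ -3 * m - 1940 + e.1 ≤ z.2 ∧ z.2 ≤ -100 - e.1) ∨
  (z.2 = -100 - e.1 ∧ e.1 - m - 600 ≤ z.1 ∧ z.1 ≤ -150 - e.1) ∨
  (z.1 = -150 - e.1 ∧ ln (-150 - e.1) ≤ z.2 ∧ z.2 ≤ -100 - e.1)

def Tub (m : ℤ) (e z : Cl) : Prop := (EndN m e ∧ TubN m e z) ∨ (EndW m e ∧ TubW m e z) ∨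
  (EndE m e ∧ TubE m e z) ∨ (EndS m e ∧ TubS m e z)

def col (m : ℤ) (e : Cl) : ℤ := if e.2 = 3 * m + 2001 then e.1 else if e.1 = -3 * m - 2001 then e.2 - 60 else
  if e.1 = 3 * m + 2001 then 60 - e.2 else -150 - e.1

theorem col_N {m : ℤ} {e : Cl} (h : EndN m e) : col m e = e.1 := by
  unfold EndN at h; unfold col; rw [if_pos h.1]
theorem col_W {m : ℤ} (hm : 1 ≤ m) {e : Cl} (h : EndW m e) : col m e = e.2 - 60 := by
  unfold EndW at h; unfold col; rw [if_neg (by omega), if_pos h.1]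
theorem col_E {m : ℤ} (hm : 1 ≤ m) {e : Cl} (h : EndE m e) : col m e = 60 - e.2 := by
  unfold EndE at h; unfold col; rw [if_neg (by omega), if_neg (by omega), if_pos h.1]
theorem col_S {m : ℤ} (hm : 1 ≤ m) {e : Cl} (h : EndS m e) : col m e = -150 - e.1 := by
  unfold EndS at h; unfold col; rw [if_neg (by omega), if_neg (by omega), if_neg (by omega)]

def EndOk (m : ℤ) (e : Cl) : Prop := EndN m e ∨ EndW m e ∨ EndE m e ∨ EndS m e

def SpOk (m : ℤ) (e e' : Cl) : Prop := (EndN m e → EndN m e' → e.1 + 2 ≤ e'.1 ∨ e'.1 + 2 ≤ e.1) ∧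
  (EndW m e → EndW m e' → e.2 + 2 ≤ e'.2 ∨ e'.2 + 2 ≤ e.2) ∧
  (EndE m e → EndE m e' → e.2 + 2 ≤ e'.2 ∨ e'.2 + 2 ≤ e.2) ∧
  (EndS m e → EndS m e' → e.1 + 2 ≤ e'.1 ∨ e'.1 + 2 ≤ e.1)

theorem tub_conn {m : ℤ} (hm : 1 ≤ m) {e : Cl} (h : EndOk m e) :
    Conn {z | Tub m e z} e (col m e, ln (col m e)) := by
  obtain ⟨x, y⟩ := e
  rcases h with h | h | h | h
  · rw [col_N h]
    have h' := h
    simp only [EndN] at h'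
    refine Conn.down (by unfold ln; omega) ?_
    intro t t1 t2
    refine Or.inl ⟨h, ?_⟩
    simp only [TubN, true_and] at *; omega
  · rw [col_W hm h]
    have h' := h
    simp only [EndW] at h'
    have c1 : Conn {z | Tub m (x, y) z} (x, y) (y - 60, y) := by
      refine Conn.right (by omega) ?_
      intro t t1 t2
      refine Or.inr (Or.inl ⟨h, ?_⟩)
      simp only [TubW, true_and]; omega
    refine c1.trans ?_
    refine Conn.down (by simp only [ln]; omega) ?_
    intro t t1 t2
    refine Or.inr (Or.inl ⟨h, ?_⟩)
    simp only [TubW, true_and] at *; right; omega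
  · rw [col_E hm h]
    have h' := h
    simp only [EndE] at h'
    have c1 : Conn {z | Tub m (x, y) z} (x, y) (60 - y, y) := by
      refine Conn.leftw (by omega) ?_
      intro t t1 t2
      refine Or.inr (Or.inr (Or.inl ⟨h, ?_⟩))
      simp only [TubE, true_and]; omega
    refine c1.trans ?_
    refine Conn.down (by simp only [ln]; omega) ?_
    intro t t1 t2
    refine Or.inr (Or.inr (Or.inl ⟨h, ?_⟩))
    simp only [TubE, true_and] at *; right; omega
  · rw [col_S hm h]
    have h' := h
    simp only [EndS] at h'
    have c1 : Conn {z | Tub m (x, y) z} (x, y) (x, -3 * m - 1940 + x) := by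
      refine Conn.up (by omega) ?_
      intro t t1 t2
      refine Or.inr (Or.inr (Or.inr ⟨h, ?_⟩))
      simp only [TubS, true_and]; left; omega
    have c2 : Conn {z | Tub m (x, y) z} (x, -3 * m - 1940 + x) (x - m - 600, -3 * m - 1940 + x) := by
      refine Conn.leftw (by omega) ?_
      intro t t1 t2
      refine Or.inr (Or.inr (Or.inr ⟨h, ?_⟩))
      simp only [TubS, true_and]; right; left; omega
    have c3 : Conn {z | Tub m (x, y) z} (x - m - 600, -3 * m - 1940 + x) (x - m - 600, -100 - x) := by
      refine Conn.up (by omega) ?_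
      intro t t1 t2
      refine Or.inr (Or.inr (Or.inr ⟨h, ?_⟩))
      simp only [TubS, true_and]; right; right; left; omega
    have c4 : Conn {z | Tub m (x, y) z} (x - m - 600, -100 - x) (-150 - x, -100 - x) := by
      refine Conn.right (by omega) ?_
      intro t t1 t2
      refine Or.inr (Or.inr (Or.inr ⟨h, ?_⟩))
      simp only [TubS, true_and]; right; right; right; left; omega
    refine c1.trans (c2.trans (c3.trans (c4.trans ?_)))
    refine Conn.down (by simp only [ln]; omega) ?_
    intro t t1 t2
    refine Or.inr (Or.inr (Or.inr ⟨h, ?_⟩))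
    simp only [TubS, true_and] at *; right; right; right; right; omega

theorem tub_w {m : ℤ} (hm : 1 ≤ m) {e : Cl} (h : EndOk m e) : Tub m e (col m e, ln (col m e)) := by
  rcases h with h | h | h | h
  · rw [col_N h]
    refine Or.inl ⟨h, ?_⟩
    unfold EndN at h; simp only [TubN, ln, true_and]; omega
  · rw [col_W hm h]
    refine Or.inr (Or.inl ⟨h, ?_⟩)
    unfold EndW at h; simp only [TubW, ln, true_and]; right; omega
  · rw [col_E hm h]
    refine Or.inr (Or.inr (Or.inl ⟨h, ?_⟩))
    unfold EndE at h; simp only [TubE, ln, true_and]; right; omega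
  · rw [col_S hm h]
    refine Or.inr (Or.inr (Or.inr ⟨h, ?_⟩))
    unfold EndS at h; simp only [TubS, ln, true_and]; right; right; right; right; omega

theorem tub_box {m : ℤ} (hm : 1 ≤ m) {e z : Cl} (h : Tub m e z) :
    (-3 * m - 2000 ≤ z.1 ∧ z.1 ≤ 3 * m + 2000) ∧ (-3 * m - 2000 ≤ z.2 ∧ z.2 ≤ 3 * m + 2000) := by
  rcases h with ⟨h, t⟩ | ⟨h, t⟩ | ⟨h, t⟩ | ⟨h, t⟩
  · unfold EndN at h; unfold TubN ln at t; omega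
  · unfold EndW at h; unfold TubW ln at t; omega
  · unfold EndE at h; unfold TubE ln at t; omega
  · unfold EndS at h; unfold TubS ln at t; omega

theorem tub_touch {m : ℤ} (hm : 1 ≤ m) {e z v : Cl} (h : Tub m e z) (hv : EndOk m v) (hadj : Adj2 z v) : v = e := by
  rw [adj2_iff] at hadj
  have : v.1 = e.1 ∧ v.2 = e.2 := by
    unfold EndOk EndN EndW EndE EndS at hv
    rcases h with ⟨h, t⟩ | ⟨h, t⟩ | ⟨h, t⟩ | ⟨h, t⟩
    · unfold EndN at h; unfold TubN ln at t; omega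
    · unfold EndW at h; unfold TubW ln at t; omega
    · unfold EndE at h; unfold TubE ln at t; omega
    · unfold EndS at h; unfold TubS ln at t; omega
  exact cl_ext this.1 this.2

/-- low cells of a tube -/
theorem tub_low {m : ℤ} (hm : 1 ≤ m) {e z : Cl} (h : Tub m e z) :
    (-205 ≤ z.1 → z.2 ≤ -70 → -3 * m - 1900 ≤ z.2 → z.2 ≤ -100 + 22 - (if z.1 ≤ -100 then 46 else 0) → z.1 = col m e ∧ ln z.1 ≤ z.2) := by
  intro a1 a2 a3 a4
  rcases h with ⟨h, t⟩ | ⟨h, t⟩ | ⟨h, t⟩ | ⟨h, t⟩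
  · rw [col_N h]; unfold EndN at h; unfold TubN at t; obtain ⟨t1, t2, t3⟩ := t; rw [t1]; exact ⟨rfl, t2⟩
  · rw [col_W hm h]; unfold EndW at h; unfold TubW at t
    rcases t with t | ⟨t1, t2, t3⟩
    · omega
    · rw [t1]; exact ⟨rfl, t2⟩
  · rw [col_E hm h]; unfold EndE at h; unfold TubE at t
    rcases t with t | ⟨t1, t2, t3⟩
    · omega
    · rw [t1]; exact ⟨rfl, t2⟩
  · rw [col_S hm h]; unfold EndS at h; unfold TubS at t
    rcases t with t | t | t | t | ⟨t1, t2, t3⟩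
    · omega
    · omega
    · omega
    · exfalso
      split_ifs at a4 <;> omega
    · rw [t1]; exact ⟨rfl, t2⟩

theorem tub_lowS {m : ℤ} (hm : 1 ≤ m) {e z : Cl} (h : Tub m e z) (h1 : -m - 300 ≤ z.1) (h2 : -2 * m - 450 ≤ z.2) :
    -270 ≤ z.2 := by
  rcases h with ⟨h, t⟩ | ⟨h, t⟩ | ⟨h, t⟩ | ⟨h, t⟩
  · unfold EndN at h; unfold TubN ln at t; omega
  · unfold EndW at h; unfold TubW ln at t; omega
  · unfold EndE at h; unfold TubE ln at t; omega
  · unfold EndS at h; unfold TubS ln at t; omega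

theorem col_bd {m : ℤ} (hm : 1 ≤ m) {e : Cl} (h : EndOk m e) : -172 ≤ col m e ∧ col m e ≤ 82 := by
  rcases h with h | h | h | h
  · rw [col_N h]; unfold EndN at h; omega
  · rw [col_W hm h]; unfold EndW at h; omega
  · rw [col_E hm h]; unfold EndE at h; omega
  · rw [col_S hm h]; unfold EndS at h; omega

theorem col_sp {m : ℤ} (hm : 1 ≤ m) {e e' : Cl} (h : EndOk m e) (h' : EndOk m e') (hs : SpOk m e e') :
    col m e + 2 ≤ col m e' ∨ col m e' + 2 ≤ col m e := by
  obtain ⟨s1, s2, s3, s4⟩ := hs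
  rcases h with h | h | h | h <;> rcases h' with h' | h' | h' | h'
  · have := s1 h h'; rw [col_N h, col_N h']; omega
  · rw [col_N h, col_W hm h']; unfold EndN EndW at *; omega
  · rw [col_N h, col_E hm h']; unfold EndN EndE at *; omega
  · rw [col_N h, col_S hm h']; unfold EndN EndS at *; omega
  · rw [col_W hm h, col_N h']; unfold EndN EndW at *; omega
  · have := s2 h h'; rw [col_W hm h, col_W hm h']; omega
  · rw [col_W hm h, col_E hm h']; unfold EndW EndE at *; omega
  · rw [col_W hm h, col_S hm h']; unfold EndW EndS at *; omega
  · rw [col_E hm h, col_N h']; unfold EndN EndE at *; omega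
  · rw [col_E hm h, col_W hm h']; unfold EndE EndW at *; omega
  · have := s3 h h'; rw [col_E hm h, col_E hm h']; omega
  · rw [col_E hm h, col_S hm h']; unfold EndE EndS at *; omega
  · rw [col_S hm h, col_N h']; unfold EndN EndS at *; omega
  · rw [col_S hm h, col_W hm h']; unfold EndS EndW at *; omega
  · rw [col_S hm h, col_E hm h']; unfold EndS EndE at *; omega
  · have := s4 h h'; rw [col_S hm h, col_S hm h']; omega

def SepC (c d : Cl) : Prop := (c.1 ≠ d.1 ∨ c.2 ≠ d.2) ∧
  ¬ (c.1 = d.1 ∧ (c.2 = d.2 + 1 ∨ d.2 = c.2 + 1)) ∧ ¬ (c.2 = d.2 ∧ (c.1 = d.1 + 1 ∨ d.1 = c.1 + 1))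

theorem tub_sep_lt {m : ℤ} (hm : 1 ≤ m) {e e' c d : Cl} (h : Tub m e c) (h' : Tub m e' d) (hs : SpOk m e e') :
    SepC c d := by
  obtain ⟨s1, s2, s3, s4⟩ := hs
  rcases h with ⟨h, t⟩ | ⟨h, t⟩ | ⟨h, t⟩ | ⟨h, t⟩ <;> rcases h' with ⟨h', t'⟩ | ⟨h', t'⟩ | ⟨h', t'⟩ | ⟨h', t'⟩
  · have := s1 h h'; clear s1 s2 s3 s4; unfold EndN at *; unfold TubN ln at *; unfold SepC; omega
  · clear s1 s2 s3 s4; unfold EndN EndW at *; unfold TubN TubW ln at *; unfold SepC; omega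
  · clear s1 s2 s3 s4; unfold EndN EndE at *; unfold TubN TubE ln at *; unfold SepC; omega
  · clear s1 s2 s3 s4; unfold EndN EndS at *; unfold TubN TubS ln at *; unfold SepC; omega
  · clear s1 s2 s3 s4; unfold EndN EndW at *; unfold TubN TubW ln at *; unfold SepC; omega
  · have := s2 h h'; clear s1 s2 s3 s4; unfold EndW at *; unfold TubW ln at *; unfold SepC; omega
  · clear s1 s2 s3 s4; unfold EndE EndW at *; unfold TubE TubW ln at *; unfold SepC; omega
  · clear s1 s2 s3 s4; unfold EndS EndW at *; unfold TubS TubW ln at *; unfold SepC; omega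
  · clear s1 s2 s3 s4; unfold EndN EndE at *; unfold TubN TubE ln at *; unfold SepC; omega
  · clear s1 s2 s3 s4; unfold EndE EndW at *; unfold TubE TubW ln at *; unfold SepC; omega
  · have := s3 h h'; clear s1 s2 s3 s4; unfold EndE at *; unfold TubE ln at *; unfold SepC; omega
  · clear s1 s2 s3 s4; unfold EndE EndS at *; unfold TubE TubS ln at *; unfold SepC; omega
  · clear s1 s2 s3 s4; unfold EndN EndS at *; unfold TubN TubS ln at *; unfold SepC; omega
  · clear s1 s2 s3 s4; unfold EndS EndW at *; unfold TubS TubW ln at *; unfold SepC; omega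
  · clear s1 s2 s3 s4; unfold EndE EndS at *; unfold TubE TubS ln at *; unfold SepC; omega
  · have := s4 h h'; clear s1 s2 s3 s4; unfold EndS at *; unfold TubS ln at *; unfold SepC
    rcases t with t | t | t | t | t <;> rcases t' with t' | t' | t' | t' | t' <;> omega

theorem tub_sep {m : ℤ} (hm : 1 ≤ m) {e e' c d : Cl} (h : Tub m e c) (h' : Tub m e' d) (hs : SpOk m e e') :
    c ≠ d ∧ ¬ Adj2 c d := by
  have := tub_sep_lt hm h h' hs
  unfold SepC at this
  rw [adj2_iff]
  refine ⟨?_, by omega⟩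
  rintro rfl
  omega

theorem box_stage {a b : Cl} {V E : Set Cl} {m : ℤ} (hm : 1 ≤ m) (hS : Sys a b V E) (hE : ∀ e ∈ E, EndOk m e)
    (hsp : ∀ e ∈ E, ∀ e' ∈ E, e ≠ e' → SpOk m e e')
    (hbox : ∀ c : Cl, -3 * m - 2000 ≤ c.1 → c.1 ≤ 3 * m + 2000 → -3 * m - 2000 ≤ c.2 → c.2 ≤ 3 * m + 2000 →
      c ∉ V ∧ ∀ v ∈ V, Adj2 c v → v ∈ E) :
    ∃ (C : Set Cl) (F : Set ℤ), (∀ z ∈ C, (-3 * m - 2000 ≤ z.1 ∧ z.1 ≤ 3 * m + 2000 ∧ -3 * m - 2000 ≤ z.2 ∧ z.2 ≤ 3 * m + 2000) ∧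
        (-m - 300 ≤ z.1 → -2 * m - 450 ≤ z.2 → z.2 ≤ -282 → z.2 = -282 ∧ z.1 ∈ F)) ∧
      (∀ u ∈ F, -197 ≤ u ∧ u ≤ 100) ∧ (∀ u ∈ F, ∀ v ∈ F, u < v → u + 2 ≤ v) ∧ (∃ u1 u2, ∀ u ∈ F, u = u1 ∨ u = u2) ∧
      Sys a b (V ∪ C) {z | z.2 = -282 ∧ z.1 ∈ F} := by
  have Efin := hS.finiteE
  have mE : ∀ e, e ∈ Efin.toFinset ↔ e ∈ E := fun e => Set.Finite.mem_toFinset _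
  obtain ⟨C1, c1, S1⟩ := Sys.multi Efin.toFinset (fun e => {z | Tub m e z}) (fun e => (col m e, ln (col m e))) hS
    (fun e he => (mE e).1 he) (by
      intro e he c hc
      have hb := tub_box hm hc
      obtain ⟨q1, q2⟩ := hbox c hb.1.1 hb.1.2 hb.2.1 hb.2.2
      exact ⟨q1, fun v hv hadj => tub_touch hm hc (hE v (q2 v hv hadj)) hadj⟩)
    (by
      intro e he e' he' hne c hc d hd
      exact tub_sep hm hc hd (hsp e ((mE e).1 he) e' ((mE e').1 he') hne))
    (by
      intro e he
      have h := hE e ((mE e).1 he)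
      exact ⟨tub_conn hm h, Or.inr (tub_w hm h)⟩)
  simp only [Set.mem_ofPred_eq] at c1
  -- low cells
  have low : ∀ z ∈ V ∪ C1, -205 ≤ z.1 → z.1 ≤ 110 → -300 ≤ z.2 → z.2 ≤ -280 + (z.1 + 200) / 2 + 5 →
      ∃ e ∈ E, z.1 = col m e ∧ ln z.1 ≤ z.2 := by
    intro z hz a1 a2 a3 a4
    rcases hz with hz | hz
    · exact absurd hz (hbox z (by omega) (by omega) (by omega) (by omega)).1
    · obtain ⟨e, he, ht⟩ := c1 z hz
      exact ⟨e, (mE e).1 he, tub_low hm ht a1 (by omega) (by omega) (by split_ifs <;> omega)⟩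
  set I : Set ℤ := {x | ∃ e ∈ E, x = col m e + 200} with hId
  have hI : ∀ x, x ∈ I ↔ ∃ e ∈ E, x = col m e + 200 := fun x => Iff.rfl
  clear_value I
  have Ibd : ∀ x ∈ I, 28 ≤ x ∧ x ≤ 282 := by
    intro x hx
    obtain ⟨e, he, rfl⟩ := (hI x).1 hx
    have := col_bd hm (hE e he); omega
  have Isp : ∀ x ∈ I, ∀ y ∈ I, x < y → x + 2 ≤ y := by
    intro x hx y hy hxy
    obtain ⟨e, he, rfl⟩ := (hI x).1 hx
    obtain ⟨e', he', rfl⟩ := (hI y).1 hy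
    have := col_sp hm (hE e he) (hE e' he') (hsp e he e' he' (by rintro rfl; omega))
    omega
  have low' : ∀ z : Cl, fL (-200, -280) z ∈ V ∪ C1 → -5 ≤ z.1 → z.1 ≤ 310 → -20 ≤ z.2 → z.2 ≤ z.1 / 2 + 5 →
      z.1 ∈ I ∧ (z.1 - 1) / 2 ≤ z.2 := by
    intro z hz a1 a2 a3 a4
    simp only [fL, Equiv.coe_fn_mk] at hz
    obtain ⟨e, he, h1, h2⟩ := low _ hz (by simp only; omega) (by simp only; omega) (by simp only; omega) (by simp only; omega)
    simp only [ln] at h1 h2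
    exact ⟨(hI _).2 ⟨e, he, by omega⟩, by omega⟩
  obtain ⟨C2, F, d1, d2, d3, d4, S2⟩ := core (Xm := 300) (Yl := -2) (T := 5) (by norm_num) (by norm_num) (by norm_num)
    (S1.map (fL (-200, -280)) (fL_iso _)) I (by
      intro x hx
      obtain ⟨e, he, rfl⟩ := (hI x).1 hx
      simp only [Set.mem_ofPred_eq, fL, Equiv.coe_fn_mk]
      refine Or.inr ⟨e, (mE e).2 he, ?_⟩
      refine cl_ext (by simp only; omega) ?_
      simp only [ln]; omega) (by
      intro x hx; have := Ibd x hx; omega) Isp (by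
      intro z hz hcon
      unfold Zone at hz
      have hzb : z.2 ≤ z.1 / 2 + 1 := by
        rcases hcon with h | ⟨x, hx, h⟩ <;> omega
      constructor
      · intro hzV
        obtain ⟨q1, q2⟩ := low' z hzV (by omega) (by omega) (by omega) (by omega)
        rcases hcon with h | ⟨x, hx, h⟩
        · omega
        · rcases lt_trichotomy z.1 x with hh | hh | hh
          · omega
          · omega
          · have := Isp x hx z.1 q1 hh; omega
      · intro v hv hadj
        rw [adj2_iff] at hadj
        obtain ⟨q1, q2⟩ := low' v hv (by omega) (by omega) (by omega) (by omega)
        refine ⟨v.1, q1, rfl, ?_⟩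
        rcases hcon with h | ⟨x, hx, h⟩
        · omega
        · rcases lt_trichotomy v.1 x with hh | hh | hh
          · have := Isp v.1 q1 x hx hh; omega
          · omega
          · have := Isp x hx v.1 q1 hh; omega)
  have S3 := S2.map (fL (-200, -280)).symm (iso_symm (fL_iso _))
  simp only [Equiv.symm_symm, Equiv.apply_symm_apply] at S3
  refine ⟨C1 ∪ {y | (fL (-200, -280)).symm y ∈ C2}, {u | u + 200 ∈ F}, ?_, ?_, ?_, ?_, ?_⟩
  · rintro z (hz | hz)
    · obtain ⟨e, he, ht⟩ := c1 z hz
      have hb := tub_box hm ht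
      refine ⟨by omega, ?_⟩
      intro g1 g2 g3
      have := tub_lowS hm ht g1 g2
      omega
    · obtain ⟨g1, g2⟩ := d1 _ hz
      simp only [fL, Equiv.coe_fn_symm_mk, Zone] at g1 g2
      refine ⟨by omega, ?_⟩
      intro g3 g4 g5
      refine ⟨by omega, ?_⟩
      have := g2 (by omega)
      have e : z.1 - -200 = z.1 + 200 := by omega
      rw [e] at this
      exact this
  · intro u hu; have := d2 _ hu; omega
  · intro u hu v hv huv; have := d3 _ hu _ hv (by omega); omega
  · obtain ⟨u1, u2, h⟩ := d4
    refine ⟨u1 - 200, u2 - 200, fun u hu => ?_⟩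
    have := h _ hu; omega
  · refine S3.congr (fun z => ?_) (fun z => ?_)
    · simp only [Set.mem_ofPred_eq, Set.mem_union, Equiv.apply_symm_apply, or_assoc]
    · simp only [Set.mem_ofPred_eq, Equiv.apply_symm_apply]
      have e1 : (((fL (-200, -280)).symm z).2 = -2 ∧ ((fL (-200, -280)).symm z).1 ∈ F) ↔ (z.2 = -282 ∧ z.1 + 200 ∈ F) := by
        simp only [fL, Equiv.coe_fn_symm_mk]
        have e : z.1 - -200 = z.1 + 200 := by omega
        rw [e]
        constructor
        · rintro ⟨g, g'⟩; exact ⟨by omega, g'⟩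
        · rintro ⟨g, g'⟩; exact ⟨by omega, g'⟩
      rw [e1]
      refine or_iff_right ?_
      rintro ⟨h1 | ⟨e, he, h1⟩, h2⟩
      · exact h1.2 ((mE z).2 h1.1)
      · refine h2 (col m e + 200) ((hI _).2 ⟨e, (mE e).1 he, rfl⟩) ?_
        rw [h1]
        simp only [fL, Equiv.coe_fn_symm_mk, ln]
        omega

theorem Sys.two {a b : Cl} {V E : Set Cl} (h : Sys a b V E) : ∃ e1 ∈ E, ∃ e2 ∈ E, e1 ≠ e2 := by
  obtain ⟨h1, h2, Ls, h3, h4, h5⟩ := h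
  obtain ⟨M, hM, ha⟩ := (h4 a).1 h1
  obtain ⟨h6, h7⟩ := h3.1 M hM
  match M, h6, h7, hM with
  | x :: y :: t, h6, h7, hM =>
    refine ⟨x, (h5 x).2 ⟨_, hM, Or.inl rfl⟩, (y :: t).getLast (by simp), (h5 _).2 ⟨_, hM, Or.inr ?_⟩, ?_⟩
    · rw [List.getLast?_eq_some_getLast (by simp), List.getLast_cons]
    · exact h6.not_mem _ (List.getLast_mem _)

theorem IP.exit {A : Set Cl} : ∀ {l : List Cl} {u w : Cl}, IP Adj2 (u :: l) → u ∈ A → w ∈ l → w ∉ A →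
    ∃ x ∈ u :: l, ∃ y ∈ u :: l, Adj2 x y ∧ x ∈ A ∧ y ∉ A := by
  intro l
  induction l with
  | nil => intro u w _ _ hw; cases hw
  | cons v t ih =>
    intro u w h hu hw hwA
    by_cases hv : v ∈ A
    · have hw' : w ∈ t := by
        rcases List.mem_cons.1 hw with rfl | h'
        · exact absurd hv hwA
        · exact h'
      obtain ⟨x, hx, y, hy, h1, h2, h3⟩ := ih h.tail hv hw' hwA
      exact ⟨x, List.mem_cons_of_mem _ hx, y, List.mem_cons_of_mem _ hy, h1, h2, h3⟩
    · exact ⟨u, by simp, v, by simp, h.2.1, hu, hv⟩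

theorem final_route {a b : Cl} {V : Set Cl} {F : Set ℤ} {m : ℤ} (hm : 1 ≤ m) (hF : ∀ u ∈ F, -197 ≤ u ∧ u ≤ 100)
    (hsp : ∀ u ∈ F, ∀ v ∈ F, u < v → u + 2 ≤ v) (h2 : ∃ u1 u2, ∀ u ∈ F, u = u1 ∨ u = u2)
    (hS : Sys a b V {z | z.2 = -282 ∧ z.1 ∈ F}) (hab : a ≠ b) (hnadj : ¬ Adj2 a b)
    (hV : ∀ z ∈ V, -m - 300 ≤ z.1 → z.1 ≤ m + 300 → -2 * m - 450 ≤ z.2 → z.2 ≤ -282 → z.2 = -282 ∧ z.1 ∈ F) :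
    ∃ P : List Cl, IP Adj2 P ∧ P.head? = some a ∧ P.getLast? = some b ∧ (∀ x ∈ V, x ∈ P) ∧
      (∀ x ∈ P, x ∈ V ∨ (-m - 250 ≤ x.1 ∧ x.1 ≤ m + 250 ∧ -m - 400 ≤ x.2 ∧ x.2 ≤ -283)) ∧
      (∀ x : Cl, |x.1| + |x.2 + (m + 400)| ≤ m → (x ∈ P ↔ x.2 = -(m + 400))) := by
  obtain ⟨p, q, hpF, hqF, hpq⟩ : ∃ p q, p ∈ F ∧ q ∈ F ∧ p < q := by
    obtain ⟨e1, h1, e2, h3, hne⟩ := hS.two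
    have hne' : e1.1 ≠ e2.1 := fun h => hne (cl_ext h (by rw [h1.1, h3.1]))
    rcases lt_or_gt_of_ne hne' with h | h
    · exact ⟨_, _, h1.2, h3.2, h⟩
    · exact ⟨_, _, h3.2, h1.2, h⟩
  have hpq2 := hsp p hpF q hqF hpq
  have hp := hF p hpF
  have hq := hF q hqF
  have hFpq : ∀ u ∈ F, u = p ∨ u = q := by
    obtain ⟨u1, u2, h⟩ := h2
    intro u hu
    have := h u hu; have := h p hpF; have := h q hqF
    omega
  have hS' : Sys a b V {(p, -282), (q, -282)} := by
    refine hS.congr (fun _ => Iff.rfl) ?_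
    intro z
    simp only [Set.mem_ofPred_eq, Set.mem_insert_iff, Set.mem_singleton_iff]
    constructor
    · rintro ⟨g1, g2⟩
      rcases hFpq _ g2 with g | g
      · exact Or.inl (cl_ext g g1)
      · exact Or.inr (cl_ext g g1)
    · rintro (rfl | rfl)
      · exact ⟨rfl, hpF⟩
      · exact ⟨rfl, hqF⟩
  set X : Set Cl := {z | (z.1 = p ∧ -284 ≤ z.2 ∧ z.2 ≤ -283) ∨ (z.2 = -284 ∧ -m - 250 ≤ z.1 ∧ z.1 ≤ p) ∨
    (z.1 = -m - 250 ∧ -m - 400 ≤ z.2 ∧ z.2 ≤ -284) ∨ (z.2 = -m - 400 ∧ -m - 250 ≤ z.1 ∧ z.1 ≤ m + 250) ∨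
    (z.1 = m + 250 ∧ -m - 400 ≤ z.2 ∧ z.2 ≤ -284) ∨ (z.2 = -284 ∧ q ≤ z.1 ∧ z.1 ≤ m + 250) ∨
    (z.1 = q ∧ -284 ≤ z.2 ∧ z.2 ≤ -283)} with hXd
  have hX : ∀ z, z ∈ X ↔ ((z.1 = p ∧ -284 ≤ z.2 ∧ z.2 ≤ -283) ∨ (z.2 = -284 ∧ -m - 250 ≤ z.1 ∧ z.1 ≤ p) ∨
    (z.1 = -m - 250 ∧ -m - 400 ≤ z.2 ∧ z.2 ≤ -284) ∨ (z.2 = -m - 400 ∧ -m - 250 ≤ z.1 ∧ z.1 ≤ m + 250) ∨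
    (z.1 = m + 250 ∧ -m - 400 ≤ z.2 ∧ z.2 ≤ -284) ∨ (z.2 = -284 ∧ q ≤ z.1 ∧ z.1 ≤ m + 250) ∨
    (z.1 = q ∧ -284 ≤ z.2 ∧ z.2 ≤ -283)) := fun z => Iff.rfl
  clear_value X
  have hXb : ∀ z ∈ X, -m - 250 ≤ z.1 ∧ z.1 ≤ m + 250 ∧ -m - 400 ≤ z.2 ∧ z.2 ≤ -283 := by
    intro z hz; have := (hX z).1 hz; omega
  have hclear : Clear V {(p, -282), (q, -282)} X := by
    intro c hc
    have hb := hXb c hc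
    constructor
    · intro h; have := hV c h (by omega) (by omega) (by omega) (by omega); omega
    · intro v hv hadj
      rw [adj2_iff] at hadj
      obtain ⟨g1, g2⟩ := hV v hv (by omega) (by omega) (by omega) (by omega)
      rcases hFpq _ g2 with g | g
      · exact Or.inl (cl_ext g g1)
      · exact Or.inr (cl_ext g g1)
  have hconn : Conn (X ∪ {(q, -282)}) (p, -282) (q, -282) := by
    have c1 : Conn X (p, -282) (p, -284) := Conn.down (by omega) (fun y y1 y2 => (hX _).2 (by left; simp only [true_and]; omega))
    have c2 : Conn X (p, -284) (-m - 250, -284) := Conn.leftw (by omega) (fun y y1 y2 => (hX _).2 (by right; left; simp only [true_and]; omega))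
    have c3 : Conn X (-m - 250, -284) (-m - 250, -m - 400) := Conn.down (by omega) (fun y y1 y2 => (hX _).2 (by right; right; left; simp only [true_and]; omega))
    have c4 : Conn X (-m - 250, -m - 400) (m + 250, -m - 400) := Conn.right (by omega) (fun y y1 y2 => (hX _).2 (by right; right; right; left; simp only [true_and]; omega))
    have c5 : Conn X (m + 250, -m - 400) (m + 250, -284) := Conn.up (by omega) (fun y y1 y2 => (hX _).2 (by right; right; right; right; left; simp only [true_and]; omega))
    have c6 : Conn X (m + 250, -284) (q, -284) := Conn.leftw (by omega) (fun y y1 y2 => (hX _).2 (by right; right; right; right; right; left; simp only [true_and]; omega))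
    have c7 : Conn X (q, -284) (q, -283) := Conn.up (by omega) (fun y y1 y2 => (hX _).2 (by right; right; right; right; right; right; simp only [true_and]; omega))
    have c8 : Conn (X ∪ {(q, -282)}) (q, -283) (q, -282) := Conn.single ((adj2_iff _ _).2 (by simp)) (Or.inr rfl)
    exact ((c1.trans (c2.trans (c3.trans (c4.trans (c5.trans (c6.trans c7)))))).mono Set.subset_union_left).trans c8
  obtain ⟨C, P, r1, r2, r3, r4, r5, r6⟩ := hS'.final (by intro h; have := congrArg Prod.fst h; simp only at this; omega) hab hnadj hclear hconn
  refine ⟨P, r3, r4, r5, fun x hx => (r6 x).2 (Or.inl hx), ?_, ?_⟩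
  · intro x hx
    rcases (r6 x).1 hx with h | h
    · exact Or.inl h
    · exact Or.inr (hXb x (r2 x h))
  · intro x hx
    have hxb : (-m ≤ x.1 ∧ x.1 ≤ m) ∧ -m ≤ x.2 + (m + 400) ∧ x.2 + (m + 400) ≤ m := by
      have g1 := abs_nonneg x.1
      have g2 := abs_nonneg (x.2 + (m + 400))
      exact ⟨abs_le.1 (by omega), abs_le.1 (by omega)⟩
    constructor
    · intro h
      rcases (r6 x).1 h with h | h
      · have := hV x h (by omega) (by omega) (by omega) (by omega); omega
      · have := (hX x).1 (r2 x h); omega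
    · intro hrow
      refine (r6 x).2 (Or.inr ?_)
      obtain ⟨u, hu, v, hv, h1, h3, h4⟩ := IP.exit (A := {z : Cl | (-m - 400 < z.2 ∧ z.1 ≤ p) ∨ (z.2 = -m - 400 ∧ z.1 < x.1)})
        (w := (q, -282)) r1 (by left; simp only; omega) (by simp) (by
          simp only [Set.mem_ofPred_eq]; omega)
      rw [adj2_iff] at h1
      simp only [Set.mem_ofPred_eq] at h3 h4
      have hcl : ∀ z ∈ (p, -282) :: (C ++ [(q, -282)]), (z.1 = p ∧ z.2 = -282) ∨ (z.1 = q ∧ z.2 = -282) ∨ (z ∈ X ∧ z ∈ C) := by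
        intro z hz
        simp only [List.mem_cons, List.mem_append, List.not_mem_nil, or_false] at hz
        rcases hz with rfl | h | rfl
        · exact Or.inl ⟨rfl, rfl⟩
        · exact Or.inr (Or.inr ⟨r2 z h, h⟩)
        · exact Or.inr (Or.inl ⟨rfl, rfl⟩)
      have gu : (u.1 = p ∧ u.2 = -282) ∨ (u.1 = q ∧ u.2 = -282) ∨ u ∈ X := by
        rcases hcl u hu with h | h | h
        · exact Or.inl h
        · exact Or.inr (Or.inl h)
        · exact Or.inr (Or.inr h.1)
      rw [hX] at gu
      rcases hcl v hv with g | g | ⟨g, g'⟩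
      · omega
      · omega
      · rw [hX] at g
        have : x.1 = v.1 ∧ x.2 = v.2 := by omega
        rw [show x = v from cl_ext this.1 this.2]
        exact g'

theorem IP.adj_mid {S T : List Cl} {p : Cl} (h : IP Adj2 (S ++ p :: T)) :
    (∀ q T', T = q :: T' → Adj2 p q) ∧ (∀ q S', S = S' ++ [q] → Adj2 p q) := by
  constructor
  · rintro q T' rfl
    exact h.right.2.1
  · rintro q S' rfl
    have : IP Adj2 (S' ++ q :: p :: T) := by simpa using h
    exact adj2_symm this.right.2.1

theorem IP.deg3 {P : List Cl} (h : IP Adj2 P) : Deg3 {x | x ∈ P} := by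
  intro p hp q1 h1 q2 h2 q3 h3 a1 a2 a3 n12 n13 n23
  obtain ⟨S, T, rfl⟩ := List.append_of_mem hp
  have hloc : ∀ q, q ∈ S ++ p :: T → Adj2 p q → (∃ S', S = S' ++ [q]) ∨ ∃ T', T = q :: T' := by
    intro q hq ha
    rw [List.mem_append, List.mem_cons] at hq
    rcases hq with hq | hq | hq
    · exact Or.inl (h.consec' (fun _ _ => adj2_symm) hq ha)
    · exact absurd hq.symm (adj2_ne ha)
    · exact Or.inr (h.consec hq ha)
  have hS : ∀ q q' S1 S2, S = S1 ++ [q] → S = S2 ++ [q'] → q = q' := by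
    intro q q' S1 S2 e1 e2
    rw [e1] at e2
    have := congrArg List.getLast? e2
    simpa using this
  have hT : ∀ q q' S1 S2, T = q :: S1 → T = q' :: S2 → q = q' := by
    intro q q' S1 S2 e1 e2
    rw [e1] at e2
    exact (List.cons.inj e2).1
  rcases hloc q1 h1 a1 with ⟨s1, e1⟩ | ⟨s1, e1⟩ <;> rcases hloc q2 h2 a2 with ⟨s2, e2⟩ | ⟨s2, e2⟩ <;>
    rcases hloc q3 h3 a3 with ⟨s3, e3⟩ | ⟨s3, e3⟩
  · exact n12 (hS _ _ _ _ e1 e2)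
  · exact n12 (hS _ _ _ _ e1 e2)
  · exact n13 (hS _ _ _ _ e1 e3)
  · exact n23 (hT _ _ _ _ e2 e3)
  · exact n23 (hS _ _ _ _ e2 e3)
  · exact n13 (hT _ _ _ _ e1 e3)
  · exact n12 (hT _ _ _ _ e1 e2)
  · exact n12 (hT _ _ _ _ e1 e2)

theorem IP.two_nb {P : List Cl} (h : IP Adj2 P) {a b z : Cl} (ha : P.head? = some a) (hb : P.getLast? = some b)
    (hz : z ∈ P) (hza : z ≠ a) (hzb : z ≠ b) (p : Cl) : ∃ q ∈ P, q ≠ p ∧ Adj2 z q := by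
  obtain ⟨S, T, rfl⟩ := List.append_of_mem hz
  have g := h.adj_mid
  rcases List.eq_nil_or_concat S with rfl | ⟨S', q1, rfl⟩
  · simp at ha; exact absurd ha hza
  rcases T with _ | ⟨q2, T'⟩
  · simp at hb; exact absurd hb hzb
  have n12 : q1 ≠ q2 := (h.cross q1 (by simp) q2 (by simp)).1
  by_cases hp : q1 = p
  · exact ⟨q2, by simp, by rw [← hp]; exact n12.symm, g.1 q2 T' rfl⟩
  · exact ⟨q1, by simp, hp, g.2 q1 S' (by simp)⟩

theorem IP.one_nb {P : List Cl} (h : IP Adj2 P) {z w : Cl} (hz : z ∈ P) (hw : w ∈ P) (hzw : z ≠ w) :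
    ∃ q ∈ P, Adj2 z q := by
  obtain ⟨S, T, rfl⟩ := List.append_of_mem hz
  have g := h.adj_mid
  rcases T with _ | ⟨q2, T'⟩
  · rcases List.eq_nil_or_concat S with rfl | ⟨S', q1, rfl⟩
    · simp at hw; exact absurd hw.symm hzw
    · exact ⟨q1, by simp, g.2 q1 S' (by simp)⟩
  · exact ⟨q2, by simp, g.1 q2 T' rfl⟩

theorem IP.block {P : List Cl} (h : IP Adj2 P) (x y : ℤ) :
    ∃ v : Cl, (x ≤ v.1 ∧ v.1 ≤ x + 1) ∧ (y ≤ v.2 ∧ v.2 ≤ y + 1) ∧ v ∉ P := by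
  by_contra hcon
  push Not at hcon
  have m1 := hcon (x, y) (by simp) (by simp)
  have m2 := hcon (x + 1, y) (by simp) (by simp)
  have m3 := hcon (x, y + 1) (by simp) (by simp)
  have m4 := hcon (x + 1, y + 1) (by simp) (by simp)
  have a12 : Adj2 (x, y) (x + 1, y) := (adj2_mk _ _ _ _).2 (by omega)
  have a13 : Adj2 (x, y) (x, y + 1) := (adj2_mk _ _ _ _).2 (by omega)
  have a24 : Adj2 (x + 1, y) (x + 1, y + 1) := (adj2_mk _ _ _ _).2 (by omega)
  have a34 : Adj2 (x, y + 1) (x + 1, y + 1) := (adj2_mk _ _ _ _).2 (by omega)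
  obtain ⟨S, T, rfl⟩ := List.append_of_mem m1
  have hx := h.cross
  have side : ∀ q, q ∈ S ++ (x, y) :: T → q ≠ (x, y) → q ∈ S ∨ q ∈ T := by
    intro q hq hne
    rw [List.mem_append, List.mem_cons] at hq
    rcases hq with hq | hq | hq
    · exact Or.inl hq
    · exact absurd hq hne
    · exact Or.inr hq
  have n23 : ((x + 1, y) : Cl) ≠ (x, y + 1) := by intro e; have := congrArg Prod.fst e; simp at this
  have n14 : ((x + 1, y + 1) : Cl) ≠ (x, y) := by intro e; have := congrArg Prod.fst e; simp at this
  rcases side _ m2 (adj2_ne a12).symm with s2 | s2 <;> rcases side _ m3 (adj2_ne a13).symm with s3 | s3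
  · obtain ⟨u, e⟩ := h.consec' (fun _ _ => adj2_symm) s2 a12
    obtain ⟨u', e'⟩ := h.consec' (fun _ _ => adj2_symm) s3 a13
    rw [e] at e'
    have := congrArg List.getLast? e'
    simp at this
  · rcases side _ m4 n14 with s4 | s4
    · exact (hx _ s4 _ s3).2 (adj2_symm a34)
    · exact (hx _ s2 _ s4).2 a24
  · rcases side _ m4 n14 with s4 | s4
    · exact (hx _ s4 _ s2).2 (adj2_symm a24)
    · exact (hx _ s3 _ s4).2 a34
  · obtain ⟨u, e⟩ := h.consec s2 a12
    obtain ⟨u', e'⟩ := h.consec s3 a13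
    rw [e] at e'
    exact n23 (List.cons.inj e').1

theorem IP.ends {P : List Cl} (h : IP Adj2 P) {a b z : Cl} (ha : P.head? = some a) (hb : P.getLast? = some b)
    (hz : z ∈ P) (hza : z ≠ a) (hzb : z ≠ b) : a ≠ b ∧ ¬ Adj2 a b := by
  obtain ⟨S, T, rfl⟩ := List.append_of_mem hz
  rcases S with _ | ⟨s, S⟩
  · simp at ha; exact absurd ha hza
  rcases List.eq_nil_or_concat T with rfl | ⟨T', t, rfl⟩
  · rw [List.getLast?_append] at hb
    simp at hb; exact absurd hb hzb
  have e1 : s = a := by simpa using ha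
  have e2 : t = b := by
    have : (s :: S ++ z :: (T' ++ [t])) = (s :: S ++ z :: T') ++ [t] := by simp
    rw [List.concat_eq_append, this, List.getLast?_append] at hb
    simpa using hb
  subst e1 e2
  exact h.cross s (by simp) t (by simp)

theorem IP_iff (P : List Cl) (hne : P ≠ []) : IsInducedPath2 P ↔ IP Adj2 P := by
  have key : ∀ P : List Cl, (P.Nodup ∧ P.IsChain Adj2 ∧ ∀ i j : ℕ, ∀ (hi : i < P.length) (hj : j < P.length), i + 1 < j →
      ¬ Adj2 P[i] P[j]) ↔ IP Adj2 P := by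
    intro P
    induction P with
    | nil => simp [IP]
    | cons x t ih =>
      cases t with
      | nil => simp [IP]
      | cons y t =>
        unfold IP
        rw [← ih]
        constructor
        · rintro ⟨h1, h2, h3⟩
          rw [List.isChain_cons_cons] at h2
          refine ⟨adj2_ne h2.1, h2.1, ?_, (List.nodup_cons.1 h1).2, h2.2, ?_⟩
          · intro z hz
            refine ⟨?_, ?_⟩
            · rintro rfl
              exact (List.nodup_cons.1 h1).1 (List.mem_cons_of_mem _ hz)
            · obtain ⟨k, hk, rfl⟩ := List.getElem_of_mem hz
              have := h3 0 (k + 2) (by simp) (by simp; omega) (by omega)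
              simpa using this
          · intro i j hi hj hij
            have := h3 (i + 1) (j + 1) (by simpa using hi) (by simpa using hj) (by omega)
            simpa using this
        · rintro ⟨h1, h2, h3, h4, h5, h6⟩
          refine ⟨?_, List.isChain_cons_cons.2 ⟨h2, h5⟩, ?_⟩
          · refine List.nodup_cons.2 ⟨?_, h4⟩
            intro hx
            rcases List.mem_cons.1 hx with h | h
            · exact h1 h
            · exact (h3 x h).1 rfl
          · intro i j hi hj hij
            rcases i with _ | i
            · obtain ⟨k, rfl⟩ : ∃ k, j = k + 2 := ⟨j - 2, by omega⟩
              simp only [List.getElem_cons_zero, List.getElem_cons_succ]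
              exact (h3 _ (List.getElem_mem _)).2
            · obtain ⟨k, rfl⟩ : ∃ k, j = k + 1 := ⟨j - 1, by omega⟩
              simp only [List.getElem_cons_succ]
              exact h6 i k (by simpa using hi) (by simpa using hj) (by omega)
  rw [← key]
  unfold IsInducedPath2 IsPath2
  constructor
  · rintro ⟨⟨_, h1, h2⟩, h3⟩
    exact ⟨h1, h2, fun i j hi hj hij => h3 ⟨i, hi⟩ ⟨j, hj⟩ hij⟩
  · rintro ⟨h1, h2, h3⟩
    exact ⟨⟨hne, h1, h2⟩, fun i j hij => h3 i j i.2 j.2 hij⟩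

theorem main_c {a b : Cl} {P : List Cl} {m : ℤ} (hm : 1 ≤ m) (hP : IP Adj2 P) (ha : P.head? = some a)
    (hb : P.getLast? = some b) (hO : (0, -(m + 400)) ∈ P)
    (hna : |a.1| + |a.2 + (m + 400)| > 20 * m + 13000 + 2) (hnb : |b.1| + |b.2 + (m + 400)| > 20 * m + 13000 + 2) :
    ∃ P' : List Cl, IP Adj2 P' ∧ P'.head? = some a ∧ P'.getLast? = some b ∧
      (∀ x : Cl, |x.1| + |x.2 + (m + 400)| > 20 * m + 13000 → (x ∈ P' ↔ x ∈ P)) ∧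
      (∀ x : Cl, |x.1| + |x.2 + (m + 400)| ≤ m → (x ∈ P' ↔ x.2 = -(m + 400))) := by
  obtain ⟨v1, p1, q1, n1⟩ := hP.block (-(3 * m + 2020) - 1) (3 * m + 2020)
  obtain ⟨v2, p2, q2, n2⟩ := hP.block (3 * m + 2020) (3 * m + 2020)
  obtain ⟨v3, p3, q3, n3⟩ := hP.block (3 * m + 2020) (-(3 * m + 2020) - 1)
  obtain ⟨v4, p4, q4, n4⟩ := hP.block (-(3 * m + 2020) - 1) (-(3 * m + 2020) - 1)
  have K : Corners (3 * m + 2020) v1 v2 v3 v4 :=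
    ⟨by omega, ⟨by omega, by omega⟩, ⟨by omega, by omega⟩, ⟨by omega, by omega⟩, ⟨by omega, by omega⟩⟩
  have hDm : ∀ z, z ∈ Oct v1 v2 v3 v4 ↔ ((2 * (z.2 - v1.2) ≤ z.1 - v1.1 ∧ z.2 - v1.2 ≤ 2 * (z.1 - v1.1)) ∧
    (2 * (z.2 - v2.2) ≤ v2.1 - z.1 ∧ z.2 - v2.2 ≤ 2 * (v2.1 - z.1)) ∧
    (2 * (v3.2 - z.2) ≤ v3.1 - z.1 ∧ v3.2 - z.2 ≤ 2 * (v3.1 - z.1)) ∧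
    (2 * (v4.2 - z.2) ≤ z.1 - v4.1 ∧ v4.2 - z.2 ≤ 2 * (z.1 - v4.1))) := fun z => Iff.rfl
  have hin : ∀ z : Cl, -(3 * m + 2020) ≤ z.1 → z.1 ≤ 3 * m + 2020 → -(3 * m + 2020) ≤ z.2 → z.2 ≤ 3 * m + 2020 →
      z ∈ Oct v1 v2 v3 v4 := by
    intro z h1 h2 h3 h4
    rw [hDm]
    omega
  have hout : ∀ z ∈ Oct v1 v2 v3 v4, |z.1| + |z.2 + (m + 400)| < 20 * m + 13000 := by
    intro z hz
    rw [hDm] at hz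
    have hb1 : -(6 * m + 4050) ≤ z.1 ∧ z.1 ≤ 6 * m + 4050 ∧ -(6 * m + 4050) ≤ z.2 ∧ z.2 ≤ 6 * m + 4050 := by omega
    clear hz hin hDm K hna hnb p1 q1 p2 q2 p3 q3 p4 q4
    have := abs_cases z.1
    have := abs_cases (z.2 + (m + 400))
    omega
  have hnbn : ∀ z w : Cl, Adj2 z w → |z.1| + |z.2 + (m + 400)| > 20 * m + 13000 →
      |w.1| + |w.2 + (m + 400)| ≥ 20 * m + 13000 := by
    intro z w h h'
    rw [adj2_iff] at h
    clear hin hDm K hna hnb p1 q1 p2 q2 p3 q3 p4 q4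
    have := abs_cases z.1
    have := abs_cases (z.2 + (m + 400))
    have := abs_cases w.1
    have := abs_cases (w.2 + (m + 400))
    omega
  have hVin : ∀ z ∈ VV {x | x ∈ P} (Oct v1 v2 v3 v4),
      ¬ (-(3 * m + 2019) ≤ z.1 ∧ z.1 ≤ 3 * m + 2019 ∧ -(3 * m + 2019) ≤ z.2 ∧ z.2 ≤ 3 * m + 2019) := by
    rintro z hz ⟨h1, h2, h3, h4⟩
    obtain ⟨q, hq, hadj⟩ := VV_nb hz
    rw [adj2_iff] at hadj
    exact hq.2.1 (hin q (by omega) (by omega) (by omega) (by omega))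
  have hKK : ∀ z ∈ P, |z.1| + |z.2 + (m + 400)| > 20 * m + 13000 → z ∈ KK {x | x ∈ P} (Oct v1 v2 v3 v4) := by
    intro z hz hn
    obtain ⟨q, hq, hadj⟩ := hP.one_nb hz hO (by
      rintro rfl
      simp only [neg_add_cancel, abs_zero] at hn
      omega)
    refine ⟨hz, fun h => ?_, q, hq, fun h => ?_, hadj⟩
    · have := hout z h; omega
    · have := hout q h; have := hnbn z q hadj hn; omega
  have haP : a ∈ P := List.mem_of_mem_head? (by rw [ha]; simp)
  have hbP : b ∈ P := List.mem_of_mem_getLast? (by rw [hb]; simp)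
  have haK := hKK a haP (by omega)
  have hbK := hKK b hbP (by omega)
  have hOa : ((0, -(m + 400)) : Cl) ≠ a := by
    rintro rfl
    simp only [neg_add_cancel, abs_zero] at hna
    omega
  have hOb : ((0, -(m + 400)) : Cl) ≠ b := by
    rintro rfl
    simp only [neg_add_cancel, abs_zero] at hnb
    omega
  obtain ⟨hab, hnadj⟩ := hP.ends ha hb hO hOa hOb
  have hd2 : Deg2 {x | x ∈ P} (Oct v1 v2 v3 v4) := by
    intro z hz hD p
    refine hP.two_nb ha hb hz ?_ ?_ p
    · rintro rfl; exact haK.2.1 hD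
    · rintro rfl; exact hbK.2.1 hD
  have S0 : Sys a b (VV {x | x ∈ P} (Oct v1 v2 v3 v4)) (EE {x | x ∈ P} (Oct v1 v2 v3 v4)) := by
    refine sys_init hP ha hb hO _ ?_ (KK_VV haK) (KK_VV hbK) (fun x hx => hx.1) ?_
    · intro h
      exact hVin _ h (by simp only; omega)
    · intro x hx
      obtain ⟨q, hq, h⟩ := VV_nb hx
      exact ⟨q, KK_VV hq, h⟩
  obtain ⟨C, FN, FW, FS, FE, hC, ⟨N1, N2⟩, ⟨W1, W2⟩, ⟨S1, S2⟩, ⟨E1, E2⟩, hS⟩ :=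
    four K hP.deg3 hd2 n1 n2 n3 n4 S0
  clear p1 q1 p2 q2 p3 q3 p4 q4 K hDm hin
  obtain ⟨C2, F, hC2, hF, hFs, hF2, hS2⟩ := box_stage hm hS
    (by
      rintro e (⟨h, h'⟩ | ⟨h, h'⟩ | ⟨h, h'⟩ | ⟨h, h'⟩)
      · have := N1 _ h'; left; unfold EndN; omega
      · have := W1 _ h'; right; left; unfold EndW; omega
      · have := S1 _ h'; right; right; right; unfold EndS; omega
      · have := E1 _ h'; right; right; left; unfold EndE; omega)
    (by
      have red : ∀ e ∈ {z : Cl | (z.2 = 3 * m + 2020 - 19 ∧ z.1 ∈ FN) ∨ (-z.1 = 3 * m + 2020 - 19 ∧ z.2 ∈ FW) ∨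
          (-z.2 = 3 * m + 2020 - 19 ∧ -z.1 ∈ FS) ∨ (z.1 = 3 * m + 2020 - 19 ∧ -z.2 ∈ FE)},
          (EndN m e → e.1 ∈ FN) ∧ (EndW m e → e.2 ∈ FW) ∧ (EndS m e → -e.1 ∈ FS) ∧ (EndE m e → -e.2 ∈ FE) := by
        rintro e (⟨h, h'⟩ | ⟨h, h'⟩ | ⟨h, h'⟩ | ⟨h, h'⟩)
        · have := N1 _ h'
          refine ⟨fun _ => h', fun g => ?_, fun g => ?_, fun g => ?_⟩ <;> exfalso <;> simp only [EndW, EndS, EndE] at g <;> omega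
        · have := W1 _ h'
          refine ⟨fun g => ?_, fun _ => h', fun g => ?_, fun g => ?_⟩ <;> exfalso <;> simp only [EndN, EndS, EndE] at g <;> omega
        · have := S1 _ h'
          refine ⟨fun g => ?_, fun g => ?_, fun _ => h', fun g => ?_⟩ <;> exfalso <;> simp only [EndN, EndW, EndE] at g <;> omega
        · have := E1 _ h'
          refine ⟨fun g => ?_, fun g => ?_, fun g => ?_, fun _ => h'⟩ <;> exfalso <;> simp only [EndN, EndW, EndS] at g <;> omega
      intro e he e' he' hne
      have r1 := red e he
      have r2 := red e' he'
      have hne' : ¬ (e.1 = e'.1 ∧ e.2 = e'.2) := fun h => hne (cl_ext h.1 h.2)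
      clear hC hS S0 he he'
      refine ⟨fun g g' => ?_, fun g g' => ?_, fun g g' => ?_, fun g g' => ?_⟩
      · have h := r1.1 g
        have h' := r2.1 g'
        have := N2 _ h _ h'
        have := N2 _ h' _ h
        unfold EndN at g g'
        omega
      · have h := r1.2.1 g
        have h' := r2.2.1 g'
        have := W2 _ h _ h'
        have := W2 _ h' _ h
        unfold EndW at g g'
        omega
      · have h := r1.2.2.2 g
        have h' := r2.2.2.2 g'
        have := E2 _ h _ h'
        have := E2 _ h' _ h
        unfold EndE at g g'
        omega
      · have h := r1.2.2.1 g
        have h' := r2.2.2.1 g'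
        have := S2 _ h _ h'
        have := S2 _ h' _ h
        unfold EndS at g g'
        omega)
    (by
      intro c c1 c2 c3 c4
      constructor
      · rintro (h | h)
        · exact hVin _ h ⟨by omega, by omega, by omega, by omega⟩
        · have := (hC _ h).2; omega
      · intro v hv hadj
        rw [adj2_iff] at hadj
        rcases hv with h | h
        · exact absurd ⟨by omega, by omega, by omega, by omega⟩ (hVin _ h)
        · rcases (hC _ h).2 with ⟨g, g'⟩ | ⟨g, g'⟩ | ⟨g, g'⟩ | ⟨g, g'⟩
          · have e : v.2 = 3 * m + 2020 - 19 := by omega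
            exact Or.inl ⟨e, g' e⟩
          · have e : -v.1 = 3 * m + 2020 - 19 := by omega
            exact Or.inr (Or.inl ⟨e, g' e⟩)
          · have e : -v.2 = 3 * m + 2020 - 19 := by omega
            exact Or.inr (Or.inr (Or.inl ⟨e, g' e⟩))
          · have e : v.1 = 3 * m + 2020 - 19 := by omega
            exact Or.inr (Or.inr (Or.inr ⟨e, g' e⟩)))
  obtain ⟨P', r1, r2, r3, r4, r5, r6⟩ := final_route hm hF hFs hF2 hS2 hab hnadj (by
    intro z hz c1 c2 c3 c4
    rcases hz with (hz | hz) | hz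
    · exact absurd ⟨by omega, by omega, by omega, by omega⟩ (hVin _ hz)
    · have := (hC _ hz).2; exfalso; omega
    · exact (hC2 _ hz).2 c1 c3 c4)
  refine ⟨P', r1, r2, r3, ?_, r6⟩
  intro x hx
  have x1 := abs_cases x.1
  have x2 := abs_cases (x.2 + (m + 400))
  constructor
  · intro h
    rcases r5 x h with ((h | h) | h) | h
    · exact h.1
    · have := (hC _ h).1; exfalso; omega
    · have := (hC2 _ h).1; exfalso; omega
    · exfalso; omega
  · intro h
    exact r4 x (Or.inl (Or.inl (KK_VV (hKK x h hx))))

theorem statement2 (m : ℤ) (hm : 1 ≤ m) :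
    ∃ r : ℤ, 0 < r ∧
      ∀ (P : List (ℤ × ℤ)) (hne : P ≠ []),
        IsInducedPath2 P → (0 : ℤ × ℤ) ∈ P →
        norm1 (P.head hne) > r + 2 → norm1 (P.getLast hne) > r + 2 →
        ∃ (P' : List (ℤ × ℤ)) (hne' : P' ≠ []),
          IsInducedPath2 P' ∧
          P'.head hne' = P.head hne ∧
          P'.getLast hne' = P.getLast hne ∧
          (∀ x : ℤ × ℤ, norm1 x > r → (x ∈ P' ↔ x ∈ P)) ∧
          (∀ x : ℤ × ℤ, (x ∈ P' ∧ norm1 x ≤ m) ↔ ∃ i : ℤ, -m ≤ i ∧ i ≤ m ∧ x = (i, 0)) := by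
  refine ⟨20 * m + 13000, by omega, ?_⟩
  intro P hne hP hO hna hnb
  have hIP := (IP_iff P hne).1 hP
  let f : Cl → Cl := fun z => (z.1, z.2 - (m + 400))
  let g : Cl → Cl := fun z => (z.1, z.2 + (m + 400))
  have fi : Function.Injective f := by
    rintro ⟨x, y⟩ ⟨x', y'⟩ h
    simp only [f, Prod.mk.injEq] at h
    exact Prod.ext h.1 (by simp only; omega)
  have gi : Function.Injective g := by
    rintro ⟨x, y⟩ ⟨x', y'⟩ h
    simp only [g, Prod.mk.injEq] at h
    exact Prod.ext h.1 (by simp only; omega)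
  have fg : ∀ z, f (g z) = z := by rintro ⟨x, y⟩; simp [f, g]
  have gf : ∀ z, g (f z) = z := by rintro ⟨x, y⟩; simp [f, g]
  obtain ⟨P', r1, r2, r3, r4, r5⟩ := main_c (a := f (P.head hne)) (b := f (P.getLast hne)) (P := P.map f) hm
    (hIP.map f fi (by
      intro x y
      simp only [f, adj2_iff]
      omega))
    (by rw [List.head?_map, List.head?_eq_some_head hne]; rfl)
    (by rw [List.getLast?_map, List.getLast?_eq_some_getLast hne]; rfl)
    (List.mem_map.2 ⟨0, hO, by simp [f]⟩)
    (by simpa [f, norm1] using hna) (by simpa [f, norm1] using hnb)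
  have hne' : P'.map g ≠ [] := by
    intro h
    rw [List.map_eq_nil_iff] at h
    subst h
    simp at r2
  have mg : ∀ x, x ∈ P'.map g ↔ f x ∈ P' := by
    intro x
    rw [List.mem_map]
    constructor
    · rintro ⟨y, hy, rfl⟩; rwa [fg]
    · intro h; exact ⟨f x, h, gf x⟩
  have mf : ∀ x, f x ∈ P.map f ↔ x ∈ P := fun x => List.mem_map_of_injective fi
  refine ⟨P'.map g, hne', (IP_iff _ hne').2 (r1.map g gi ?_), ?_, ?_, ?_, ?_⟩
  · intro x y
    simp only [g, adj2_iff]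
    omega
  · have : (P'.map g).head? = some (P.head hne) := by
      rw [List.head?_map, r2, Option.map_some, gf]
    rw [List.head?_eq_some_head hne'] at this
    exact Option.some.inj this
  · have : (P'.map g).getLast? = some (P.getLast hne) := by
      rw [List.getLast?_map, r3, Option.map_some, gf]
    rw [List.getLast?_eq_some_getLast hne'] at this
    exact Option.some.inj this
  · intro x hx
    rw [mg, r4 (f x) (by simpa [f, norm1] using hx), mf]
  · intro x
    rw [mg]
    constructor
    · rintro ⟨h1, h2⟩
      have h3 := (r5 (f x) (by simpa [f, norm1] using h2)).1 h1
      simp only [f] at h3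
      have h0 : x.2 = 0 := by omega
      unfold norm1 at h2
      have := abs_cases x.1
      have := abs_cases x.2
      exact ⟨x.1, by omega, by omega, cl_ext rfl h0⟩
    · rintro ⟨i, h1, h2, rfl⟩
      have h3 : norm1 (i, 0) ≤ m := by
        have := abs_cases i
        simp only [norm1, abs_zero]
        omega
      exact ⟨(r5 (f (i, 0)) (by simpa [f, norm1] using h3)).2 (by simp [f]), h3⟩
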